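/- arXiv:2204.01170 — 8 statements merged into one kernel-verified Lean document; each statement's English description precedes it below -/
import Mathlib

section
/- Emergence of the viscous shock profile from the leading inner term (final Proposition of Appendix A): For every ξ ∈ ℝ there exist constants C > 0 and T₀ > 0 such that for all T ≥ T₀: |Φ(T, T^(−1/2)·ξ) + (T/β₃)^(1/2)·tanh(ξ/(2·√β₃))| ≤ C·T^(1/2)·T^(−2). Equivalently, Φ(T, T^(−1/2)·ξ) = (T/β₃)^(1/2)·σ(ξ/√β₃)·(1 + O_ξ(T^(−2))) as T → ∞, where σ(ξ) := −tanh(ξ/2) is the stationary unit-viscosity shock profile. -/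
open Set MeasureTheory

/-- The Gibbs weight of the quartic double well with minima at `±1`. -/
noncomputable def wellWeight (L s : ℝ) : ℝ := Real.exp (-L * (s ^ 2 - 1) ^ 2)

lemma wellWeight_pos (L s : ℝ) : 0 < wellWeight L s := Real.exp_pos _

lemma wellWeight_neg (L s : ℝ) : wellWeight L (-s) = wellWeight L s := by
  simp [wellWeight]

lemma continuous_wellWeight (L : ℝ) : Continuous (wellWeight L) := by
  unfold wellWeight
  fun_prop

lemma hasDerivAt_wellWeight (L s : ℝ) :
    HasDerivAt (wellWeight L) (-4 * L * s * (s ^ 2 - 1) * wellWeight L s) s := by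
  have h : HasDerivAt (fun s : ℝ => -L * (s ^ 2 - 1) ^ 2) (-4 * L * s * (s ^ 2 - 1)) s := by
    refine (((((hasDerivAt_id' s).fun_pow 2).sub_const 1).fun_pow 2).const_mul (-L)).congr_deriv ?_
    push_cast
    ring
  refine h.exp.congr_deriv ?_
  rw [wellWeight]
  ring

lemma integrable_mul_wellWeight {f : ℝ → ℝ} (hf : Continuous f) {K b L : ℝ} (hL : 1 ≤ L)
    (hK : ∀ s, |f s| ≤ K * Real.exp (b * |s|)) :
    Integrable (fun s => f s * wellWeight L s) := by
  have hK0 : 0 ≤ K := by simpa using (abs_nonneg _).trans (hK 0)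
  refine ((integrable_exp_neg_mul_sq (b := 1 / 2) (by norm_num)).const_mul
    (K * Real.exp (b ^ 2 / 2 + 5 / 4))).mono'
    (hf.mul (continuous_wellWeight L)).aestronglyMeasurable
    (Filter.Eventually.of_forall fun s => ?_)
  rw [Real.norm_eq_abs, abs_mul, abs_of_pos (wellWeight_pos L s)]
  calc |f s| * wellWeight L s ≤ K * Real.exp (b * |s|) * wellWeight L s :=
        mul_le_mul_of_nonneg_right (hK s) (wellWeight_pos L s).le
    _ = K * Real.exp (b * |s| + -L * (s ^ 2 - 1) ^ 2) := by
        rw [wellWeight, mul_assoc, ← Real.exp_add]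
    _ ≤ K * Real.exp (b ^ 2 / 2 + 5 / 4 + -(1 / 2) * s ^ 2) := by
        refine mul_le_mul_of_nonneg_left (Real.exp_le_exp.2 ?_) hK0
        nlinarith [sq_nonneg (b - |s|), sq_abs s, sq_nonneg (s ^ 2 - 1 - 1 / 2),
          mul_nonneg (sub_nonneg.2 hL) (sq_nonneg (s ^ 2 - 1))]
    _ = _ := by rw [Real.exp_add, mul_assoc]

lemma integrable_wellWeight {L : ℝ} (hL : 1 ≤ L) : Integrable (wellWeight L) := by
  simpa using integrable_mul_wellWeight (f := fun _ => 1) continuous_const (K := 1) (b := 0) hL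
    (by simp)

lemma abs_quartic_sub_sq_le (s : ℝ) : |s ^ 4 - s ^ 2| ≤ 26 * Real.exp (1 * |s|) := by
  have h4 := Real.pow_div_factorial_le_exp |s| (abs_nonneg s) 4
  have h2 := Real.pow_div_factorial_le_exp |s| (abs_nonneg s) 2
  norm_num [Nat.factorial] at h4 h2
  rw [show |s| ^ 4 = s ^ 4 from (by decide : Even 4).pow_abs s] at h4
  rw [abs_le, one_mul]
  constructor <;> nlinarith [sq_nonneg s, sq_nonneg (s ^ 2)]

lemma integral_quartic_sub_sq_mul_wellWeight {L : ℝ} (hL : 1 ≤ L) :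
    ∫ s, (s ^ 4 - s ^ 2) * wellWeight L s = (∫ s, wellWeight L s) / (4 * L) := by
  have hq : Integrable (fun s => (s ^ 4 - s ^ 2) * wellWeight L s) :=
    integrable_mul_wellWeight (by fun_prop) hL abs_quartic_sub_sq_le
  have hid : Integrable (fun s => s * wellWeight L s) :=
    integrable_mul_wellWeight (K := 1) (b := 1) continuous_id hL fun s => by
      rw [id, one_mul, one_mul]
      linarith [Real.add_one_le_exp |s|]
  have hderiv : ∀ s : ℝ, HasDerivAt (fun s => s * wellWeight L s)
      (wellWeight L s - 4 * L * ((s ^ 4 - s ^ 2) * wellWeight L s)) s := fun s => by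
    refine ((hasDerivAt_id' s).fun_mul (hasDerivAt_wellWeight L s)).congr_deriv ?_
    ring
  have h0 := integral_eq_zero_of_hasDerivAt_of_integrable hderiv
    ((integrable_wellWeight hL).sub (hq.const_mul (4 * L))) hid
  rw [integral_sub (integrable_wellWeight hL) (hq.const_mul (4 * L)), integral_const_mul] at h0
  rw [eq_div_iff (by positivity)]
  linarith

lemma exp_div_sqrt_le_integral_wellWeight {L : ℝ} (hL : 1 ≤ L) :
    Real.exp (-9) / √L ≤ ∫ s, wellWeight L s := by
  have hr : 0 < √L := Real.sqrt_pos.2 (by linarith)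
  have hr1 : 1 ≤ √L := Real.one_le_sqrt.2 hL
  have hpt : ∀ s ∈ Icc (1 : ℝ) (1 + (√L)⁻¹), Real.exp (-9) ≤ wellWeight L s := by
    rintro s ⟨h1, h2⟩
    have hinv : (√L)⁻¹ ≤ 1 := inv_le_one_of_one_le₀ hr1
    have hy : √L * (s - 1) ≤ 1 := by
      calc √L * (s - 1) ≤ √L * (√L)⁻¹ := by gcongr; linarith
        _ = 1 := mul_inv_cancel₀ hr.ne'
    have hp : √L * (s - 1) * (s + 1) ≤ 3 := by
      nlinarith [mul_nonneg hr.le (sub_nonneg.2 h1)]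
    have hp0 : 0 ≤ √L * (s - 1) * (s + 1) :=
      mul_nonneg (mul_nonneg hr.le (sub_nonneg.2 h1)) (by linarith)
    have heq : L * (s ^ 2 - 1) ^ 2 = (√L * (s - 1) * (s + 1)) ^ 2 := by
      rw [mul_pow, mul_pow, Real.sq_sqrt (by linarith)]
      ring
    refine Real.exp_le_exp.2 ?_
    nlinarith
  have hle := setIntegral_ge_of_const_le measurableSet_Icc (by simp) hpt
    (integrable_wellWeight hL).integrableOn
  refine le_trans (le_of_eq ?_) (hle.trans (setIntegral_le_integral (integrable_wellWeight hL)
    (Filter.Eventually.of_forall fun s => (wellWeight_pos L s).le)))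
  simp [div_eq_inv_mul]

lemma abs_mul_wellWeight_le {K b L s v : ℝ} (hL : 1 ≤ L) (hK : 0 ≤ K)
    (hv : |v| ≤ K * Real.exp (b * |s|) * (|s| - 1) ^ 2) :
    |v * wellWeight L s| ≤ K * Real.exp (b + b ^ 2) * (2 / L) *
      (Real.exp (-(L / 4) * (s - 1) ^ 2) + Real.exp (-(L / 4) * (s + 1) ^ 2)) := by
  have hL0 : 0 < L := by linarith
  set y := |s| - 1 with hy
  have hw : wellWeight L s ≤ Real.exp (-L * y ^ 2) := by
    refine Real.exp_le_exp.2 ?_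
    have : (s ^ 2 - 1) ^ 2 = y ^ 2 * (|s| + 1) ^ 2 := by
      rw [hy, ← sq_abs s]
      ring
    rw [this]
    have := mul_nonneg hL0.le (mul_nonneg (sq_nonneg y)
      (add_nonneg (sq_nonneg |s|) (mul_nonneg zero_le_two (abs_nonneg s))))
    linarith
  have hyy : y ^ 2 ≤ 2 / L * Real.exp (L * y ^ 2 / 2) := by
    have h := Real.add_one_le_exp (L * y ^ 2 / 2)
    rw [div_mul_eq_mul_div, le_div_iff₀ hL0]
    linarith
  have hexp : b * |s| + L * y ^ 2 / 2 + -L * y ^ 2 ≤ b + b ^ 2 + -(L / 4) * y ^ 2 := by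
    have : |s| = y + 1 := by rw [hy]; ring
    rw [this]
    nlinarith [sq_nonneg (b - y / 2), mul_nonneg (sub_nonneg.2 hL) (sq_nonneg y)]
  have hgauss : Real.exp (-(L / 4) * y ^ 2) ≤
      Real.exp (-(L / 4) * (s - 1) ^ 2) + Real.exp (-(L / 4) * (s + 1) ^ 2) := by
    rcases le_total 0 s with hs | hs
    · rw [hy, abs_of_nonneg hs]
      linarith [Real.exp_pos (-(L / 4) * (s + 1) ^ 2)]
    · rw [hy, abs_of_nonpos hs, show (-s - 1) ^ 2 = (s + 1) ^ 2 by ring]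
      linarith [Real.exp_pos (-(L / 4) * (s - 1) ^ 2)]
  rw [abs_mul, abs_of_pos (wellWeight_pos L s)]
  calc |v| * wellWeight L s
      ≤ (K * Real.exp (b * |s|) * (2 / L * Real.exp (L * y ^ 2 / 2))) * Real.exp (-L * y ^ 2) := by
        refine mul_le_mul (hv.trans ?_) hw (wellWeight_pos L s).le (by positivity)
        gcongr
    _ = K * (2 / L) * Real.exp (b * |s| + L * y ^ 2 / 2 + -L * y ^ 2) := by
        rw [Real.exp_add, Real.exp_add]
        ring
    _ ≤ K * (2 / L) * Real.exp (b + b ^ 2 + -(L / 4) * y ^ 2) := by gcongr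
    _ = K * Real.exp (b + b ^ 2) * (2 / L) * Real.exp (-(L / 4) * y ^ 2) := by
        rw [Real.exp_add]
        ring
    _ ≤ _ := by gcongr

/-- Laplace-type estimate: against the double-well weight, a function vanishing to second order at
both wells has mean of size `1 / L`. -/
lemma abs_integral_mul_wellWeight_le {K b L : ℝ} {h : ℝ → ℝ} (hL : 1 ≤ L) (hK : 0 ≤ K)
    (hh : ∀ s, |h s| ≤ K * Real.exp (b * |s|) * (|s| - 1) ^ 2) :
    |∫ s, h s * wellWeight L s| ≤
      4 * K * Real.exp (b + b ^ 2) * √(4 * Real.pi) * Real.exp 9 / L * ∫ s, wellWeight L s := by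
  have hL0 : 0 < L := by linarith
  have hg : Integrable fun s : ℝ => Real.exp (-(L / 4) * s ^ 2) :=
    integrable_exp_neg_mul_sq (by positivity)
  have hint : (∫ s : ℝ, (Real.exp (-(L / 4) * (s - 1) ^ 2) + Real.exp (-(L / 4) * (s + 1) ^ 2)))
      = 2 * (√(4 * Real.pi) / √L) := by
    rw [integral_add (hg.comp_sub_right 1) (hg.comp_add_right 1),
      integral_sub_right_eq_self (fun s : ℝ => Real.exp (-(L / 4) * s ^ 2)),
      integral_add_right_eq_self (fun s : ℝ => Real.exp (-(L / 4) * s ^ 2)), integral_gaussian,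
      ← Real.sqrt_div (by positivity), show Real.pi / (L / 4) = 4 * Real.pi / L by field_simp]
    ring
  have hZ : 1 / √L ≤ Real.exp 9 * ∫ s, wellWeight L s := by
    have h1 := mul_le_mul_of_nonneg_left (exp_div_sqrt_le_integral_wellWeight hL)
      (Real.exp_pos 9).le
    rwa [← mul_div_assoc, ← Real.exp_add, add_neg_cancel, Real.exp_zero] at h1
  rw [← Real.norm_eq_abs]
  calc ‖∫ s, h s * wellWeight L s‖
      ≤ ∫ s, K * Real.exp (b + b ^ 2) * (2 / L) *
        (Real.exp (-(L / 4) * (s - 1) ^ 2) + Real.exp (-(L / 4) * (s + 1) ^ 2)) :=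
        norm_integral_le_of_norm_le
          (((hg.comp_sub_right 1).fun_add (hg.comp_add_right 1)).const_mul _)
          (Filter.Eventually.of_forall fun s => abs_mul_wellWeight_le hL hK (hh s))
    _ = 4 * K * Real.exp (b + b ^ 2) * √(4 * Real.pi) / L * (1 / √L) := by
        rw [integral_const_mul, hint]
        ring
    _ ≤ 4 * K * Real.exp (b + b ^ 2) * √(4 * Real.pi) / L *
          (Real.exp 9 * ∫ s, wellWeight L s) := by gcongr
    _ = _ := by ring

/-- A function with a double zero at `1` and exponentially bounded second derivative is
quadratically small near `1`. -/
lemma abs_le_mul_sq_of_double_zero {h h' h'' : ℝ → ℝ} {K b : ℝ} (hK : 0 ≤ K) (hb : 0 ≤ b)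
    (hd : ∀ s, HasDerivAt h (h' s) s) (hd' : ∀ s, HasDerivAt h' (h'' s) s)
    (h1 : h 1 = 0) (h1' : h' 1 = 0) (hbound : ∀ s, |h'' s| ≤ K * Real.exp (b * |s|))
    {s : ℝ} (hs : 0 ≤ s) :
    |h s| ≤ K * Real.exp b * Real.exp (b * s) * (s - 1) ^ 2 := by
  have hmem : ∀ t ∈ uIcc 1 s, |t| ≤ s + 1 ∧ |t - 1| ≤ |s - 1| := fun t ht => by
    refine ⟨?_, abs_sub_left_of_mem_uIcc ht⟩
    rcases mem_uIcc.1 ht with ⟨ha, hb⟩ | ⟨ha, hb⟩ <;> rw [abs_of_nonneg] <;> linarith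
  have hb2 : ∀ t ∈ uIcc 1 s, ‖h'' t‖ ≤ K * Real.exp b * Real.exp (b * s) := fun t ht => by
    refine (hbound t).trans ?_
    rw [mul_assoc, ← Real.exp_add]
    gcongr
    nlinarith [(hmem t ht).1]
  have hb1 : ∀ t ∈ uIcc 1 s, ‖h' t‖ ≤ K * Real.exp b * Real.exp (b * s) * |s - 1| := fun t ht => by
    have := (convex_uIcc 1 s).norm_image_sub_le_of_norm_hasDerivWithin_le
      (fun x _ => (hd' x).hasDerivWithinAt) hb2 left_mem_uIcc ht
    rw [h1', sub_zero] at this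
    exact this.trans (mul_le_mul_of_nonneg_left (hmem t ht).2 (by positivity))
  have := (convex_uIcc 1 s).norm_image_sub_le_of_norm_hasDerivWithin_le
      (fun x _ => (hd x).hasDerivWithinAt) hb1 left_mem_uIcc right_mem_uIcc
  rwa [h1, sub_zero, Real.norm_eq_abs, Real.norm_eq_abs, mul_assoc, abs_mul_abs_self,
    ← sq] at this

lemma Real.cosh_le_exp_abs (x : ℝ) : Real.cosh x ≤ Real.exp |x| := by
  rw [← Real.cosh_abs, Real.cosh_eq]
  linarith [Real.exp_le_exp.2 (show -|x| ≤ |x| by linarith [abs_nonneg x])]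

lemma Real.abs_sinh_le_exp_abs (x : ℝ) : |Real.sinh x| ≤ Real.exp |x| := by
  rw [Real.abs_sinh]
  exact (Real.sinh_lt_cosh _).le.trans (by simpa using Real.cosh_le_exp_abs x)

lemma exists_abs_tilt_remainder_le (a : ℝ) : ∃ c K b : ℝ, 0 ≤ K ∧ ∀ s : ℝ,
    |s * Real.sinh (a * s) - Real.tanh a * Real.cosh (a * s) - c * (s ^ 4 - s ^ 2)|
      ≤ K * Real.exp (b * |s|) * (|s| - 1) ^ 2 := by
  set t := Real.tanh a with ht
  set c := (Real.sinh a + a * Real.cosh a - t * (a * Real.sinh a)) / 2 with hc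
  set K := 2 * |a| + a ^ 2 + |t| * a ^ 2 + 26 * |c| with hK
  set b := |a| + 1 with hb
  have hK0 : 0 ≤ K := by positivity
  have hb0 : 0 ≤ b := by positivity
  refine ⟨c, K * Real.exp b, b, by positivity, fun s => ?_⟩
  let h : ℝ → ℝ := fun s => s * Real.sinh (a * s) - t * Real.cosh (a * s) - c * (s ^ 4 - s ^ 2)
  have hlin : ∀ s : ℝ, HasDerivAt (fun s => a * s) a s := fun s => by
    simpa using (hasDerivAt_id s).const_mul a
  have hd : ∀ s, HasDerivAt h (Real.sinh (a * s) + a * (s * Real.cosh (a * s))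
      - t * (a * Real.sinh (a * s)) - c * (4 * s ^ 3 - 2 * s)) s := fun s => by
    refine ((((hasDerivAt_id' s).fun_mul (hlin s).sinh).fun_sub
      ((hlin s).cosh.const_mul t)).fun_sub
      (((hasDerivAt_pow 4 s).fun_sub (hasDerivAt_pow 2 s)).const_mul c)).congr_deriv ?_
    push_cast
    ring
  have hd' : ∀ s, HasDerivAt (fun s => Real.sinh (a * s) + a * (s * Real.cosh (a * s))
      - t * (a * Real.sinh (a * s)) - c * (4 * s ^ 3 - 2 * s))
      (2 * a * Real.cosh (a * s) + a ^ 2 * (s * Real.sinh (a * s))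
        - t * a ^ 2 * Real.cosh (a * s) - c * (12 * s ^ 2 - 2)) s := fun s => by
    refine ((((hlin s).sinh.fun_add (((hasDerivAt_id' s).fun_mul (hlin s).cosh).const_mul a)).fun_sub
      (((hlin s).sinh.const_mul a).const_mul t)).fun_sub
      ((((hasDerivAt_pow 3 s).const_mul 4).fun_sub
        ((hasDerivAt_id' s).const_mul 2)).const_mul c)).congr_deriv ?_
    push_cast
    ring
  have h1 : h 1 = 0 := by
    have := (Real.cosh_pos a).ne'
    simp only [h, ht, Real.tanh_eq_sinh_div_cosh]
    field_simp
    ring_nf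
  have hbound : ∀ s, |2 * a * Real.cosh (a * s) + a ^ 2 * (s * Real.sinh (a * s))
        - t * a ^ 2 * Real.cosh (a * s) - c * (12 * s ^ 2 - 2)| ≤ K * Real.exp (b * |s|) := by
    intro s
    have hsplit : Real.exp (b * |s|) = Real.exp |a * s| * Real.exp |s| := by
      rw [← Real.exp_add, abs_mul, hb]
      ring_nf
    have he1 : 1 ≤ Real.exp |a * s| := Real.one_le_exp (abs_nonneg _)
    have he2 : 1 ≤ Real.exp |s| := Real.one_le_exp (abs_nonneg _)
    have hcosh : |Real.cosh (a * s)| ≤ Real.exp (b * |s|) := by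
      rw [abs_of_pos (Real.cosh_pos _), hsplit]
      nlinarith [Real.cosh_le_exp_abs (a * s)]
    have hsinh : |s * Real.sinh (a * s)| ≤ Real.exp (b * |s|) := by
      rw [abs_mul, hsplit, mul_comm]
      exact mul_le_mul (Real.abs_sinh_le_exp_abs _) (by linarith [Real.add_one_le_exp |s|])
        (abs_nonneg _) (Real.exp_pos _).le
    have hpoly : |12 * s ^ 2 - 2| ≤ 26 * Real.exp (b * |s|) := by
      have h2 := Real.pow_div_factorial_le_exp |s| (abs_nonneg s) 2
      norm_num [Nat.factorial] at h2
      rw [hsplit, abs_le]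
      constructor <;> nlinarith [sq_nonneg s]
    calc _ ≤ |2 * a * Real.cosh (a * s)| + |a ^ 2 * (s * Real.sinh (a * s))|
          + |t * a ^ 2 * Real.cosh (a * s)| + |c * (12 * s ^ 2 - 2)| :=
          (abs_sub _ _).trans (add_le_add_left ((abs_sub _ _).trans
            (add_le_add_left (abs_add_le _ _) _)) _)
      _ = 2 * |a| * |Real.cosh (a * s)| + a ^ 2 * |s * Real.sinh (a * s)|
          + |t| * a ^ 2 * |Real.cosh (a * s)| + |c| * |12 * s ^ 2 - 2| := by
          simp only [abs_mul, abs_pow, sq_abs, abs_two]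
      _ ≤ 2 * |a| * Real.exp (b * |s|) + a ^ 2 * Real.exp (b * |s|)
          + |t| * a ^ 2 * Real.exp (b * |s|) + |c| * (26 * Real.exp (b * |s|)) := by gcongr
      _ = K * Real.exp (b * |s|) := by ring
  have heven : h s = h |s| := by
    rcases abs_choice s with hs | hs <;> rw [hs]
    simp only [h, mul_neg, Real.sinh_neg, Real.cosh_neg]
    ring
  change |h s| ≤ _
  rw [heven]
  refine abs_le_mul_sq_of_double_zero hK0 hb0 hd hd' h1 ?_ hbound (abs_nonneg s)
  simp only [hc, mul_one]
  ring

lemma integral_eq_integral_even_part {f : ℝ → ℝ} (hf : Integrable f) :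
    ∫ s, f s = ∫ s, (f s + f (-s)) / 2 := by
  rw [integral_div, integral_add hf hf.comp_neg, integral_neg_eq_self f volume]
  ring

/-- The mean of `s` under the double-well weight tilted by `exp (a s)` tends to `tanh a`. -/
lemma exists_abs_tilted_mean_sub_tanh_le (a : ℝ) : ∃ C : ℝ, 0 < C ∧ ∀ L : ℝ, 1 ≤ L →
    |(∫ s, s * Real.exp (a * s) * wellWeight L s) / (∫ s, Real.exp (a * s) * wellWeight L s)
      - Real.tanh a| ≤ C / L := by
  obtain ⟨c, K, b, hK, hrem⟩ := exists_abs_tilt_remainder_le a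
  set M := 4 * K * Real.exp (b + b ^ 2) * √(4 * Real.pi) * Real.exp 9 with hM
  refine ⟨M + |c| / 4 + 1, by positivity, fun L hL => ?_⟩
  have hL0 : 0 < L := by linarith
  set Z := ∫ s, wellWeight L s with hZ
  have hZ0 : 0 < Z := lt_of_lt_of_le (by positivity) (exp_div_sqrt_le_integral_wellWeight hL)
  have hcosh : Integrable fun s => Real.cosh (a * s) * wellWeight L s :=
    integrable_mul_wellWeight (K := 1) (b := |a|)
      (Real.continuous_cosh.comp (continuous_const_mul a)) hL fun s => by
      rw [Function.comp_apply, abs_of_pos (Real.cosh_pos _), one_mul, ← abs_mul]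
      exact Real.cosh_le_exp_abs _
  have hexp : Integrable fun s => Real.exp (a * s) * wellWeight L s :=
    integrable_mul_wellWeight (K := 1) (b := |a|) (by fun_prop) hL fun s => by
      rw [abs_of_pos (Real.exp_pos _), one_mul, ← abs_mul]
      exact Real.exp_le_exp.2 (le_abs_self _)
  have hsexp : Integrable fun s => s * Real.exp (a * s) * wellWeight L s :=
    integrable_mul_wellWeight (K := 1) (b := 1 + |a|) (by fun_prop) hL fun s => by
      rw [abs_mul, abs_of_pos (Real.exp_pos _), one_mul, add_mul, one_mul, Real.exp_add, ← abs_mul]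
      have := Real.exp_le_exp.2 (le_abs_self (a * s))
      gcongr
      linarith [Real.add_one_le_exp |s|]
  have hssinh : Integrable fun s => s * Real.sinh (a * s) * wellWeight L s :=
    integrable_mul_wellWeight (K := 1) (b := 1 + |a|)
      (continuous_id'.mul (Real.continuous_sinh.comp (continuous_const_mul a))) hL
      fun s => by
      change |s * Real.sinh (a * s)| ≤ _
      rw [abs_mul, one_mul, add_mul, one_mul, Real.exp_add, ← abs_mul a s]
      have hle : |s| ≤ Real.exp |s| := by linarith [Real.add_one_le_exp |s|]
      exact mul_le_mul hle (Real.abs_sinh_le_exp_abs _)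
        (abs_nonneg _) (Real.exp_pos _).le
  have hq : Integrable fun s => (s ^ 4 - s ^ 2) * wellWeight L s :=
    integrable_mul_wellWeight (by fun_prop) hL abs_quartic_sub_sq_le
  have hN : ∫ s, s * Real.exp (a * s) * wellWeight L s
      = ∫ s, s * Real.sinh (a * s) * wellWeight L s := by
    rw [integral_eq_integral_even_part hsexp]
    refine integral_congr_ae (Filter.Eventually.of_forall fun s => ?_)
    simp only [wellWeight_neg, Real.sinh_eq, mul_neg]
    ring
  have hD : ∫ s, Real.exp (a * s) * wellWeight L s = ∫ s, Real.cosh (a * s) * wellWeight L s := by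
    rw [integral_eq_integral_even_part hexp]
    refine integral_congr_ae (Filter.Eventually.of_forall fun s => ?_)
    simp only [wellWeight_neg, Real.cosh_eq, mul_neg]
    ring
  rw [hN, hD]
  set N := ∫ s, s * Real.sinh (a * s) * wellWeight L s with hNdef
  set D := ∫ s, Real.cosh (a * s) * wellWeight L s with hDdef
  have hZD : Z ≤ D := integral_mono (integrable_wellWeight hL) hcosh fun s =>
    le_mul_of_one_le_left (wellWeight_pos L s).le (Real.one_le_cosh _)
  have hD0 : 0 < D := hZ0.trans_le hZD
  have hsub : Integrable fun s => s * Real.sinh (a * s) * wellWeight L s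
      - Real.tanh a * (Real.cosh (a * s) * wellWeight L s) := hssinh.sub (hcosh.const_mul _)
  have hkey : ∫ s, (s * Real.sinh (a * s) - Real.tanh a * Real.cosh (a * s)
      - c * (s ^ 4 - s ^ 2)) * wellWeight L s = N - Real.tanh a * D - c * (Z / (4 * L)) := by
    rw [← integral_quartic_sub_sq_mul_wellWeight hL, hNdef, hDdef, ← integral_const_mul,
      ← integral_const_mul, ← integral_sub hssinh (hcosh.const_mul _),
      ← integral_sub hsub (hq.const_mul c)]
    refine integral_congr_ae (Filter.Eventually.of_forall fun s => ?_)
    ring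
  have hbd := abs_integral_mul_wellWeight_le hL hK hrem
  rw [hkey, ← hM, ← hZ] at hbd
  have hc4 : |c * (Z / (4 * L))| = |c| / 4 / L * Z := by
    rw [abs_mul, abs_of_pos (by positivity : 0 < Z / (4 * L))]
    ring
  have hnum : |N - Real.tanh a * D| ≤ (M + |c| / 4 + 1) / L * D := by
    calc |N - Real.tanh a * D|
        = |(N - Real.tanh a * D - c * (Z / (4 * L))) + c * (Z / (4 * L))| := by ring_nf
      _ ≤ M / L * Z + |c| / 4 / L * Z := (abs_add_le _ _).trans (add_le_add hbd hc4.le)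
      _ = (M + |c| / 4) / L * Z := by ring
      _ ≤ (M + |c| / 4 + 1) / L * D := by
        gcongr ?_ / L * ?_
        linarith
  rwa [div_sub' hD0.ne', abs_div, abs_of_pos hD0, div_le_iff₀ hD0, mul_comm D]

/-- Emergence of the viscous shock profile from the leading inner term (final
Proposition of Appendix A): `Φ(T, T^(-1/2) ξ) = √(T/β₃) σ(ξ/√β₃) (1 + O_ξ(T⁻²))`
as `T → ∞`, where `σ(ξ) = -tanh(ξ/2)`. -/
theorem statement5
    (β₃ : ℝ) (hβ₃ : 0 < β₃)
    (E : ℝ → ℝ → ℝ → ℝ)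
    (hE : ∀ T X ζ : ℝ, E T X ζ = X * ζ / 2 + T * ζ ^ 2 / 4 - β₃ / 8 * ζ ^ 4)
    (hint : ∀ T X : ℝ, Integrable (fun ζ : ℝ => Real.exp (E T X ζ)))
    (hint' : ∀ T X : ℝ, Integrable (fun ζ : ℝ => ζ * Real.exp (E T X ζ)))
    (Φ : ℝ → ℝ → ℝ)
    (hΦ : ∀ T X : ℝ,
      Φ T X = -(∫ ζ : ℝ, ζ * Real.exp (E T X ζ)) / ∫ ζ : ℝ, Real.exp (E T X ζ)) :
    ∀ ξ : ℝ, ∃ C : ℝ, 0 < C ∧ ∃ T₀ : ℝ, 0 < T₀ ∧ ∀ T : ℝ, T₀ ≤ T →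
      |Φ T (T ^ (-(1:ℝ)/2) * ξ)
          + Real.sqrt (T / β₃) * Real.tanh (ξ / (2 * Real.sqrt β₃))|
        ≤ C * T ^ ((1:ℝ)/2) * T ^ (-(2:ℝ)) := by
  intro ξ
  set a := ξ / (2 * √β₃) with ha
  obtain ⟨C, hC, hmean⟩ := exists_abs_tilted_mean_sub_tanh_le a
  have hb0 : 0 < √β₃ := Real.sqrt_pos.2 hβ₃
  refine ⟨C * (8 * β₃) / √β₃, by positivity, 1 + 8 * β₃, by positivity, fun T hT => ?_⟩
  have hT0 : 0 < T := by linarith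
  have hTs : 0 < √T := Real.sqrt_pos.2 hT0
  set L := T ^ 2 / (8 * β₃) with hLdef
  have hL : 1 ≤ L := by
    rw [hLdef, one_le_div (by positivity)]
    nlinarith
  set c := √(T / β₃) with hc
  have hcdiv : c = √T / √β₃ := Real.sqrt_div hT0.le _
  have hc0 : 0 < c := Real.sqrt_pos.2 (by positivity)
  have hcsq : c ^ 2 = T / β₃ := Real.sq_sqrt (by positivity)
  set X := T ^ (-(1 : ℝ) / 2) * ξ with hX
  have hhalf : T ^ (-(1 : ℝ) / 2) = (√T)⁻¹ := by
    rw [neg_div, Real.rpow_neg hT0.le, Real.sqrt_eq_rpow]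
  have hXc : X * c / 2 = a := by
    rw [hX, hhalf, hcdiv, ha]
    field_simp
  have hexp : ∀ s, Real.exp (E T X (c * s)) =
      Real.exp L * (Real.exp (a * s) * wellWeight L s) := fun s => by
    rw [wellWeight, ← Real.exp_add, ← Real.exp_add, hE]
    congr 1
    have h4 : c ^ 4 = (T / β₃) ^ 2 := by rw [← hcsq]; ring
    rw [← hXc, hLdef, mul_pow, mul_pow, h4, hcsq]
    field_simp
    ring
  have hD : ∫ ζ, Real.exp (E T X ζ) =
      c * (Real.exp L * ∫ s, Real.exp (a * s) * wellWeight L s) := by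
    have h := Measure.integral_comp_mul_left (fun ζ => Real.exp (E T X ζ)) c
    simp only [hexp, integral_const_mul, abs_of_pos (inv_pos.2 hc0), smul_eq_mul] at h
    rw [h, mul_inv_cancel_left₀ hc0.ne']
  have hN : ∫ ζ, ζ * Real.exp (E T X ζ) =
      c * (c * (Real.exp L * ∫ s, s * Real.exp (a * s) * wellWeight L s)) := by
    have h := Measure.integral_comp_mul_left (fun ζ => ζ * Real.exp (E T X ζ)) c
    have hcongr : ∀ s, c * s * Real.exp (E T X (c * s)) =
        c * (Real.exp L * (s * Real.exp (a * s) * wellWeight L s)) := fun s => by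
      rw [hexp]
      ring
    simp only [hcongr, integral_const_mul, abs_of_pos (inv_pos.2 hc0), smul_eq_mul] at h
    rw [h, mul_inv_cancel_left₀ hc0.ne']
  set N := ∫ s, s * Real.exp (a * s) * wellWeight L s
  set D := ∫ s, Real.exp (a * s) * wellWeight L s
  have hΦeq : Φ T X = -(c * (N / D)) := by
    rw [hΦ, hN, hD, neg_div, mul_div_mul_left _ _ hc0.ne', mul_div_assoc,
      mul_div_mul_left _ _ (Real.exp_pos L).ne']
  have hpow : T ^ (-(2 : ℝ)) = (T ^ 2)⁻¹ := by
    rw [Real.rpow_neg hT0.le, Real.rpow_two]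
  rw [hΦeq, show -(c * (N / D)) + c * Real.tanh a = -(c * (N / D - Real.tanh a)) by ring,
    abs_neg, abs_mul, abs_of_pos hc0, hpow, ← Real.sqrt_eq_rpow]
  calc c * |N / D - Real.tanh a| ≤ c * (C / L) := by
        gcongr
        exact hmean L hL
    _ = C * (8 * β₃) / √β₃ * √T * (T ^ 2)⁻¹ := by
        rw [hcdiv, hLdef]
        field_simp
end

section
/- Laplace-method asymptotics for the Cole–Hopf integrals (equations (A.16) and (A.18)): For every ξ ∈ ℝ there exist constants C > 0 and T₀ > 0 such that for all T ≥ T₀: |∫_ℝ exp(E(T, T^(−1/2)·ξ, ζ)) dζ − (8π/T)^(1/2)·cosh(ξ/(2√β₃))·exp(T²/(8β₃))| ≤ C·T^(−2)·(8π/T)^(1/2)·cosh(ξ/(2√β₃))·exp(T²/(8β₃)), and |∫_ℝ ζ·exp(E(T, T^(−1/2)·ξ, ζ)) dζ − (8π/β₃)^(1/2)·sinh(ξ/(2√β₃))·exp(T²/(8β₃))| ≤ C·T^(−2)·(8π/β₃)^(1/2)·|sinh(ξ/(2√β₃))|·exp(T²/(8β₃)). -/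
open Set MeasureTheory Real

lemma sq_mul_exp_neg_mul_sq_le {N : ℝ} (hN : 0 < N) (x : ℝ) :
    x ^ 2 * exp (-(N / 2) * x ^ 2) ≤ 4 / N * exp (-(N / 4) * x ^ 2) := by
  have h : N / 4 * x ^ 2 ≤ exp (N / 4 * x ^ 2) := by
    linarith [add_one_le_exp (N / 4 * x ^ 2)]
  have e : exp (-(N / 4) * x ^ 2) = exp (N / 4 * x ^ 2) * exp (-(N / 2) * x ^ 2) := by
    rw [← exp_add]; ring_nf
  rw [e]
  calc x ^ 2 * exp (-(N / 2) * x ^ 2)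
      = 4 / N * (N / 4 * x ^ 2 * exp (-(N / 2) * x ^ 2)) := by field_simp
    _ ≤ 4 / N * (exp (N / 4 * x ^ 2) * exp (-(N / 2) * x ^ 2)) := by gcongr

lemma integrable_sq_mul_exp_neg_mul_sq {N : ℝ} (hN : 0 < N) :
    Integrable (fun x : ℝ => x ^ 2 * exp (-(N / 2) * x ^ 2)) := by
  refine ((integrable_exp_neg_mul_sq (b := N / 4) (by positivity)).const_mul (4 / N)).mono'
    (by fun_prop) (ae_of_all _ fun x => ?_)
  rw [norm_of_nonneg (by positivity)]
  exact sq_mul_exp_neg_mul_sq_le hN x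

lemma integral_sq_mul_exp_neg_mul_sq_le {N : ℝ} (hN : 0 < N) :
    ∫ x : ℝ, x ^ 2 * exp (-(N / 2) * x ^ 2) ≤ 8 * (N⁻¹ * √(π / N)) := by
  calc ∫ x : ℝ, x ^ 2 * exp (-(N / 2) * x ^ 2)
      ≤ ∫ x : ℝ, 4 / N * exp (-(N / 4) * x ^ 2) :=
        integral_mono (integrable_sq_mul_exp_neg_mul_sq hN)
          ((integrable_exp_neg_mul_sq (b := N / 4) (by positivity)).const_mul (4 / N))
          (sq_mul_exp_neg_mul_sq_le hN)
    _ = 8 * (N⁻¹ * √(π / N)) := by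
        have e : π / (N / 4) = 2 ^ 2 * (π / N) := by field_simp; norm_num
        rw [integral_const_mul, integral_gaussian, e, sqrt_mul (by positivity),
          sqrt_sq (by norm_num)]
        ring

lemma image_sq_sub_one_Ioi : (fun u : ℝ => u ^ 2 - 1) '' Ioi 0 = Ioi (-1) := by
  ext w
  simp only [mem_image, mem_Ioi]
  constructor
  · rintro ⟨u, hu, rfl⟩
    nlinarith
  · intro hw
    exact ⟨√(w + 1), sqrt_pos.2 (by linarith), by rw [sq_sqrt (by linarith)]; ring⟩

lemma injOn_sq_sub_one_Ioi : InjOn (fun u : ℝ => u ^ 2 - 1) (Ioi 0) := by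
  intro u hu v hv h
  simp only [mem_Ioi] at hu hv
  exact (pow_left_inj₀ hu.le hv.le two_ne_zero).1 (by simpa using h)

lemma hasDerivWithinAt_sq_sub_one (s : Set ℝ) (u : ℝ) :
    HasDerivWithinAt (fun u : ℝ => u ^ 2 - 1) (2 * u) s u := by
  simpa using ((hasDerivAt_pow 2 u).sub_const 1).hasDerivWithinAt

/-- The double-well integral over a half-line of an amplitude that is affine in `u ^ 2 - 1`,
up to the factor `u`. -/
lemma integral_Ioi_affine_mul_exp (p c : ℝ) {N : ℝ} (hN : 0 < N) :
    IntegrableOn (fun u : ℝ => u * (p + c * (u ^ 2 - 1)) * exp (-N * (u ^ 2 - 1) ^ 2)) (Ioi 0) ∧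
    |(∫ u in Ioi (0:ℝ), u * (p + c * (u ^ 2 - 1)) * exp (-N * (u ^ 2 - 1) ^ 2))
        - p * (√(π / N) / 2)| ≤ 4 * (|p| + |c|) * (N⁻¹ * √(π / N)) := by
  set G : ℝ → ℝ := fun w => (p + c * w) * exp (-N * w ^ 2) with hG
  have hGi : Integrable G := by
    have := ((integrable_exp_neg_mul_sq hN).const_mul p).add
      ((integrable_mul_exp_neg_mul_sq hN).const_mul c)
    refine this.congr (ae_of_all _ fun w => ?_)
    simp only [hG, Pi.add_apply]; ring
  have hGint : ∫ w, G w = p * √(π / N) := by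
    have hodd : ∫ w : ℝ, w * exp (-N * w ^ 2) = 0 := by
      have h := integral_neg_eq_self (fun w : ℝ => w * exp (-N * w ^ 2)) volume
      simp only [neg_sq, neg_mul _ (exp _), integral_neg] at h
      linarith
    calc ∫ w, G w = ∫ w, (p * exp (-N * w ^ 2) + c * (w * exp (-N * w ^ 2))) := by
          congr 1; ext w; simp only [hG]; ring
      _ = p * √(π / N) := by
          rw [integral_add ((integrable_exp_neg_mul_sq hN).const_mul p)
            ((integrable_mul_exp_neg_mul_sq hN).const_mul c), integral_const_mul,
            integral_const_mul, hodd, integral_gaussian]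
          ring
  have hcongr : ∀ u ∈ Ioi (0:ℝ), |2 * u| • G (u ^ 2 - 1)
      = 2 * (u * (p + c * (u ^ 2 - 1)) * exp (-N * (u ^ 2 - 1) ^ 2)) := by
    intro u hu
    rw [abs_of_pos (by simpa using hu)]
    simp only [hG, smul_eq_mul]; ring
  have hsubst : ∫ w in Ioi (-1), G w
      = 2 * ∫ u in Ioi (0:ℝ), u * (p + c * (u ^ 2 - 1)) * exp (-N * (u ^ 2 - 1) ^ 2) := by
    rw [← image_sq_sub_one_Ioi, integral_image_eq_integral_abs_deriv_smul measurableSet_Ioi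
      (fun u _ => hasDerivWithinAt_sq_sub_one _ u) injOn_sq_sub_one_Ioi, ← integral_const_mul]
    exact setIntegral_congr_fun measurableSet_Ioi hcongr
  have htail : |∫ w in Iic (-1), G w| ≤ (|p| + |c|) * (8 * (N⁻¹ * √(π / N))) := by
    have hi := (integrable_sq_mul_exp_neg_mul_sq hN).const_mul (|p| + |c|)
    calc |∫ w in Iic (-1), G w|
        ≤ ∫ w in Iic (-1), (|p| + |c|) * (w ^ 2 * exp (-(N / 2) * w ^ 2)) := by
          rw [← norm_eq_abs]
          refine norm_integral_le_of_norm_le hi.integrableOn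
            ((ae_restrict_iff' measurableSet_Iic).2 (ae_of_all _ fun w hw => ?_))
          have hw1 : w ≤ -1 := hw
          have h1 : 1 ≤ w ^ 2 := by nlinarith
          have h2 : |w| ≤ w ^ 2 := by rw [abs_of_nonpos (by linarith)]; nlinarith
          have h3 : |p + c * w| ≤ (|p| + |c|) * w ^ 2 := by
            calc |p + c * w| ≤ |p| + |c| * |w| := by
                  rw [← abs_mul]; exact abs_add_le _ _
              _ ≤ |p| * w ^ 2 + |c| * w ^ 2 := by
                  gcongr; exact le_mul_of_one_le_right (abs_nonneg p) h1
              _ = _ := by ring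
          rw [norm_mul, norm_eq_abs, norm_of_nonneg (exp_pos _).le, ← mul_assoc]
          gcongr
          linarith
      _ ≤ ∫ w, (|p| + |c|) * (w ^ 2 * exp (-(N / 2) * w ^ 2)) :=
          setIntegral_le_integral hi (ae_of_all _ fun w => by positivity)
      _ ≤ _ := by
          rw [integral_const_mul]
          gcongr
          exact integral_sq_mul_exp_neg_mul_sq_le hN
  constructor
  · have h := (integrableOn_image_iff_integrableOn_abs_deriv_smul measurableSet_Ioi
      (fun u _ => hasDerivWithinAt_sq_sub_one _ u) injOn_sq_sub_one_Ioi G).1 hGi.integrableOn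
    have h2 := ((integrableOn_congr_fun hcongr measurableSet_Ioi).1 h).const_mul (1 / 2)
    refine h2.congr (ae_of_all _ fun u => ?_)
    ring
  · have hsplit := intervalIntegral.integral_Iic_add_Ioi (b := -1) hGi.integrableOn
      hGi.integrableOn
    rw [hGint, hsubst] at hsplit
    rw [abs_le] at htail ⊢
    constructor <;> linarith [htail.1, htail.2]

/-- Laplace's method for the phase `(u ^ 2 - 1) ^ 2` on the half-line, with the relative error
`O(N⁻¹)`. -/
lemma exists_laplace_Ioi_bound {g : ℝ → ℝ} (hgc : Continuous g) {p d K L : ℝ} (hK : 0 ≤ K)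
    (hL : 1 ≤ L)
    (hg : ∀ u, |g u - p - d * (u - 1)| ≤ K * ((u - 1) ^ 2 * exp (L * (u - 1) ^ 2))) :
    ∃ C : ℝ, 0 < C ∧ ∀ N : ℝ, 2 * L ≤ N →
      |(∫ u in Ioi (0:ℝ), g u * exp (-N * (u ^ 2 - 1) ^ 2)) - p * (√(π / N) / 2)|
        ≤ C * (N⁻¹ * √(π / N)) := by
  set c : ℝ := (d - p) / 2 with hc
  refine ⟨8 * (K + 4 * |c|) + 4 * (|p| + |c|) + 1, by positivity, fun N hN => ?_⟩
  have hN0 : 0 < N := by linarith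
  obtain ⟨hPi, hP⟩ := integral_Ioi_affine_mul_exp p c hN0
  set R : ℝ → ℝ := fun u => g u - u * (p + c * (u ^ 2 - 1)) with hR
  have hRbound : ∀ u, |R u| ≤ (K + 4 * |c|) * ((u - 1) ^ 2 * exp (L * (u - 1) ^ 2)) := by
    intro u
    set v := u - 1 with hv
    have e : R u = (g u - p - d * v) - c * (v ^ 2 * (3 + v)) := by
      have hu : u = 1 + v := by rw [hv]; ring
      simp only [hR, hc]; rw [hu]; ring
    have h3 : |3 + v| ≤ 4 * exp (L * v ^ 2) := by
      have h1 := add_one_le_exp (L * v ^ 2)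
      have h2 : v ^ 2 ≤ L * v ^ 2 := le_mul_of_one_le_left (sq_nonneg v) hL
      rw [abs_le]
      constructor <;> nlinarith [sq_nonneg (v - 1), sq_nonneg (v + 1)]
    calc |R u| ≤ |g u - p - d * v| + |c * (v ^ 2 * (3 + v))| := by
          rw [e]; exact abs_sub _ _
      _ ≤ K * (v ^ 2 * exp (L * v ^ 2)) + |c| * (v ^ 2 * (4 * exp (L * v ^ 2))) := by
          rw [abs_mul, abs_mul, abs_of_nonneg (sq_nonneg v)]
          gcongr
          exact hg u
      _ = _ := by ring
  have hRexp : ∀ u ∈ Ioi (0:ℝ), ‖R u * exp (-N * (u ^ 2 - 1) ^ 2)‖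
      ≤ (K + 4 * |c|) * ((u - 1) ^ 2 * exp (-(N / 2) * (u - 1) ^ 2)) := by
    intro u hu
    have hu0 : 0 < u := hu
    rw [norm_mul, norm_eq_abs, norm_of_nonneg (exp_pos _).le]
    have h1 : exp (L * (u - 1) ^ 2) * exp (-N * (u ^ 2 - 1) ^ 2)
        ≤ exp (-(N / 2) * (u - 1) ^ 2) := by
      rw [← exp_add]
      apply exp_le_exp.2
      have h2 : (u - 1) ^ 2 ≤ (u ^ 2 - 1) ^ 2 := by
        have : (u ^ 2 - 1) ^ 2 = (u - 1) ^ 2 * (u + 1) ^ 2 := by ring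
        rw [this]
        exact le_mul_of_one_le_right (sq_nonneg _) (by nlinarith)
      have h3 : L * (u - 1) ^ 2 ≤ N / 2 * (u - 1) ^ 2 := by gcongr; linarith
      have h4 := mul_le_mul_of_nonneg_left h2 hN0.le
      linarith
    calc |R u| * exp (-N * (u ^ 2 - 1) ^ 2)
        ≤ (K + 4 * |c|) * ((u - 1) ^ 2 * exp (L * (u - 1) ^ 2)) * exp (-N * (u ^ 2 - 1) ^ 2) := by
          gcongr; exact hRbound u
      _ = (K + 4 * |c|) * ((u - 1) ^ 2 *
          (exp (L * (u - 1) ^ 2) * exp (-N * (u ^ 2 - 1) ^ 2))) := by ring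
      _ ≤ _ := by gcongr
  have hmaj : Integrable fun u : ℝ =>
      (K + 4 * |c|) * ((u - 1) ^ 2 * exp (-(N / 2) * (u - 1) ^ 2)) :=
    ((integrable_sq_mul_exp_neg_mul_sq hN0).comp_sub_right 1).const_mul _
  have hRae := (ae_restrict_iff' (μ := volume) measurableSet_Ioi).2 (ae_of_all _ hRexp)
  have hRi : IntegrableOn (fun u => R u * exp (-N * (u ^ 2 - 1) ^ 2)) (Ioi 0) :=
    hmaj.integrableOn.mono' (Continuous.aestronglyMeasurable (by fun_prop)) hRae
  have hRint : |∫ u in Ioi (0:ℝ), R u * exp (-N * (u ^ 2 - 1) ^ 2)|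
      ≤ (K + 4 * |c|) * (8 * (N⁻¹ * √(π / N))) := by
    refine (norm_integral_le_of_norm_le hmaj.integrableOn hRae).trans ?_
    refine (setIntegral_le_integral hmaj (ae_of_all _ fun u => by positivity)).trans ?_
    rw [integral_const_mul,
      integral_sub_right_eq_self (fun x : ℝ => x ^ 2 * exp (-(N / 2) * x ^ 2)) 1]
    gcongr
    exact integral_sq_mul_exp_neg_mul_sq_le hN0
  have hsum : ∫ u in Ioi (0:ℝ), g u * exp (-N * (u ^ 2 - 1) ^ 2)
      = (∫ u in Ioi (0:ℝ), R u * exp (-N * (u ^ 2 - 1) ^ 2)) +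
        ∫ u in Ioi (0:ℝ), u * (p + c * (u ^ 2 - 1)) * exp (-N * (u ^ 2 - 1) ^ 2) := by
    rw [← integral_add hRi hPi]
    congr 1; ext u; simp only [hR]; ring
  have hpos : 0 ≤ N⁻¹ * √(π / N) := by positivity
  rw [hsum]
  rw [abs_le] at hRint hP ⊢
  constructor <;> linarith [hRint.1, hRint.2, hP.1, hP.2]

lemma cosh_sub_one_le (t : ℝ) : cosh t - 1 ≤ t ^ 2 / 2 * exp (t ^ 2 / 2) := by
  have h := add_one_le_exp (-(t ^ 2 / 2))
  have h2 : exp (-(t ^ 2 / 2)) * exp (t ^ 2 / 2) = 1 := by rw [← exp_add]; simp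
  nlinarith [cosh_le_exp_half_sq t, exp_pos (t ^ 2 / 2)]

lemma abs_sinh_sub_self_le (t : ℝ) : |sinh t - t| ≤ cosh t - 1 := by
  have h1 := add_one_le_exp t
  have h2 := add_one_le_exp (-t)
  have h3 := cosh_add_sinh t
  have h4 := cosh_sub_sinh t
  rw [abs_le]
  constructor <;> linarith

lemma abs_mul_cosh_add_mul_sinh_sub_le (A B t : ℝ) :
    |A * cosh t + B * sinh t - A - B * t| ≤ (|A| + |B|) * (t ^ 2 / 2 * exp (t ^ 2 / 2)) := by
  have h0 : 0 ≤ cosh t - 1 := by linarith [one_le_cosh t]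
  calc |A * cosh t + B * sinh t - A - B * t|
      = |A * (cosh t - 1) + B * (sinh t - t)| := by ring_nf
    _ ≤ |A| * (cosh t - 1) + |B| * (cosh t - 1) := by
        refine (abs_add_le _ _).trans ?_
        rw [abs_mul, abs_mul, abs_of_nonneg h0]
        gcongr
        exact abs_sinh_sub_self_le t
    _ = (|A| + |B|) * (cosh t - 1) := by ring
    _ ≤ _ := by gcongr; exact cosh_sub_one_le t

lemma exists_laplace_cosh_bound (a : ℝ) :
    ∃ C : ℝ, 0 < C ∧ ∀ N : ℝ, 2 * (1 + a ^ 2) ≤ N →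
      |(∫ u in Ioi (0:ℝ), cosh (a * u) * exp (-N * (u ^ 2 - 1) ^ 2))
          - cosh a * (√(π / N) / 2)| ≤ C * (N⁻¹ * √(π / N)) := by
  refine exists_laplace_Ioi_bound (by fun_prop) (d := a * sinh a)
    (K := (|cosh a| + |sinh a|) * (a ^ 2 / 2)) (by positivity) (by nlinarith) fun u => ?_
  have e : cosh (a * u) = cosh a * cosh (a * (u - 1)) + sinh a * sinh (a * (u - 1)) := by
    rw [← cosh_add]; ring_nf
  calc |cosh (a * u) - cosh a - a * sinh a * (u - 1)|
      = |cosh a * cosh (a * (u - 1)) + sinh a * sinh (a * (u - 1)) - cosh a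
          - sinh a * (a * (u - 1))| := by rw [e]; ring_nf
    _ ≤ _ := abs_mul_cosh_add_mul_sinh_sub_le _ _ _
    _ = (|cosh a| + |sinh a|) * (a ^ 2 / 2) *
          ((u - 1) ^ 2 * exp ((a * (u - 1)) ^ 2 / 2)) := by ring
    _ ≤ _ := by
        gcongr
        nlinarith [sq_nonneg (a * (u - 1)), sq_nonneg (u - 1)]

lemma exists_laplace_mul_sinh_bound (a : ℝ) :
    ∃ C : ℝ, 0 < C ∧ ∀ N : ℝ, 2 * (1 + a ^ 2) ≤ N →
      |(∫ u in Ioi (0:ℝ), u * sinh (a * u) * exp (-N * (u ^ 2 - 1) ^ 2))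
          - sinh a * (√(π / N) / 2)| ≤ C * (N⁻¹ * √(π / N)) := by
  set K : ℝ := (|sinh a| + |cosh a|) * (a ^ 2 / 2) with hK
  refine exists_laplace_Ioi_bound (by fun_prop) (d := sinh a + a * cosh a)
    (K := |a * cosh a| + 2 * K) (by positivity) (by nlinarith) fun u => ?_
  set v := u - 1 with hv
  have hu : u = 1 + v := by rw [hv]; ring
  have e : sinh (a * u) = sinh a * cosh (a * v) + cosh a * sinh (a * v) := by
    rw [← sinh_add, hu]; ring_nf
  have h1 : |sinh (a * u) - sinh a - cosh a * (a * v)|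
      ≤ K * (v ^ 2 * exp (a ^ 2 * v ^ 2 / 2)) := by
    rw [e]
    refine (abs_mul_cosh_add_mul_sinh_sub_le _ _ _).trans_eq ?_
    rw [hK, mul_pow]; ring
  have h2 : |1 + v| ≤ 2 * exp (v ^ 2 / 2) := by
    have := add_one_le_exp (v ^ 2 / 2)
    rw [abs_le]
    constructor <;> nlinarith [sq_nonneg (v - 1), sq_nonneg (v + 1)]
  have h3 : exp (v ^ 2 / 2) * exp (a ^ 2 * v ^ 2 / 2) ≤ exp ((1 + a ^ 2) * v ^ 2) := by
    rw [← exp_add]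
    apply exp_le_exp.2
    nlinarith [sq_nonneg (a * v), sq_nonneg v]
  have h4 : 1 ≤ exp ((1 + a ^ 2) * v ^ 2) := one_le_exp (by positivity)
  calc |u * sinh (a * u) - sinh a - (sinh a + a * cosh a) * v|
      = |a * cosh a * v ^ 2 + (1 + v) * (sinh (a * u) - sinh a - cosh a * (a * v))| := by
        congr 1
        rw [hu]; ring
    _ ≤ |a * cosh a| * v ^ 2
          + 2 * exp (v ^ 2 / 2) * (K * (v ^ 2 * exp (a ^ 2 * v ^ 2 / 2))) := by
        refine (abs_add_le _ _).trans ?_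
        rw [abs_mul _ (v ^ 2), abs_mul (1 + v), abs_of_nonneg (sq_nonneg v)]
        gcongr
    _ = |a * cosh a| * (v ^ 2 * 1)
          + 2 * K * (v ^ 2 * (exp (v ^ 2 / 2) * exp (a ^ 2 * v ^ 2 / 2))) := by ring
    _ ≤ |a * cosh a| * (v ^ 2 * exp ((1 + a ^ 2) * v ^ 2))
          + 2 * K * (v ^ 2 * exp ((1 + a ^ 2) * v ^ 2)) := by gcongr
    _ = _ := by ring

lemma exists_laplace_mul_sinh_relative_bound (a : ℝ) :
    ∃ C : ℝ, 0 < C ∧ ∀ N : ℝ, 2 * (1 + a ^ 2) ≤ N →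
      |(∫ u in Ioi (0:ℝ), u * sinh (a * u) * exp (-N * (u ^ 2 - 1) ^ 2))
          - sinh a * (√(π / N) / 2)| ≤ C * (N⁻¹ * √(π / N)) * |sinh a| := by
  rcases eq_or_ne a 0 with rfl | ha
  · exact ⟨1, one_pos, fun N _ => by simp⟩
  · obtain ⟨C, hC, h⟩ := exists_laplace_mul_sinh_bound a
    have hs : 0 < |sinh a| := abs_pos.2 (by simpa [sinh_eq_zero] using ha)
    refine ⟨C / |sinh a|, by positivity, fun N hN => (h N hN).trans_eq ?_⟩
    field_simp

/-- Folding an integral over the line onto the half-line, followed by a dilation. -/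
lemma integral_eq_mul_integral_Ioi_symm {f : ℝ → ℝ} (hf : Integrable f) {s : ℝ} (hs : 0 < s) :
    ∫ x, f x = s * ∫ u in Ioi (0:ℝ), (f (s * u) + f (-(s * u))) := by
  have h := integral_comp_mul_left_Ioi (fun x => f x + f (-x)) 0 hs
  rw [h, mul_zero, smul_eq_mul, mul_inv_cancel_left₀ hs.ne',
    integral_add hf.integrableOn hf.comp_neg.integrableOn, integral_comp_neg_Ioi, neg_zero,
    add_comm, intervalIntegral.integral_Iic_add_Ioi hf.integrableOn hf.integrableOn]

/-- Laplace-method asymptotics for the Cole–Hopf integrals (equations (A.16)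
and (A.18)). -/
theorem statement6
    (β₃ : ℝ) (hβ₃ : 0 < β₃)
    (E : ℝ → ℝ → ℝ → ℝ)
    (hE : ∀ T X ζ : ℝ, E T X ζ = X * ζ / 2 + T * ζ ^ 2 / 4 - β₃ / 8 * ζ ^ 4)
    (hint : ∀ T X : ℝ, Integrable (fun ζ : ℝ => Real.exp (E T X ζ)))
    (hint' : ∀ T X : ℝ, Integrable (fun ζ : ℝ => ζ * Real.exp (E T X ζ))) :
    ∀ ξ : ℝ, ∃ C : ℝ, 0 < C ∧ ∃ T₀ : ℝ, 0 < T₀ ∧ ∀ T : ℝ, T₀ ≤ T →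
      |(∫ ζ : ℝ, Real.exp (E T (T ^ (-(1:ℝ)/2) * ξ) ζ))
          - Real.sqrt (8 * π / T) * Real.cosh (ξ / (2 * Real.sqrt β₃))
            * Real.exp (T ^ 2 / (8 * β₃))|
        ≤ C * T ^ (-(2:ℝ)) * (Real.sqrt (8 * π / T)
            * Real.cosh (ξ / (2 * Real.sqrt β₃)) * Real.exp (T ^ 2 / (8 * β₃))) ∧
      |(∫ ζ : ℝ, ζ * Real.exp (E T (T ^ (-(1:ℝ)/2) * ξ) ζ))
          - Real.sqrt (8 * π / β₃) * Real.sinh (ξ / (2 * Real.sqrt β₃))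
            * Real.exp (T ^ 2 / (8 * β₃))|
        ≤ C * T ^ (-(2:ℝ)) * (Real.sqrt (8 * π / β₃)
            * |Real.sinh (ξ / (2 * Real.sqrt β₃))| * Real.exp (T ^ 2 / (8 * β₃))) := by
  intro ξ
  set a : ℝ := ξ / (2 * √β₃) with ha
  obtain ⟨C₁, hC₁, h₁⟩ := exists_laplace_cosh_bound a
  obtain ⟨C₂, hC₂, h₂⟩ := exists_laplace_mul_sinh_relative_bound a
  refine ⟨16 * β₃ * (C₁ + C₂), by positivity, 1 + 16 * β₃ * (1 + a ^ 2), by positivity,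
    fun T hT => ?_⟩
  have hT1 : 1 ≤ T := le_trans (le_add_of_nonneg_right (by positivity)) hT
  have hT0 : 0 < T := by linarith
  set N : ℝ := T ^ 2 / (8 * β₃) with hN
  have hNL : 2 * (1 + a ^ 2) ≤ N := by
    rw [hN, le_div_iff₀ (by positivity)]
    nlinarith
  have hN0 : 0 < N := by positivity
  set s : ℝ := √(T / β₃) with hs
  have hs0 : 0 < s := by positivity
  have hs2 : s ^ 2 = T / β₃ := sq_sqrt (by positivity)
  have hsX : T ^ (-(1:ℝ) / 2) * ξ * s / 2 = a := by
    have h : T ^ (-(1:ℝ) / 2) * √T = 1 := by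
      rw [sqrt_eq_rpow, ← rpow_add hT0]; norm_num
    rw [hs, ha, sqrt_div hT0.le]
    calc T ^ (-(1:ℝ) / 2) * ξ * (√T / √β₃) / 2
        = (T ^ (-(1:ℝ) / 2) * √T) * (ξ / (2 * √β₃)) := by ring
      _ = _ := by rw [h, one_mul]
  have hEu : ∀ u, E T (T ^ (-(1:ℝ) / 2) * ξ) (s * u) = a * u + (N + -N * (u ^ 2 - 1) ^ 2) := by
    intro u
    rw [hE, ← hsX, mul_pow, mul_pow, show s ^ 4 = (s ^ 2) ^ 2 by ring, hs2, hN]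
    field_simp
    ring
  have hpos : ∀ u, exp (E T (T ^ (-(1:ℝ) / 2) * ξ) (s * u))
      = exp N * (exp (a * u) * exp (-N * (u ^ 2 - 1) ^ 2)) := by
    intro u
    rw [hEu, exp_add, exp_add]; ring
  have hneg : ∀ u, exp (E T (T ^ (-(1:ℝ) / 2) * ξ) (-(s * u)))
      = exp N * (exp (-(a * u)) * exp (-N * (u ^ 2 - 1) ^ 2)) := by
    intro u
    rw [← mul_neg, hpos, mul_neg, neg_sq]
  have hI₁ : ∫ ζ, exp (E T (T ^ (-(1:ℝ) / 2) * ξ) ζ)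
      = 2 * s * exp N * ∫ u in Ioi (0:ℝ), cosh (a * u) * exp (-N * (u ^ 2 - 1) ^ 2) := by
    rw [integral_eq_mul_integral_Ioi_symm (hint _ _) hs0,
      show 2 * s * exp N = s * (2 * exp N) by ring, mul_assoc s]
    congr 1
    rw [← integral_const_mul]
    refine integral_congr_ae (ae_of_all _ fun u => ?_)
    dsimp only
    rw [hpos, hneg, cosh_eq]; ring
  have hI₂ : ∫ ζ, ζ * exp (E T (T ^ (-(1:ℝ) / 2) * ξ) ζ)
      = 2 * s ^ 2 * exp N *
        ∫ u in Ioi (0:ℝ), u * sinh (a * u) * exp (-N * (u ^ 2 - 1) ^ 2) := by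
    rw [integral_eq_mul_integral_Ioi_symm (hint' _ _) hs0,
      show 2 * s ^ 2 * exp N = s * (2 * s * exp N) by ring, mul_assoc s]
    congr 1
    rw [← integral_const_mul]
    refine integral_congr_ae (ae_of_all _ fun u => ?_)
    dsimp only
    rw [hpos, hneg, sinh_eq]; ring
  have hS₁ : √(8 * π / T) = s * √(π / N) := by
    rw [hs, ← sqrt_mul (by positivity), hN]
    congr 1
    field_simp
  have hS₂ : √(8 * π / β₃) = s ^ 2 * √(π / N) := by
    rw [sq, mul_assoc, ← hS₁, hs, ← sqrt_mul (by positivity)]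
    congr 1
    field_simp
  have hNT : N⁻¹ = 8 * β₃ * T ^ (-(2:ℝ)) := by
    rw [rpow_neg hT0.le, rpow_two, hN, inv_div, div_eq_mul_inv]
  constructor
  · rw [hI₁, hS₁]
    calc |2 * s * exp N * (∫ u in Ioi (0:ℝ), cosh (a * u) * exp (-N * (u ^ 2 - 1) ^ 2))
            - s * √(π / N) * cosh a * exp N|
        = 2 * s * exp N * |(∫ u in Ioi (0:ℝ), cosh (a * u) * exp (-N * (u ^ 2 - 1) ^ 2))
            - cosh a * (√(π / N) / 2)| := by
          rw [← abs_of_pos (show 0 < 2 * s * exp N by positivity), ← abs_mul,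
            abs_of_pos (show 0 < 2 * s * exp N by positivity)]
          congr 1
          ring
      _ ≤ 2 * s * exp N * (C₁ * (N⁻¹ * √(π / N))) := by gcongr; exact h₁ N hNL
      _ = 16 * β₃ * C₁ * T ^ (-(2:ℝ)) * (s * √(π / N) * 1 * exp N) := by rw [hNT]; ring
      _ ≤ 16 * β₃ * (C₁ + C₂) * T ^ (-(2:ℝ)) * (s * √(π / N) * cosh a * exp N) := by
          gcongr
          · linarith
          · exact one_le_cosh a
  · rw [hI₂, hS₂]
    calc |2 * s ^ 2 * exp N *
            (∫ u in Ioi (0:ℝ), u * sinh (a * u) * exp (-N * (u ^ 2 - 1) ^ 2))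
            - s ^ 2 * √(π / N) * sinh a * exp N|
        = 2 * s ^ 2 * exp N *
            |(∫ u in Ioi (0:ℝ), u * sinh (a * u) * exp (-N * (u ^ 2 - 1) ^ 2))
            - sinh a * (√(π / N) / 2)| := by
          rw [← abs_of_pos (show 0 < 2 * s ^ 2 * exp N by positivity), ← abs_mul,
            abs_of_pos (show 0 < 2 * s ^ 2 * exp N by positivity)]
          congr 1
          ring
      _ ≤ 2 * s ^ 2 * exp N * (C₂ * (N⁻¹ * √(π / N)) * |sinh a|) := by gcongr; exact h₂ N hNL
      _ = 16 * β₃ * C₂ * T ^ (-(2:ℝ)) * (s ^ 2 * √(π / N) * |sinh a| * exp N) := by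
          rw [hNT]; ring
      _ ≤ 16 * β₃ * (C₁ + C₂) * T ^ (-(2:ℝ)) * (s ^ 2 * √(π / N) * |sinh a| * exp N) := by
          gcongr
          linarith
end

section
/- Lemma 2.2 (bounds for the self-similar cubic profile): There exists a constant C ≥ 1, depending only on β₃, such that for all t < 0 and x ∈ ℝ: (i) C⁻¹·min(|x|/|t|, |x|^(1/3)) ≤ |𝔲(t,x)| ≤ C·min(|x|/|t|, |x|^(1/3)); (ii) C⁻¹·(|t| + 𝔲(t,x)²) ≤ 𝔪(t,x)⁻¹ ≤ C·(|t| + 𝔲(t,x)²); (iii) C⁻¹·max(|t|^(1/2), |x|^(1/3)) ≤ 𝔡(t,x) ≤ C·max(|t|^(1/2), |x|^(1/3)). Moreover, for all t < 0 and all x ≠ 0, 𝔪(t,x) ≤ |𝔲(t,x)|/|x|. -/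
open Set

/-- If `v ≥ 0` solves `s * v + b * v ^ 3 = r ^ 3`, then `v` is comparable with `min (r ^ 3 / s) r`. -/
lemma profile_comparable {b C s v r : ℝ} (hb : 0 < b) (hbC : 2 * b ≤ C) (hC : 2 ≤ C)
    (hCb : 1 ≤ C * b) (hs : 0 < s) (hv : 0 ≤ v) (hr : 0 ≤ r) (h : s * v + b * v ^ 3 = r ^ 3) :
    C⁻¹ * min (r ^ 3 / s) r ≤ v ∧ v ≤ C * min (r ^ 3 / s) r := by
  have hC0 : 0 < C := by linarith
  have hv3 : 0 ≤ v ^ 3 := by positivity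
  have hCC : C ≤ C ^ 3 := le_self_pow₀ (by linarith) (by norm_num)
  constructor
  · rw [inv_mul_le_iff₀ hC0, min_le_iff, div_le_iff₀ hs]
    rcases le_total (b * v ^ 3) (s * v) with hsv | hsv
    · left
      nlinarith [mul_nonneg hs.le hv]
    · right
      refine le_of_pow_le_pow_left₀ (n := 3) (by norm_num) (by positivity) ?_
      rw [mul_pow]
      nlinarith
  · rw [mul_min_of_nonneg _ _ hC0.le, le_min_iff]
    constructor
    · have hvs : v ≤ r ^ 3 / s := by
        rw [le_div_iff₀ hs]
        nlinarith [mul_nonneg hb.le hv3]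
      have : 0 ≤ r ^ 3 / s := by positivity
      nlinarith
    · refine le_of_pow_le_pow_left₀ (n := 3) (by norm_num) (by positivity) ?_
      rw [mul_pow]
      have hbr : b * v ^ 3 ≤ r ^ 3 := by nlinarith [mul_nonneg hs.le hv]
      calc v ^ 3 ≤ (C * b) * v ^ 3 := le_mul_of_one_le_left hv3 hCb
        _ = C * (b * v ^ 3) := by ring
        _ ≤ C ^ 3 * r ^ 3 := by gcongr

/-- If `v ≥ 0` solves `q ^ 2 * v + b * v ^ 3 = r ^ 3`, then `√(q ^ 2 + 3 * b * v ^ 2)` is comparable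
with `max q r`. -/
lemma sqrt_slope_comparable {b c C q v r : ℝ} (hb : 0 < b) (hc : 0 < c) (hbc : b * c = 1)
    (hC : C = 4 * (1 + b + c)) (hq : 0 ≤ q) (hv : 0 ≤ v) (hr : 0 ≤ r)
    (h : q ^ 2 * v + b * v ^ 3 = r ^ 3) :
    C⁻¹ * max q r ≤ √(q ^ 2 + 3 * b * v ^ 2) ∧ √(q ^ 2 + 3 * b * v ^ 2) ≤ C * max q r := by
  have hC0 : 0 < C := by rw [hC]; positivity
  have hC4 : 4 ≤ C := by linarith
  have hCC : C ≤ C ^ 3 := le_self_pow₀ (by linarith) (by norm_num)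
  constructor
  · have hd2 : √(q ^ 2 + 3 * b * v ^ 2) ^ 2 = q ^ 2 + 3 * b * v ^ 2 := Real.sq_sqrt (by positivity)
    have hd : 0 ≤ √(q ^ 2 + 3 * b * v ^ 2) := Real.sqrt_nonneg _
    generalize √(q ^ 2 + 3 * b * v ^ 2) = d at hd hd2 ⊢
    rw [inv_mul_le_iff₀ hC0, max_le_iff]
    constructor
    · have hqd : q ≤ d := by
        refine le_of_pow_le_pow_left₀ (n := 2) (by norm_num) hd ?_
        rw [hd2]
        have : 0 ≤ 3 * b * v ^ 2 := by positivity
        linarith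
      nlinarith
    · have hvd : v ≤ (1 + c) * d := by
        refine le_of_pow_le_pow_left₀ (n := 2) (by norm_num) (by positivity) ?_
        have hcd : v ^ 2 ≤ c * d ^ 2 := by
          have : c * d ^ 2 = c * q ^ 2 + 3 * (b * c) * v ^ 2 := by rw [hd2]; ring
          rw [this, hbc]
          have : 0 ≤ c * q ^ 2 := by positivity
          nlinarith [sq_nonneg v]
        rw [mul_pow]
        exact hcd.trans (by gcongr; nlinarith)
      refine le_of_pow_le_pow_left₀ (n := 3) (by norm_num) (by positivity) ?_
      calc r ^ 3 = q ^ 2 * v + b * v ^ 3 := h.symm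
        _ ≤ d ^ 2 * v := by
          have : 0 ≤ b * v ^ 3 := by positivity
          rw [hd2]; nlinarith
        _ ≤ d ^ 2 * ((1 + c) * d) := by gcongr
        _ = (1 + c) * d ^ 3 := by ring
        _ ≤ C ^ 3 * d ^ 3 := by gcongr; linarith
        _ = (C * d) ^ 3 := by ring
  · set M := max q r
    have hqM : q ≤ M := le_max_left _ _
    have hrM : r ≤ M := le_max_right _ _
    have hM : 0 ≤ M := hq.trans hqM
    have hvM : v ≤ (1 + c) * M := by
      refine le_of_pow_le_pow_left₀ (n := 3) (by norm_num) (by positivity) ?_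
      have hbv : b * v ^ 3 ≤ M ^ 3 := by
        have : 0 ≤ q ^ 2 * v := by positivity
        have : r ^ 3 ≤ M ^ 3 := by gcongr
        linarith
      calc v ^ 3 = (b * c) * v ^ 3 := by rw [hbc, one_mul]
        _ = c * (b * v ^ 3) := by ring
        _ ≤ (1 + c) ^ 3 * M ^ 3 := by
          gcongr
          linarith [le_self_pow₀ (show 1 ≤ 1 + c by linarith) (show 3 ≠ 0 by norm_num)]
        _ = ((1 + c) * M) ^ 3 := by ring
    refine Real.sqrt_le_iff.mpr ⟨by positivity, ?_⟩
    calc q ^ 2 + 3 * b * v ^ 2 ≤ M ^ 2 + 3 * b * ((1 + c) * M) ^ 2 := by gcongr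
      _ = (1 + 3 * (b + 2 * (b * c) + (b * c) * c)) * M ^ 2 := by ring
      _ ≤ C ^ 2 * M ^ 2 := by
        rw [hbc]
        gcongr
        nlinarith
      _ = (C * M) ^ 2 := by ring

/-- Lemma 2.2: bounds for the self-similar cubic profile `𝔲`, its slope `𝔪`
and the distance `𝔡`. -/
theorem statement7
    (β₃ : ℝ) (hβ₃ : 0 < β₃)
    (uu mm dd : ℝ → ℝ → ℝ)
    (huu : ∀ t : ℝ, t < 0 → ∀ x : ℝ, t * uu t x - β₃ * uu t x ^ 3 = x)
    (hmm : ∀ t x : ℝ, mm t x = (|t| + 3 * β₃ * uu t x ^ 2)⁻¹)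
    (hdd : ∀ t x : ℝ, dd t x = Real.sqrt (|t| + 3 * β₃ * uu t x ^ 2)) :
    ∃ C : ℝ, 1 ≤ C ∧ ∀ t : ℝ, t < 0 → ∀ x : ℝ,
      (C⁻¹ * min (|x| / |t|) (|x| ^ ((1:ℝ)/3)) ≤ |uu t x| ∧
        |uu t x| ≤ C * min (|x| / |t|) (|x| ^ ((1:ℝ)/3))) ∧
      (C⁻¹ * (|t| + uu t x ^ 2) ≤ (mm t x)⁻¹ ∧
        (mm t x)⁻¹ ≤ C * (|t| + uu t x ^ 2)) ∧
      (C⁻¹ * max (|t| ^ ((1:ℝ)/2)) (|x| ^ ((1:ℝ)/3)) ≤ dd t x ∧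
        dd t x ≤ C * max (|t| ^ ((1:ℝ)/2)) (|x| ^ ((1:ℝ)/3))) ∧
      (x ≠ 0 → mm t x ≤ |uu t x| / |x|) := by
  have hc : 0 < β₃⁻¹ := inv_pos.mpr hβ₃
  have hbc : β₃ * β₃⁻¹ = 1 := mul_inv_cancel₀ hβ₃.ne'
  obtain ⟨C, hC⟩ : ∃ C, C = 4 * (1 + β₃ + β₃⁻¹) := ⟨_, rfl⟩
  have hC0 : 0 < C := by rw [hC]; positivity
  have hCb : 1 ≤ C * β₃ := by rw [hC]; nlinarith
  refine ⟨C, by linarith, fun t ht x => ?_⟩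
  have hs : 0 < |t| := abs_pos.mpr ht.ne
  have hx : |t| * |uu t x| + β₃ * |uu t x| ^ 3 = |x| := by
    have hxu : x = -(uu t x * (|t| + β₃ * uu t x ^ 2)) := by
      rw [abs_of_neg ht]; linear_combination -(huu t ht x)
    have hpos : 0 < |t| + β₃ * uu t x ^ 2 := by positivity
    have hax : |x| = |uu t x| * (|t| + β₃ * uu t x ^ 2) := by
      conv_lhs => rw [hxu, abs_neg, abs_mul, abs_of_pos hpos]
    rw [hax, ← sq_abs (uu t x)]; ring
  have hr3 : (|x| ^ ((1:ℝ)/3)) ^ 3 = |x| := by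
    rw [← Real.rpow_mul_natCast (abs_nonneg x)]; norm_num
  have hq2 : (|t| ^ ((1:ℝ)/2)) ^ 2 = |t| := by
    rw [← Real.rpow_mul_natCast (abs_nonneg t)]; norm_num
  have hr : 0 ≤ |x| ^ ((1:ℝ)/3) := by positivity
  have hq : 0 ≤ |t| ^ ((1:ℝ)/2) := by positivity
  have hu2 := sq_nonneg (uu t x)
  rw [hmm, hdd, inv_inv]
  refine ⟨?_, ⟨?_, ?_⟩, ?_, fun hx0 => ?_⟩
  · have := profile_comparable hβ₃ (by linarith) (by linarith) hCb hs (abs_nonneg (uu t x)) hr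
      (hx.trans hr3.symm)
    rwa [hr3] at this
  · rw [inv_mul_le_iff₀ hC0]
    nlinarith
  · nlinarith
  · have := sqrt_slope_comparable hβ₃ hc hbc hC hq (abs_nonneg (uu t x)) hr
      (by rw [hq2, hr3, hx])
    rwa [hq2, sq_abs] at this
  · rw [inv_eq_one_div, div_le_div_iff₀ (by positivity) (abs_pos.mpr hx0), ← sq_abs (uu t x), ← hx]
    have : 0 ≤ β₃ * |uu t x| ^ 3 := by positivity
    nlinarith
end

section
/- Lemma 3.1 (triviality outside a compact region, for the inviscid solution and the first corrector): Let t₀ ∈ ℝ, T ∈ (t₀,∞], c̊ ∈ ℝ, L̊ > 0. Let ů : ℝ → ℝ be C¹ with ů(x) = c̊ for all |x| ≥ L̊, and let u : [t₀,T) × ℝ → ℝ be a C² solution of ∂ₜu = −u·∂ₓu with u(t₀,·) = ů. Then: (i) u(t,x) = c̊ whenever |x − c̊·(t − t₀)| ≥ L̊. (ii) If in addition u is C³ and w : [t₀,T) × ℝ → ℝ is C¹ with ∂ₜw = −∂ₓ(u·w) + ∂ₓ²u and w(t₀,·) = 0, then w(t,x) = 0 whenever |x − c̊·(t − t₀)|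 ≥ L̊. -/
open Set

/-- A function that is constant on the closed set `{y | L ≤ |y - b|}`, which has no isolated
points, has zero derivative there. -/
lemma deriv_eq_zero_of_const_outside {f : ℝ → ℝ} {b L k : ℝ}
    (hf : ∀ y, L ≤ |y - b| → f y = k) {x : ℝ} (hx : L ≤ |x - b|) : deriv f x = 0 := by
  by_cases hd : DifferentiableAt ℝ f x
  swap
  · exact deriv_zero_of_not_differentiableAt hd
  have key : ∀ s : Set ℝ, UniqueDiffWithinAt ℝ s x → (∀ y ∈ s, L ≤ |y - b|) → x ∈ s →
      deriv f x = 0 := by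
    intro s hs hsub hxs
    rw [← hd.derivWithin hs, derivWithin_congr (f := fun _ => k) (fun y hy => hf y (hsub y hy))
      (hf x hx)]
    simp
  rcases le_abs.1 hx with h | h
  · refine key (Ici x) (uniqueDiffOn_Ici x x self_mem_Ici) (fun y hy => ?_) self_mem_Ici
    exact le_abs.2 (Or.inl (by linarith [mem_Ici.1 hy]))
  · refine key (Iic x) (uniqueDiffOn_Iic x x self_mem_Iic) (fun y hy => ?_) self_mem_Iic
    exact le_abs.2 (Or.inr (by linarith [mem_Iic.1 hy]))

lemma hasDerivAt_snd_of_hasFDerivAt {f : ℝ → ℝ → ℝ} {s y : ℝ} {f' : ℝ × ℝ →L[ℝ] ℝ}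
    (hf : HasFDerivAt (fun p : ℝ × ℝ => f p.1 p.2) f' (s, y)) :
    HasDerivAt (fun z => f s z) (f' (0, 1)) y :=
  hf.comp_hasDerivAt (f := fun z : ℝ => (s, z)) y
    ((hasDerivAt_const y s).prodMk (hasDerivAt_id y))

lemma hasDerivAt_fst_of_hasFDerivAt {f : ℝ → ℝ → ℝ} {s y : ℝ} {f' : ℝ × ℝ →L[ℝ] ℝ}
    (hf : HasFDerivAt (fun p : ℝ × ℝ => f p.1 p.2) f' (s, y)) :
    HasDerivAt (fun r => f r y) (f' (1, 0)) s :=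
  hf.comp_hasDerivAt (f := fun r : ℝ => (r, y)) s
    ((hasDerivAt_id s).prodMk (hasDerivAt_const s y))

/-- The derivative of a function of two variables along a line of slope `c`. -/
lemma hasDerivAt_along_line {f : ℝ → ℝ → ℝ} {x c t s : ℝ}
    (hf : DifferentiableAt ℝ (fun p : ℝ × ℝ => f p.1 p.2) (s, x - c * (t - s))) :
    HasDerivAt (fun r => f r (x - c * (t - r)))
      (deriv (fun r => f r (x - c * (t - s))) s
        + c * deriv (fun y => f s y) (x - c * (t - s))) s := by
  obtain ⟨f', hf'⟩ := hf
  rw [(hasDerivAt_fst_of_hasFDerivAt hf').deriv, (hasDerivAt_snd_of_hasFDerivAt hf').deriv]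
  have hline : HasDerivAt (fun r : ℝ => (r, x - c * (t - r))) (1, c) s := by
    refine (hasDerivAt_id s).prodMk ?_
    have := (((hasDerivAt_id s).const_sub t).const_mul c).const_sub x
    simpa using this
  have h := hf'.comp_hasDerivAt (f := fun r : ℝ => (r, x - c * (t - r))) s hline
  have hsplit : ((1, c) : ℝ × ℝ) = (1, 0) + c • (0, 1) := by simp
  rw [hsplit, map_add, map_smul, smul_eq_mul] at h
  exact h

/-- A solution of `v' = -a v` with bounded coefficient and zero initial value vanishes. -/
lemma eq_zero_of_linear_ode {v a : ℝ → ℝ} {t₀ t K : ℝ} (ht : t₀ ≤ t)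
    (hv : ContinuousOn v (Icc t₀ t))
    (hd : ∀ s ∈ Ioo t₀ t, HasDerivAt v (-(v s) * a s) s)
    (ha : ∀ s ∈ Ioo t₀ t, |a s| ≤ K) (h0 : v t₀ = 0) : v t = 0 := by
  have hE : ∀ s, HasDerivAt (fun r : ℝ => Real.exp (-(2 * K) * r))
      (Real.exp (-(2 * K) * s) * -(2 * K)) s := fun s => by
    simpa using ((hasDerivAt_id s).const_mul (-(2 * K))).exp
  have hg : ∀ s ∈ Ioo t₀ t, HasDerivAt (fun r => v r ^ 2 * Real.exp (-(2 * K) * r)) _ s :=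
    fun s hs => ((hd s hs).pow 2).mul (hE s)
  have hanti : AntitoneOn (fun r => v r ^ 2 * Real.exp (-(2 * K) * r)) (Icc t₀ t) := by
    refine antitoneOn_of_deriv_nonpos (convex_Icc _ _)
      ((hv.pow 2).mul (by fun_prop)) ?_ ?_ <;> rw [interior_Icc]
    · exact fun s hs => (hg s hs).differentiableAt.differentiableWithinAt
    · intro s hs
      rw [(hg s hs).deriv]
      have h1 : 0 ≤ v s ^ 2 * Real.exp (-(2 * K) * s) * (K + a s) :=
        mul_nonneg (by positivity) (by linarith [(abs_le.1 (ha s hs)).1])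
      simp only [Pi.pow_apply]
      norm_num only [pow_one]
      nlinarith only [h1]
  have h := hanti (left_mem_Icc.2 ht) (right_mem_Icc.2 ht) ht
  simp only [h0] at h
  have hpos := Real.exp_pos (-(2 * K) * t)
  have : v t ^ 2 ≤ 0 := by
    by_contra! hlt
    nlinarith [mul_pos hlt hpos]
  exact pow_eq_zero_iff two_ne_zero |>.1 (le_antisymm this (sq_nonneg _))

/-- A `C¹` solution of the inviscid Burgers equation keeps the value `c` along the line of
slope `c` if it takes that value at the starting point. -/
lemma burgers_const_along_line {u : ℝ → ℝ → ℝ} {t₀ t x c : ℝ} (ht : t₀ ≤ t)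
    (hreg : ContDiffOn ℝ 1 (fun p : ℝ × ℝ => u p.1 p.2) (Icc t₀ t ×ˢ univ))
    (hpde : ∀ s ∈ Ioo t₀ t, ∀ y,
      deriv (fun r => u r y) s = -(u s y) * deriv (fun z => u s z) y)
    (h0 : u t₀ (x - c * (t - t₀)) = c) : u t x = c := by
  rcases ht.eq_or_lt with rfl | hlt
  · simpa using h0
  have hline : ContinuousOn (fun r : ℝ => (r, x - c * (t - r))) (Icc t₀ t) := by fun_prop
  have hmaps : MapsTo (fun r : ℝ => (r, x - c * (t - r))) (Icc t₀ t) (Icc t₀ t ×ˢ univ) :=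
    fun r hr => ⟨hr, mem_univ _⟩
  have hnhds : ∀ s ∈ Ioo t₀ t, ∀ y : ℝ, Icc t₀ t ×ˢ univ ∈ nhds (s, y) := fun s hs y =>
    prod_mem_nhds (Icc_mem_nhds hs.1 hs.2) Filter.univ_mem
  have hdiff : ∀ s ∈ Ioo t₀ t, ∀ y : ℝ,
      DifferentiableAt ℝ (fun p : ℝ × ℝ => u p.1 p.2) (s, y) := fun s hs y =>
    (hreg.contDiffAt (hnhds s hs y)).differentiableAt one_ne_zero
  have hfd := (hreg.continuousOn_fderivWithin
    ((uniqueDiffOn_Icc hlt).prod uniqueDiffOn_univ) le_rfl).comp hline hmaps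
  have hslope := hfd.clm_apply (continuousOn_const (c := ((0, 1) : ℝ × ℝ)))
  obtain ⟨K, hK⟩ := isCompact_Icc.exists_bound_of_continuousOn hslope
  have hv := eq_zero_of_linear_ode (v := fun r => u r (x - c * (t - r)) - c)
    (a := fun s => deriv (fun z => u s z) (x - c * (t - s))) (K := K) ht
    ((hreg.continuousOn.comp hline hmaps).sub continuousOn_const) ?_ ?_ (by simp [h0])
  · simpa [sub_eq_zero] using hv
  · intro s hs
    refine ((hasDerivAt_along_line (hdiff s hs _)).sub_const c).congr_deriv ?_
    rw [hpde s hs]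
    ring
  · intro s hs
    have h := hK s (Ioo_subset_Icc_self hs)
    simp only [Function.comp_apply, fderivWithin_of_mem_nhds (hnhds s hs _)] at h
    rwa [(hasDerivAt_snd_of_hasFDerivAt (hdiff s hs _).hasFDerivAt).deriv, ← Real.norm_eq_abs]

/-- The corrector stays zero along lines of slope `c` that lie in the region where `u` equals `c`. -/
lemma corrector_zero_along_line {u w : ℝ → ℝ → ℝ} {t₀ t x c L : ℝ} (ht : t₀ ≤ t)
    (hu : ∀ s ∈ Ioo t₀ t, ∀ y, L ≤ |y - c * (s - t₀)| → u s y = c)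
    (hud : ∀ s ∈ Ioo t₀ t, ∀ y, DifferentiableAt ℝ (fun z => u s z) y)
    (hreg : ContDiffOn ℝ 1 (fun p : ℝ × ℝ => w p.1 p.2) (Icc t₀ t ×ˢ univ))
    (hpde : ∀ s ∈ Ioo t₀ t, ∀ y, deriv (fun r => w r y) s
      = -(deriv (fun z => u s z * w s z) y) + deriv (deriv (fun z => u s z)) y)
    (h0 : ∀ y, w t₀ y = 0) (hx : L ≤ |x - c * (t - t₀)|) : w t x = 0 := by
  have hdiff : ∀ s ∈ Ioo t₀ t, ∀ y : ℝ,
      DifferentiableAt ℝ (fun p : ℝ × ℝ => w p.1 p.2) (s, y) := fun s hs y =>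
    (hreg.contDiffAt (prod_mem_nhds (Icc_mem_nhds hs.1 hs.2) Filter.univ_mem)).differentiableAt
      one_ne_zero
  have hv := eq_zero_of_linear_ode (v := fun r => w r (x - c * (t - r)))
    (a := fun _ => 0) (K := 0) ht
    (hreg.continuousOn.comp (f := fun r : ℝ => (r, x - c * (t - r))) (by fun_prop)
      (fun r hr => ⟨hr, mem_univ _⟩)) ?_ (by simp) (h0 _)
  · simpa using hv
  · intro s hs
    refine (hasDerivAt_along_line (hdiff s hs _)).congr_deriv ?_
    have hy : L ≤ |x - c * (t - s) - c * (s - t₀)| := by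
      convert hx using 2; ring
    have hux : ∀ y, L ≤ |y - c * (s - t₀)| → deriv (fun z => u s z) y = 0 := fun y h =>
      deriv_eq_zero_of_const_outside (hu s hs) h
    rw [hpde s hs, deriv_eq_zero_of_const_outside hux hy,
      deriv_fun_mul (hud s hs _)
        (hasDerivAt_snd_of_hasFDerivAt (hdiff s hs _).hasFDerivAt).differentiableAt,
      hux _ hy, hu s hs _ hy]
    ring

/-- Lemma 3.1: triviality outside a compact region for the inviscid solution
and for the first viscous corrector. -/
theorem statement10
    (t₀ : ℝ) (T : EReal) (hT : (t₀ : EReal) < T)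
    (cInit LInit : ℝ) (hL : 0 < LInit)
    (uInit : ℝ → ℝ) (hInit : ContDiff ℝ 1 uInit)
    (hconst : ∀ x : ℝ, LInit ≤ |x| → uInit x = cInit)
    (u : ℝ → ℝ → ℝ)
    (hreg : ContDiffOn ℝ 2 (fun p : ℝ × ℝ => u p.1 p.2)
      ({t : ℝ | t₀ ≤ t ∧ (t : EReal) < T} ×ˢ (Set.univ : Set ℝ)))
    (hpde : ∀ t : ℝ, t₀ < t → (t : EReal) < T → ∀ x : ℝ,
      deriv (fun s => u s x) t = -(u t x) * deriv (fun y => u t y) x)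
    (hinit : ∀ x : ℝ, u t₀ x = uInit x) :
    (∀ t : ℝ, t₀ ≤ t → (t : EReal) < T → ∀ x : ℝ,
      LInit ≤ |x - cInit * (t - t₀)| → u t x = cInit) ∧
    (ContDiffOn ℝ 3 (fun p : ℝ × ℝ => u p.1 p.2)
        ({t : ℝ | t₀ ≤ t ∧ (t : EReal) < T} ×ˢ (Set.univ : Set ℝ)) →
      ∀ w : ℝ → ℝ → ℝ,
        ContDiffOn ℝ 1 (fun p : ℝ × ℝ => w p.1 p.2)
          ({t : ℝ | t₀ ≤ t ∧ (t : EReal) < T} ×ˢ (Set.univ : Set ℝ)) →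
        (∀ t : ℝ, t₀ < t → (t : EReal) < T → ∀ x : ℝ,
          deriv (fun s => w s x) t
            = -(deriv (fun y => u t y * w t y) x)
              + deriv (deriv (fun y => u t y)) x) →
        (∀ x : ℝ, w t₀ x = 0) →
        ∀ t : ℝ, t₀ ≤ t → (t : EReal) < T → ∀ x : ℝ,
          LInit ≤ |x - cInit * (t - t₀)| → w t x = 0) := by
  have hsub : ∀ t : ℝ, (t : EReal) < T →
      Icc t₀ t ×ˢ (univ : Set ℝ) ⊆ {t : ℝ | t₀ ≤ t ∧ (t : EReal) < T} ×ˢ univ := fun t htT =>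
    prod_mono (fun s hs => ⟨hs.1, (EReal.coe_le_coe_iff.2 hs.2).trans_lt htT⟩) subset_rfl
  have hlt : ∀ {s t : ℝ}, (t : EReal) < T → s ∈ Ioo t₀ t → (s : EReal) < T := fun htT hs =>
    (EReal.coe_lt_coe_iff.2 hs.2).trans htT
  have hreg1 : ∀ t : ℝ, (t : EReal) < T →
      ContDiffOn ℝ 1 (fun p : ℝ × ℝ => u p.1 p.2) (Icc t₀ t ×ˢ univ) := fun t htT =>
    (hreg.mono (hsub t htT)).of_le one_le_two
  have hu : ∀ t : ℝ, t₀ ≤ t → (t : EReal) < T → ∀ x : ℝ,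
      LInit ≤ |x - cInit * (t - t₀)| → u t x = cInit := fun t ht htT x hx =>
    burgers_const_along_line ht (hreg1 t htT) (fun s hs => hpde s hs.1 (hlt htT hs))
      ((hinit _).trans (hconst _ hx))
  refine ⟨hu, fun _ w hw hwpde hw0 t ht htT x hx => ?_⟩
  refine corrector_zero_along_line ht (fun s hs => hu s hs.1.le (hlt htT hs)) ?_
    (hw.mono (hsub t htT)) (fun s hs => hwpde s hs.1 (hlt htT hs)) hw0 hx
  intro s hs y
  have hd := ((hreg1 t htT).contDiffAt (x := (s, y))
    (prod_mem_nhds (Icc_mem_nhds hs.1 hs.2) Filter.univ_mem)).differentiableAt one_ne_zero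
  exact (hasDerivAt_snd_of_hasFDerivAt hd.hasFDerivAt).differentiableAt
end

section
/- Lemma 2.4 (the inviscid solution resembles the cubic profile near the shock): There exists a constant C, depending only on ů, such that for all (t,x) ∈ [t₀,0) × [−1,1]: |u⁰(t,x) − 𝔲(t,x)| ≤ C·|x|^(1/3)·|𝔲(t,x)|. -/
open Set

open scoped Topology in
/-- A smooth function vanishing at `0` together with its second derivative agrees with its cubic
Taylor polynomial up to a quartic error. -/
theorem cubic_taylor_isBigO {f : ℝ → ℝ} (hf : ContDiff ℝ (⊤ : ℕ∞) f) (h0 : f 0 = 0)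
    (h2 : iteratedDeriv 2 f 0 = 0) :
    (fun y => f y - deriv f 0 * y - iteratedDeriv 3 f 0 / 6 * y ^ 3)
      =O[𝓝 0] fun y : ℝ => y ^ 4 := by
  have h4 := (taylor_isLittleO_univ (x₀ := 0) (n := 4)
    (contDiff_infty.1 hf 4)).isBigO
  have hc : (fun y : ℝ => iteratedDeriv 4 f 0 / 24 * y ^ 4) =O[𝓝 0] fun y : ℝ => y ^ 4 :=
    (Asymptotics.isBigO_refl _ _).const_mul_left _
  simp only [sub_zero] at h4
  refine (h4.add hc).congr_left fun y => ?_
  simp only [taylor_within_apply, iteratedDerivWithin_univ, Finset.sum_range_succ,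
    Finset.sum_range_zero, iteratedDeriv_zero, iteratedDeriv_one, h0, h2, sub_zero, smul_eq_mul,
    Nat.factorial]
  push_cast
  ring

open scoped Topology in
/-- If `f` has the expansion `f y = t₀⁻¹ y + b y³ + O(y⁴)`, then `t₀ v - t₀⁴ b v³` inverts `f`
up to a quartic error. -/
theorem cubic_inverse_isBigO {f : ℝ → ℝ} {t₀ b : ℝ} (ht₀ : t₀ ≠ 0)
    (hR : (fun y => f y - t₀⁻¹ * y - b * y ^ 3) =O[𝓝 0] fun y : ℝ => y ^ 4) :
    (fun y => t₀ * f y - t₀ ^ 4 * b * f y ^ 3 - y) =O[𝓝 0] fun y => f y ^ 4 := by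
  have h43 : (fun y : ℝ => y ^ 4) =O[𝓝 0] fun y : ℝ => y ^ 3 :=
    (Asymptotics.isLittleO_pow_pow (𝕜 := ℝ) (by norm_num)).isBigO
  have h54 : (fun y : ℝ => y ^ 5) =O[𝓝 0] fun y : ℝ => y ^ 4 :=
    (Asymptotics.isLittleO_pow_pow (𝕜 := ℝ) (by norm_num)).isBigO
  have h31 : (fun y : ℝ => y ^ 3) =o[𝓝 0] fun y : ℝ => y := by
    simpa using Asymptotics.isLittleO_pow_pow (𝕜 := ℝ) (m := 1) (n := 3) (by norm_num)
  have hD : (fun y => t₀ * f y - y) =O[𝓝 0] fun y : ℝ => y ^ 3 := by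
    refine (((hR.trans h43).const_mul_left t₀).add
      ((Asymptotics.isBigO_refl (fun y : ℝ => y ^ 3) (𝓝 0)).const_mul_left (t₀ * b))).congr_left
      fun y => ?_
    field_simp
    ring
  have hs : (fun y => t₀ * f y) =O[𝓝 0] fun y : ℝ => y :=
    ((hD.trans_isLittleO h31).isBigO.add (Asymptotics.isBigO_refl _ _)).congr_left
      fun y => by ring
  have hy : (fun y : ℝ => y) =O[𝓝 0] f := by
    have h := (hD.trans_isLittleO h31).right_isBigO_add
    refine (h.congr_right fun y => ?_).trans
      ((Asymptotics.isBigO_refl f (𝓝 0)).const_mul_left t₀)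
    ring
  have hid := Asymptotics.isBigO_refl (fun y : ℝ => y) (𝓝 0)
  have hq : (fun y => y ^ 2 + y * (t₀ * f y) + (t₀ * f y) ^ 2) =O[𝓝 0] fun y : ℝ => y ^ 2 := by
    refine ((Asymptotics.isBigO_refl _ _).add ?_).add (hs.pow 2)
    exact (hid.mul hs).congr_right fun y => by ring
  have hprod := ((hD.mul hq).congr_right (g₂ := fun y : ℝ => y ^ 5) fun y => by ring).trans h54
  refine (((hR.const_mul_left t₀).sub (hprod.const_mul_left (t₀ * b))).congr_left
    fun y => ?_).trans (hy.pow 4)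
  field_simp
  ring

/-- Quantitative stability of the real root of `t u - β u³ = x`. -/
theorem abs_sub_cubic_root_le {t β x U v K : ℝ} (ht : t < 0) (hβ : 0 < β)
    (hU : t * U - β * U ^ 3 = x) (hv : |t * v - β * v ^ 3 - x| ≤ K * v ^ 4) :
    |v - U| ≤ 2 * K / β * v ^ 2 := by
  have hfac : t * v - β * v ^ 3 - x = -((v - U) * (-t + β * (v ^ 2 + v * U + U ^ 2))) := by
    rw [← hU]; ring
  have hq : 1 / 2 * v ^ 2 ≤ v ^ 2 + v * U + U ^ 2 := by nlinarith [sq_nonneg (v + 2 * U)]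
  have hpos : 0 < -t + β * (v ^ 2 + v * U + U ^ 2) := by
    have : 0 ≤ β * (v ^ 2 + v * U + U ^ 2) := mul_nonneg hβ.le (by nlinarith [sq_nonneg v])
    linarith
  rw [hfac, abs_neg, abs_mul, abs_of_pos hpos] at hv
  rcases eq_or_ne v 0 with rfl | hv0
  · have : |0 - U| ≤ 0 := by
      by_contra! h
      have := mul_pos h hpos
      norm_num at hv this
      linarith
    simpa using this
  · have hv2 : 0 < v ^ 2 := by positivity
    have h1 : |v - U| * (β * (1 / 2 * v ^ 2)) ≤ K * v ^ 4 := by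
      refine le_trans ?_ hv
      gcongr
      nlinarith [mul_le_mul_of_nonneg_left hq hβ.le]
    have h2 : |v - U| * β ≤ 2 * K * v ^ 2 := by
      refine le_of_mul_le_mul_right ?_ hv2
      nlinarith
    rw [div_mul_eq_mul_div, le_div_iff₀ hβ]
    exact h2

/-- The real root of `t u - β u³ = x` is `O(|x|^(1/3))`, uniformly in `t < 0`. -/
theorem abs_cubic_root_le {t β x U r : ℝ} (ht : t < 0) (hβ : 0 < β) (hr : 0 ≤ r)
    (hr3 : r ^ 3 = |x|) (hU : t * U - β * U ^ 3 = x) :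
    |x| = |U| * (-t + β * U ^ 2) ∧ |U| ≤ (1 + β⁻¹) * r := by
  have hpos : 0 < -t + β * U ^ 2 := by have := mul_nonneg hβ.le (sq_nonneg U); linarith
  have hx : |x| = |U| * (-t + β * U ^ 2) := by
    rw [← hU, show t * U - β * U ^ 3 = -(U * (-t + β * U ^ 2)) by ring, abs_neg, abs_mul,
      abs_of_pos hpos]
  refine ⟨hx, ?_⟩
  have hi : 0 < β⁻¹ := inv_pos.2 hβ
  have hc : 1 ≤ β * (1 + β⁻¹) ^ 3 := by
    have h1 : β * β⁻¹ = 1 := mul_inv_cancel₀ hβ.ne'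
    have h2 : β * (1 + β⁻¹) ^ 3 = β + 3 + 3 * β⁻¹ + β⁻¹ ^ 2 := by
      linear_combination (3 + 3 * β⁻¹ + β⁻¹ ^ 2) * h1
    nlinarith [sq_nonneg β⁻¹]
  have h3 : β * |U| ^ 3 ≤ r ^ 3 := by
    rw [hr3, hx, ← sq_abs U]
    nlinarith [abs_nonneg U]
  refine le_of_not_gt fun hlt => ?_
  have h4 : ((1 + β⁻¹) * r) ^ 3 < |U| ^ 3 := pow_lt_pow_left₀ hlt (by positivity) (by norm_num)
  rw [mul_pow] at h4
  nlinarith [mul_le_mul_of_nonneg_right hc (pow_nonneg hr 3), mul_lt_mul_of_pos_left h4 hβ]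

/-- A smooth solution of the inviscid Burgers equation is constant along characteristics. -/
theorem burgers_eq_init {t₀ : ℝ} {w : ℝ → ℝ → ℝ}
    (hw : ContDiffOn ℝ (⊤ : ℕ∞) (fun p : ℝ × ℝ => w p.1 p.2) (Ico t₀ 0 ×ˢ univ))
    (hpde : ∀ t ∈ Ico t₀ (0:ℝ), ∀ x : ℝ,
      deriv (fun s => w s x) t = -(w t x) * deriv (fun y => w t y) x)
    {t x : ℝ} (ht : t ∈ Ico t₀ (0:ℝ)) :
    w t₀ (x - (t - t₀) * w t x) = w t x := by
  set v := w t x with hv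
  rcases eq_or_lt_of_le ht.1 with rfl | htt
  · simp [hv]
  set F : ℝ × ℝ → ℝ := fun p => w p.1 p.2 with hF
  have hopen : IsOpen (Ioo t₀ 0 ×ˢ (univ : Set ℝ)) := isOpen_Ioo.prod isOpen_univ
  have hw' : ContDiffOn ℝ (⊤ : ℕ∞) F (Ioo t₀ 0 ×ˢ univ) :=
    hw.mono (prod_mono Ioo_subset_Ico_self subset_rfl)
  let γ : ℝ → ℝ × ℝ := fun r => (t - r, x - r * v)
  have hγc : Continuous γ := by fun_prop
  have hinner : ∀ b ∈ Ico 0 (t - t₀), F (γ b) - v = 0 := by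
    intro b hb
    have hmem : ∀ r ∈ Icc 0 b, γ r ∈ Ioo t₀ 0 ×ˢ (univ : Set ℝ) := fun r hr =>
      ⟨⟨by simp only [γ]; linarith [hr.2, hb.2], by simp only [γ]; linarith [hr.1, ht.2]⟩, trivial⟩
    have hcont : ContinuousOn (fun r => fderiv ℝ F (γ r) (0, 1)) (Icc 0 b) :=
      ((hw'.continuousOn_fderiv_of_isOpen hopen (by exact_mod_cast le_top)).comp hγc.continuousOn
        hmem).clm_apply continuousOn_const
    obtain ⟨K, hK⟩ := isCompact_Icc.exists_bound_of_continuousOn hcont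
    have hderiv : ∀ r ∈ Icc 0 b,
        HasDerivAt (fun r => F (γ r) - v) ((F (γ r) - v) * fderiv ℝ F (γ r) (0, 1)) r := by
      intro r hr
      have hd : HasFDerivAt F (fderiv ℝ F (γ r)) (γ r) :=
        ((hw'.contDiffAt (hopen.mem_nhds (hmem r hr))).differentiableAt (by simp)).hasFDerivAt
      have hγ : HasDerivAt γ (-1, -v) r := by
        have h1 : HasDerivAt (fun r : ℝ => t - r) (-1) r := by
          simpa using (hasDerivAt_id r).const_sub t
        have h2 : HasDerivAt (fun r : ℝ => x - r * v) (-v) r := by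
          simpa using ((hasDerivAt_id r).mul_const v).const_sub x
        exact h1.prodMk h2
      have h1 : HasDerivAt (fun s => w s (γ r).2) (fderiv ℝ F (γ r) (1, 0)) (γ r).1 :=
        HasFDerivAt.comp_hasDerivAt (f := fun s => (s, (γ r).2)) (γ r).1 hd ((hasDerivAt_id _).prodMk (hasDerivAt_const _ _))
      have h2 : HasDerivAt (fun y => w (γ r).1 y) (fderiv ℝ F (γ r) (0, 1)) (γ r).2 :=
        HasFDerivAt.comp_hasDerivAt (f := fun y => ((γ r).1, y)) (γ r).2 hd ((hasDerivAt_const _ _).prodMk (hasDerivAt_id _))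
      have hp := hpde (γ r).1 (Ioo_subset_Ico_self (hmem r hr).1) (γ r).2
      rw [h1.deriv, h2.deriv] at hp
      have hc := (hd.comp_hasDerivAt r hγ).sub_const v
      refine hc.congr_deriv ?_
      rw [show ((-1, -v) : ℝ × ℝ) = (-1 : ℝ) • (1, 0) + (-v) • (0, 1) by simp, map_add, map_smul,
        map_smul, hp]
      simp only [smul_eq_mul, hF]
      ring
    refine eq_zero_of_abs_deriv_le_mul_abs_self_of_eq_zero_right (K := K) (a := 0) (b := b)
      (fun r hr => (hderiv r hr).continuousAt.continuousWithinAt)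
      (fun r hr => (hderiv r (Ico_subset_Icc_self hr)).hasDerivWithinAt) ?_ ?_ b
      (right_mem_Icc.2 hb.1)
    · simp [γ, hF, hv]
    · intro r hr
      rw [norm_mul, mul_comm]
      exact mul_le_mul_of_nonneg_right (hK r (Ico_subset_Icc_self hr)) (norm_nonneg _)
  have hcl : ContinuousOn (fun r => F (γ r) - v) (Icc 0 (t - t₀)) :=
    (hw.continuousOn.comp hγc.continuousOn fun r hr =>
      ⟨⟨by simp only [γ]; linarith [hr.2], by simp only [γ]; linarith [hr.1, ht.2]⟩, trivial⟩).sub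
        continuousOn_const
  have hclos : closure (Ico 0 (t - t₀)) = Icc 0 (t - t₀) := closure_Ico (by linarith)
  have hEq : EqOn (fun r => F (γ r) - v) (fun _ => 0) (Icc 0 (t - t₀)) :=
    EqOn.of_subset_closure hinner hcl continuousOn_const Ico_subset_Icc_self hclos.ge
  have := hEq (right_mem_Icc.2 (by linarith))
  simp only [γ, hF, sub_sub_cancel] at this
  linarith

/-- Characteristics starting outside `(-δ, δ)` stay uniformly away from the origin. -/
theorem exists_le_abs_characteristic {f : ℝ → ℝ} {t₀ δ : ℝ} (hf : Differentiable ℝ f)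
    (h0 : f 0 = 0) (ht₀ : t₀ < 0) (hd : ∀ x, x ≠ 0 → t₀⁻¹ < deriv f x) (hδ : 0 < δ) :
    ∃ m > 0, ∀ t ∈ Ico t₀ 0, ∀ y, δ ≤ |y| → m ≤ |y + (t - t₀) * f y| := by
  set h : ℝ → ℝ := fun y => f y - t₀⁻¹ * y with hh
  have hder : ∀ y, HasDerivAt h (deriv f y - t₀⁻¹) y := fun y => by
    simpa using (hf y).hasDerivAt.fun_sub ((hasDerivAt_id y).const_mul t₀⁻¹)
  have hc : Continuous h := continuous_iff_continuousAt.2 fun y => (hder y).continuousAt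
  have hp : StrictMonoOn h (Ici 0) := strictMonoOn_of_deriv_pos (convex_Ici 0) hc.continuousOn
    fun y hy => by
      rw [interior_Ici] at hy
      rw [(hder y).deriv]
      exact sub_pos.2 (hd y (ne_of_gt hy))
  have hn : StrictMonoOn h (Iic 0) := strictMonoOn_of_deriv_pos (convex_Iic 0) hc.continuousOn
    fun y hy => by
      rw [interior_Iic] at hy
      rw [(hder y).deriv]
      exact sub_pos.2 (hd y (ne_of_lt hy))
  have hz : h 0 = 0 := by simp [hh, h0]
  have hpos : 0 < h δ := hz ▸ hp (mem_Ici.2 le_rfl) (mem_Ici.2 hδ.le) hδ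
  have hneg : h (-δ) < 0 :=
    hz ▸ hn (mem_Iic.2 (by linarith)) (mem_Iic.2 le_rfl) (by linarith : -δ < 0)
  set m := min δ (-t₀ * min (h δ) (-h (-δ))) with hm
  have hm1 : m ≤ δ := min_le_left _ _
  have hm2 : m ≤ -t₀ * h δ :=
    (min_le_right _ _).trans (mul_le_mul_of_nonneg_left (min_le_left _ _) (by linarith))
  have hm3 : m ≤ -t₀ * -h (-δ) :=
    (min_le_right _ _).trans (mul_le_mul_of_nonneg_left (min_le_right _ _) (by linarith))
  refine ⟨m, lt_min hδ (mul_pos (by linarith) (lt_min hpos (by linarith))), fun t ht y hy => ?_⟩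
  obtain ⟨θ, hθ⟩ : ∃ θ, t = θ * t₀ := ⟨t / t₀, (div_mul_cancel₀ t ht₀.ne).symm⟩
  have hθ0 : 0 ≤ θ := by
    by_contra! hlt
    nlinarith [ht.2]
  have hθ1 : θ ≤ 1 := by
    by_contra! hlt
    nlinarith [ht.1]
  have hx : y + (t - t₀) * f y = θ * y + (1 - θ) * (-t₀ * h y) := by
    rw [hθ]
    linear_combination -((1 - θ) * y) * mul_inv_cancel₀ ht₀.ne
  rw [hx]
  rcases le_abs.1 hy with hy | hy
  · have h1 : h δ ≤ h y := hp.monotoneOn (mem_Ici.2 hδ.le) (mem_Ici.2 (by linarith)) hy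
    have h2 : m ≤ -t₀ * h y := hm2.trans (mul_le_mul_of_nonneg_left h1 (by linarith))
    refine le_trans ?_ (le_abs_self _)
    nlinarith
  · have h1 : h y ≤ h (-δ) :=
      hn.monotoneOn (mem_Iic.2 (by linarith)) (mem_Iic.2 (by linarith)) (by linarith)
    have h2 : m ≤ -t₀ * -h y :=
      hm3.trans (mul_le_mul_of_nonneg_left (by linarith) (by linarith))
    refine le_trans ?_ (neg_le_abs _)
    nlinarith

/-- Lemma 2.4: near the shock, the inviscid solution resembles the cubic
profile: `|u⁰ - 𝔲| ≲ |x|^(1/3) |𝔲|` on `[t₀,0) × [-1,1]`. -/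
theorem statement11
    (uInit : ℝ → ℝ) (cInit LInit : ℝ) (hL : 0 < LInit)
    (h_smooth : ContDiff ℝ (⊤ : ℕ∞) uInit)
    (h_const : ∀ x : ℝ, x ∉ Set.Icc (-LInit) LInit → uInit x = cInit)
    (h_neg : deriv uInit 0 < 0)
    (h_min : ∀ x : ℝ, deriv uInit 0 ≤ deriv uInit x)
    (h_uniq : ∀ x : ℝ, deriv uInit x = deriv uInit 0 → x = 0)
    (h_nondeg : 0 < iteratedDeriv 3 uInit 0)
    (h_val : uInit 0 = 0)
    (t₀ : ℝ) (ht₀ : t₀ = (deriv uInit 0)⁻¹)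
    (β₃ : ℝ) (hβ₃ : β₃ = t₀ ^ 4 * iteratedDeriv 3 uInit 0 / 6)
    (uu : ℝ → ℝ → ℝ)
    (huu : ∀ t : ℝ, t < 0 → ∀ x : ℝ, t * uu t x - β₃ * uu t x ^ 3 = x)
    (u0 : ℝ → ℝ → ℝ)
    (hu0_smooth : ContDiffOn ℝ (⊤ : ℕ∞) (fun p : ℝ × ℝ => u0 p.1 p.2)
      (Set.Ico t₀ 0 ×ˢ (Set.univ : Set ℝ)))
    (hu0_pde : ∀ t ∈ Set.Ico t₀ (0:ℝ), ∀ x : ℝ,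
      deriv (fun s => u0 s x) t = -(u0 t x) * deriv (fun y => u0 t y) x)
    (hu0_init : ∀ x : ℝ, u0 t₀ x = uInit x) :
    ∃ C : ℝ, ∀ t ∈ Set.Ico t₀ (0:ℝ), ∀ x ∈ Set.Icc (-1:ℝ) 1,
      |u0 t x - uu t x| ≤ C * |x| ^ ((1:ℝ)/3) * |uu t x| := by
  have ht₀neg : t₀ < 0 := by rw [ht₀]; exact inv_lt_zero.2 h_neg
  have ha : deriv uInit 0 = t₀⁻¹ := by rw [ht₀, inv_inv]
  have hβ : 0 < β₃ := by
    rw [hβ₃]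
    have : 0 < t₀ ^ 4 := by have := ht₀neg.ne; positivity
    positivity
  have h2 : iteratedDeriv 2 uInit 0 = 0 := by
    rw [iteratedDeriv_succ, iteratedDeriv_one]
    exact IsLocalMin.deriv_eq_zero (Filter.Eventually.of_forall h_min)
  have hexp := cubic_taylor_isBigO h_smooth h_val h2
  rw [ha] at hexp
  obtain ⟨K, hK, hE⟩ := (cubic_inverse_isBigO ht₀neg.ne hexp).exists_pos
  have hsmall : ∀ᶠ y in nhds (0 : ℝ), 2 * K / β₃ * |uInit y| < 1 / 2 := by
    have hc : Continuous fun y => 2 * K / β₃ * |uInit y| :=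
      continuous_const.mul h_smooth.continuous.abs
    exact hc.continuousAt.eventually_lt continuousAt_const (by simp [h_val])
  obtain ⟨δ, hδ, hloc⟩ := Metric.eventually_nhds_iff.1 (hE.bound.and hsmall)
  obtain ⟨m, hm, hfar⟩ := exists_le_abs_characteristic (h_smooth.differentiable (by simp)) h_val
    ht₀neg (fun x hx => ha ▸ lt_of_le_of_ne (h_min x) fun h => hx (h_uniq x h.symm)) hδ
  obtain ⟨M, hM⟩ : ∃ M, ∀ y, |uInit y| ≤ M := by
    obtain ⟨M, hM⟩ := (isCompact_Icc (a := -LInit) (b := LInit)).exists_bound_of_continuousOn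
      h_smooth.continuous.continuousOn
    refine ⟨max M |cInit|, fun y => ?_⟩
    by_cases hy : y ∈ Icc (-LInit) LInit
    · exact (hM y hy).trans (le_max_left _ _)
    · rw [h_const y hy]
      exact le_max_right _ _
  have hM0 : 0 ≤ M := (abs_nonneg _).trans (hM 0)
  set c := 1 + β₃⁻¹ with hc
  have hc0 : 0 < c := by positivity
  set B := -t₀ + β₃ * c ^ 2 with hB
  have hB0 : 0 < B := by have := neg_pos.2 ht₀neg; positivity
  refine ⟨max (4 * (2 * K / β₃) * c) ((M + c) * B / m ^ 2), fun t ht x hx => ?_⟩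
  set U := uu t x
  set r := |x| ^ ((1 : ℝ) / 3) with hr
  have hr0 : 0 ≤ r := by positivity
  have hr3 : r ^ 3 = |x| := by
    rw [hr, ← Real.rpow_natCast, ← Real.rpow_mul (abs_nonneg x)]
    norm_num
  have hU := huu t ht.2 x
  obtain ⟨hxU, hUr⟩ := abs_cubic_root_le ht.2 hβ hr0 hr3 hU
  have hchar := burgers_eq_init hu0_smooth hu0_pde (x := x) ht
  rw [hu0_init] at hchar
  set v := u0 t x
  set y := x - (t - t₀) * v with hy
  rcases lt_or_ge |y| δ with hyδ | hyδ
  · obtain ⟨hE1, hE2⟩ := hloc (y := y) (by simpa using hyδ)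
    rw [hchar] at hE2
    simp only [hchar, Real.norm_eq_abs, abs_pow] at hE1
    have hv : |t * v - β₃ * v ^ 3 - x| ≤ K * v ^ 4 := by
      rw [← abs_pow, abs_of_nonneg (by positivity : 0 ≤ v ^ 4)] at hE1
      convert hE1 using 2
      rw [hβ₃, hy]
      ring
    have h1 := abs_sub_cubic_root_le ht.2 hβ hU hv
    have h2K : 0 ≤ 2 * K / β₃ := by positivity
    have h3 : |v - U| ≤ 1 / 2 * |v| := by
      rw [← sq_abs v] at h1
      nlinarith [abs_nonneg v]
    have h4 : |v| ≤ 2 * |U| := by linarith [abs_sub_abs_le_abs_sub v U]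
    calc |v - U| ≤ 2 * K / β₃ * |v| ^ 2 := by rwa [sq_abs]
      _ ≤ 2 * K / β₃ * (2 * |U|) ^ 2 := by gcongr
      _ = 4 * (2 * K / β₃) * |U| * |U| := by ring
      _ ≤ 4 * (2 * K / β₃) * (c * r) * |U| := by gcongr
      _ = 4 * (2 * K / β₃) * c * r * |U| := by ring
      _ ≤ _ := by gcongr; exact le_max_left _ _
  · have hxm : m ≤ |x| := by
      have := hfar t ht y hyδ
      rwa [hchar, hy, sub_add_cancel] at this
    have hx1 : |x| ≤ 1 := abs_le.2 hx
    have hr1 : r ≤ 1 := Real.rpow_le_one (abs_nonneg x) hx1 (by norm_num)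
    have hmr : m ≤ r := by
      refine hxm.trans (hr3 ▸ ?_)
      exact pow_le_of_le_one hr0 hr1 (by norm_num)
    have hUc : |U| ≤ c := hUr.trans (mul_le_of_le_one_right hc0.le hr1)
    have hmU : m ≤ |U| * B := by
      refine hxm.trans (hxU.trans_le ?_)
      rw [hB, ← sq_abs U]
      gcongr
      exact ht.1
    calc |v - U| ≤ |v| + |U| := abs_sub _ _
      _ ≤ M + c := add_le_add (hchar ▸ hM y) hUc
      _ = (M + c) / m ^ 2 * (m * m) := by field_simp
      _ ≤ (M + c) / m ^ 2 * (r * (|U| * B)) := by gcongr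
      _ = (M + c) * B / m ^ 2 * r * |U| := by ring
      _ ≤ _ := by gcongr; exact le_max_right _ _
end

section
/- Corollary 2.5 (second-order homogeneous expansion of the inviscid solution): There exists a constant C, depending only on ů, such that for all (t,x) ∈ [t₀,0) × [−1,1]: |u⁰(t,x) − 𝔲(t,x) − β₄·𝔲(t,x)⁴·𝔪(t,x)| ≤ C·|𝔲(t,x)|⁵·𝔪(t,x). -/
open Set Filter Topology

/-- Taylor expansion at `0` on an open interval, with a big-O remainder. -/
lemma isBigO_sub_taylor {f : ℝ → ℝ} {s : Set ℝ} (hs : IsOpen s) (hc : Convex ℝ s)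
    (h0 : (0 : ℝ) ∈ s) (hf : ContDiffOn ℝ (⊤ : ℕ∞) f s) (n : ℕ) :
    (fun y => f y - ∑ k ∈ Finset.range (n + 1), (k.factorial : ℝ)⁻¹ * iteratedDeriv k f 0 * y ^ k)
      =O[𝓝 0] fun y => y ^ (n + 1) := by
  have h := taylor_isLittleO (n := n + 1) hc h0 (hf.of_le (by exact_mod_cast le_top))
  rw [hs.nhdsWithin_eq h0] at h
  simp only [taylor_within_apply, sub_zero, smul_eq_mul] at h
  have h' : (fun y : ℝ => (((n + 1).factorial : ℝ)⁻¹ * iteratedDeriv (n + 1) f 0) * y ^ (n + 1))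
      =O[𝓝 0] fun y => y ^ (n + 1) := Asymptotics.isBigO_const_mul_self _ _ _
  refine (h.isBigO.add h').congr_left fun y => ?_
  rw [Finset.sum_range_succ _ (n + 1), iteratedDerivWithin_of_isOpen hs h0]
  have : ∀ k ∈ Finset.range (n + 1), ((k.factorial : ℝ)⁻¹ * y ^ k) * iteratedDerivWithin k f s 0
      = (k.factorial : ℝ)⁻¹ * iteratedDeriv k f 0 * y ^ k := fun k _ => by
    rw [iteratedDerivWithin_of_isOpen hs h0]; ring
  rw [Finset.sum_congr rfl this]
  ring

lemma eq_zero_of_pow_mul_isBigO {g : ℝ → ℝ} (hg : Continuous g) {k : ℕ}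
    (h : (fun y => y ^ k * g y) =O[𝓝 0] fun y => y ^ (k + 1)) : g 0 = 0 := by
  obtain ⟨C, hC⟩ := h.bound
  have hev : ∀ᶠ y in 𝓝[≠] (0 : ℝ), ‖g y‖ ≤ C * ‖y‖ := by
    filter_upwards [hC.filter_mono nhdsWithin_le_nhds, self_mem_nhdsWithin] with y hy hy0
    have hp : 0 < ‖y‖ ^ k := pow_pos (norm_pos_iff.2 hy0) k
    rw [norm_mul, norm_pow, norm_pow, pow_succ] at hy
    refine le_of_mul_le_mul_left ?_ hp
    linarith
  have h1 : Tendsto (fun y : ℝ => C * ‖y‖) (𝓝[≠] 0) (𝓝 0) := by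
    have : Tendsto (fun y : ℝ => C * ‖y‖) (𝓝 0) (𝓝 (C * ‖(0 : ℝ)‖)) :=
      (continuous_const.mul continuous_norm).tendsto 0
    simpa using this.mono_left nhdsWithin_le_nhds
  exact tendsto_nhds_unique ((hg.tendsto 0).mono_left nhdsWithin_le_nhds)
    (squeeze_zero_norm' hev h1)

lemma isBigO_pow_pow {m n : ℕ} (hmn : m ≤ n) :
    (fun y : ℝ => y ^ n) =O[𝓝 0] fun y => y ^ m := by
  refine Asymptotics.IsBigO.of_bound 1 ?_
  filter_upwards [Metric.ball_mem_nhds (0 : ℝ) one_pos] with y hy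
  rw [one_mul, norm_pow, norm_pow]
  exact pow_le_pow_of_le_one (norm_nonneg _) (mem_ball_zero_iff.1 hy).le hmn

/-- A cubic polynomial without constant term that is `O(y ^ 4)` at `0` vanishes. -/
lemma coeffs_eq_zero_of_isBigO {a b c : ℝ}
    (h : (fun y : ℝ => a * y + b * y ^ 2 + c * y ^ 3) =O[𝓝 0] fun y => y ^ 4) :
    a = 0 ∧ b = 0 ∧ c = 0 := by
  have ha : a = 0 := by
    simpa using eq_zero_of_pow_mul_isBigO (g := fun y => a + y * (b + c * y)) (k := 1)
      (by fun_prop) ((h.trans (isBigO_pow_pow (by norm_num))).congr_left fun y => by ring)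
  subst ha
  have hb : b = 0 := by
    simpa using eq_zero_of_pow_mul_isBigO (g := fun y => b + y * c) (k := 2)
      (by fun_prop) ((h.trans (isBigO_pow_pow (by norm_num))).congr_left fun y => by ring)
  subst hb
  have hc : c = 0 := by
    simpa using eq_zero_of_pow_mul_isBigO (g := fun _ => c) (k := 3)
      (by fun_prop) (h.congr_left fun y => by ring)
  exact ⟨rfl, rfl, hc⟩

/-- Reversion of the series `b₁ x + b₃ x³ + O(x⁴)` up to third order. -/
lemma inverse_series_coeffs {f w : ℝ → ℝ} {b₁ b₃ a₁ a₂ a₃ a₄ : ℝ}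
    (hf : (fun x => f x - (b₁ * x + b₃ * x ^ 3)) =O[𝓝 0] fun x => x ^ 4)
    (hw : (fun y => w y - (a₁ * y + a₂ * y ^ 2 + a₃ * y ^ 3 + a₄ * y ^ 4)) =O[𝓝 0] fun y => y ^ 5)
    (hw0 : Tendsto w (𝓝 0) (𝓝 0)) (hinv : ∀ᶠ y in 𝓝 0, f (w y) = y) :
    b₁ * a₁ = 1 ∧ b₁ * a₂ = 0 ∧ b₁ * a₃ + b₃ * a₁ ^ 3 = 0 := by
  have hmono : ∀ {m n : ℕ} (c : ℝ), m ≤ n → (fun y : ℝ => c * y ^ n) =O[𝓝 0] fun y => y ^ m :=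
    fun c hmn => (isBigO_pow_pow hmn).const_mul_left c
  have hw4 : (fun y => w y - (a₁ * y + a₂ * y ^ 2 + a₃ * y ^ 3)) =O[𝓝 0] fun y => y ^ 4 :=
    ((hw.trans (isBigO_pow_pow (by norm_num))).add (hmono (m := 4) (n := 4) a₄ le_rfl)).congr_left
      fun y => by ring
  have hw2 : (fun y => w y - a₁ * y) =O[𝓝 0] fun y => y ^ 2 :=
    (((hw4.trans (isBigO_pow_pow (by norm_num))).add (hmono (m := 2) (n := 2) a₂ le_rfl)).add
      (hmono (m := 2) (n := 3) a₃ (by norm_num))).congr_left fun y => by ring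
  have hw1 : w =O[𝓝 0] fun y => y ^ 1 :=
    ((hw2.trans (isBigO_pow_pow (by norm_num))).add (hmono (m := 1) (n := 1) a₁ le_rfl)).congr_left
      fun y => by ring
  have hcube : (fun y => w y ^ 3 - (a₁ * y) ^ 3) =O[𝓝 0] fun y => y ^ 4 := by
    have hq : (fun y => w y * w y + a₁ * (w y * y ^ 1) + a₁ ^ 2 * y ^ 2) =O[𝓝 0]
        fun y => y ^ 2 := by
      refine ((?_ : (fun y => w y * w y) =O[𝓝 0] fun y => y ^ 2).add
        (((hw1.mul (isBigO_pow_pow (m := 1) (n := 1) le_rfl)).const_mul_left a₁).congr_right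
          fun y => by ring)).add (hmono (m := 2) (n := 2) _ le_rfl)
      exact (hw1.mul hw1).congr_right fun y => by ring
    exact (hw2.mul hq).congr (fun y => by ring) (fun y => by ring)
  have hfw : (fun y => f (w y) - (b₁ * w y + b₃ * w y ^ 3)) =O[𝓝 0] fun y => y ^ 4 :=
    (hf.comp_tendsto hw0).trans ((hw1.pow 4).congr_right fun y => by ring)
  have hid : (fun y => y - (b₁ * w y + b₃ * w y ^ 3)) =O[𝓝 0] fun y => y ^ 4 :=
    hfw.congr' (hinv.mono fun y hy => by simp only [hy]) EventuallyEq.rfl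
  have key := coeffs_eq_zero_of_isBigO (a := b₁ * a₁ - 1) (b := b₁ * a₂)
    (c := b₁ * a₃ + b₃ * a₁ ^ 3)
    (((hid.add (hw4.const_mul_left b₁)).add (hcube.const_mul_left b₃)).neg_left.congr_left
      fun y => by ring)
  exact ⟨by linarith [key.1], key.2.1, key.2.2⟩

/-- A smooth solution of Burgers' equation is constant along characteristics. -/
lemma burgers_const_along_characteristic {u : ℝ → ℝ → ℝ} {t₀ T : ℝ} {f : ℝ → ℝ}
    (hu : ContDiffOn ℝ (⊤ : ℕ∞) (fun p : ℝ × ℝ => u p.1 p.2) (Ico t₀ T ×ˢ univ))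
    (hpde : ∀ t ∈ Ico t₀ T, ∀ x : ℝ,
      deriv (fun s => u s x) t = -(u t x) * deriv (fun y => u t y) x)
    (hinit : ∀ x, u t₀ x = f x) {t : ℝ} (ht : t ∈ Ico t₀ T) (y : ℝ) :
    u t (y + (t - t₀) * f y) = f y := by
  set P : ℝ × ℝ → ℝ := fun p => u p.1 p.2 with hP
  set S : Set (ℝ × ℝ) := Ico t₀ T ×ˢ univ with hS
  set c := f y with hc
  set γ : ℝ → ℝ × ℝ := fun s => (s, y + (s - t₀) * c) with hγ
  have hγc : Continuous γ := by fun_prop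
  have hmaps : MapsTo γ (Icc t₀ t) S := fun s hs => ⟨⟨hs.1, hs.2.trans_lt ht.2⟩, mem_univ _⟩
  have hF : ContinuousOn (fderivWithin ℝ P S) S :=
    hu.continuousOn_fderivWithin ((uniqueDiffOn_Ico _ _).prod uniqueDiffOn_univ)
      (by exact_mod_cast le_top)
  obtain ⟨K, hK⟩ := isCompact_Icc.exists_bound_of_continuousOn
    ((hF.comp hγc.continuousOn hmaps).clm_apply (continuousOn_const (c := ((0 : ℝ), (1 : ℝ)))))
  set h : ℝ → ℝ := fun s => (P (γ s) - c) ^ 2 * Real.exp (-(2 * K) * s) with hh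
  have hcont : ContinuousOn h (Icc t₀ t) :=
    (((hu.continuousOn.comp hγc.continuousOn hmaps).sub continuousOn_const).pow 2).mul
      (by fun_prop)
  have hder : ∀ s ∈ interior (Icc t₀ t), ∃ d ≤ 0, HasDerivAt h d s := by
    intro s hs
    rw [interior_Icc] at hs
    have hsS : γ s ∈ S := hmaps ⟨hs.1.le, hs.2.le⟩
    have hnhds : S ∈ 𝓝 (γ s) :=
      prod_mem_nhds (Ico_mem_nhds hs.1 (hs.2.trans ht.2)) univ_mem
    have hd : HasFDerivAt P (fderivWithin ℝ P S (γ s)) (γ s) :=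
      (((hu.differentiableOn (by simp)) _ hsS).hasFDerivWithinAt).hasFDerivAt hnhds
    set L := fderivWithin ℝ P S (γ s)
    have ht' : HasDerivAt (fun r => u r (y + (s - t₀) * c)) (L (1, 0)) s := by
      have := HasFDerivAt.comp_hasDerivAt (l := P) (f := fun r => (r, y + (s - t₀) * c)) s hd
        ((hasDerivAt_id s).prodMk (hasDerivAt_const _ _))
      exact this
    have hx' : HasDerivAt (fun z => u s z) (L (0, 1)) (y + (s - t₀) * c) := by
      have := HasFDerivAt.comp_hasDerivAt (l := P) (f := fun z => (s, z))
        (y + (s - t₀) * c) hd ((hasDerivAt_const _ s).prodMk (hasDerivAt_id _))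
      exact this
    have hpd := hpde s ⟨hs.1.le, hs.2.trans ht.2⟩ (y + (s - t₀) * c)
    rw [ht'.deriv, hx'.deriv] at hpd
    have hγ' : HasDerivAt γ (1, c) s := by
      have := (hasDerivAt_id s).prodMk ((((hasDerivAt_id s).sub_const t₀).mul_const c).const_add y)
      simpa using this
    have hg : HasDerivAt (fun r => P (γ r)) (L (1, c)) s := hd.comp_hasDerivAt s hγ'
    have hsplit : L (1, c) = L (1, 0) + c * L (0, 1) := by
      rw [← smul_eq_mul, ← map_smul, ← map_add]; simp
    have hexp : HasDerivAt (fun r => Real.exp (-(2 * K) * r))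
        (Real.exp (-(2 * K) * s) * (-(2 * K) * 1)) s :=
      ((hasDerivAt_id s).const_mul (-(2 * K))).exp
    refine ⟨_, ?_, ((hg.sub_const c).pow 2).mul hexp⟩
    have hKs : -L (0, 1) ≤ K := (neg_le_abs _).trans (hK s ⟨hs.1.le, hs.2.le⟩)
    have hv : P (γ s) = u s (y + (s - t₀) * c) := rfl
    rw [hsplit, hpd, hv]
    set v := u s (y + (s - t₀) * c)
    have : 0 ≤ 2 * Real.exp (-(2 * K) * s) * ((v - c) ^ 2 * (K + L (0, 1))) :=
      mul_nonneg (by positivity) (mul_nonneg (sq_nonneg _) (by linarith))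
    simp only [Nat.cast_ofNat, Pi.pow_apply, hv, Nat.add_one_sub_one, pow_one]
    linarith
  have hanti : AntitoneOn h (Icc t₀ t) := by
    refine antitoneOn_of_deriv_nonpos (convex_Icc _ _) hcont ?_ ?_
    · intro s hs
      obtain ⟨d, -, hd⟩ := hder s hs
      exact hd.differentiableAt.differentiableWithinAt
    · intro s hs
      obtain ⟨d, hd0, hd⟩ := hder s hs
      rw [hd.deriv]; exact hd0
  have hle := hanti (left_mem_Icc.2 ht.1) (right_mem_Icc.2 ht.1) ht.1
  have h0 : h t₀ = 0 := by simp [hh, hP, hγ, hinit, hc]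
  rw [h0] at hle
  have hsq : (P (γ t) - c) ^ 2 ≤ 0 :=
    nonpos_of_mul_nonpos_left hle (Real.exp_pos _)
  exact sub_eq_zero.1 (pow_eq_zero_iff two_ne_zero |>.1 (le_antisymm hsq (sq_nonneg _)))

/-- Comparison of an approximate root with the exact root of `-s U - β U³ = x`. -/
lemma perturbed_cubic_root_bound {β b K s u U x : ℝ} (hβ : 0 < β) (hs : 0 ≤ s)
    (hu : 8 * (|b| + K) * |u| ≤ 3 * β) (hu1 : |u| ≤ 1)
    (hR : |x - (-s * u - β * u ^ 3 + b * u ^ 4)| ≤ K * |u| ^ 5)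
    (hU : -s * U - β * U ^ 3 = x) (hK : 0 ≤ K) :
    |(u - U) * (s + 3 * β * U ^ 2) - b * U ^ 4| ≤
      (|b| * (60 * (4 * (|b| + K) / (3 * β))) + 32 * K
        + β * (64 * (4 * (|b| + K) / (3 * β)) ^ 2)) * |U| ^ 5 := by
  set B := 4 * (|b| + K) / (3 * β) with hB
  have hBβ : 3 * β * B = 4 * (|b| + K) := by rw [hB]; field_simp
  have hB0 : 0 ≤ B := by positivity
  obtain ⟨R, hRdef⟩ : ∃ R, R = x - (-s * u - β * u ^ 3 + b * u ^ 4) := ⟨_, rfl⟩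
  rw [← hRdef] at hR
  have hD : (u - U) * (s + β * (u ^ 2 + u * U + U ^ 2)) = b * u ^ 4 + R := by
    rw [hRdef, ← hU]; ring
  have hdiff : |u - U| ≤ B * u ^ 2 := by
    rcases eq_or_ne u 0 with rfl | hu0
    · have hR0 : R = 0 := by simpa using hR
      have : U * (s + β * U ^ 2) = 0 := by
        rw [hR0] at hD; linarith
      rcases mul_eq_zero.1 this with h | h
      · simp [h]
      · have : U ^ 2 = 0 := by
          have := mul_nonneg hβ.le (sq_nonneg U)
          have h2 : β * U ^ 2 = 0 := by linarith
          simpa [hβ.ne'] using h2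
        have : U = 0 := by simpa using this
        simp [this]
    · have hupos : 0 < u ^ 2 := by positivity
      have hlow : 3 / 4 * β * u ^ 2 ≤ s + β * (u ^ 2 + u * U + U ^ 2) := by
        nlinarith [mul_nonneg hβ.le (sq_nonneg (u / 2 + U))]
      have habs : |u - U| * (s + β * (u ^ 2 + u * U + U ^ 2)) ≤ (|b| + K) * u ^ 4 := by
        have h1 : |u - U| * (s + β * (u ^ 2 + u * U + U ^ 2)) = |b * u ^ 4 + R| := by
          rw [← hD, abs_mul, abs_of_nonneg (a := s + _) (le_trans (by positivity) hlow)]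
        have h4 : |u| ^ 4 = u ^ 4 := by rw [← abs_pow, abs_of_nonneg (by positivity)]
        have h5 : |u| ^ 5 ≤ u ^ 4 := by
          rw [← h4]; exact pow_le_pow_of_le_one (abs_nonneg _) hu1 (by norm_num)
        rw [h1]
        calc |b * u ^ 4 + R| ≤ |b * u ^ 4| + |R| := abs_add_le _ _
          _ ≤ |b| * u ^ 4 + K * u ^ 4 := by
            rw [abs_mul, abs_of_nonneg (a := u ^ 4) (by positivity)]
            gcongr
            exact hR.trans (by gcongr)
          _ = (|b| + K) * u ^ 4 := by ring
      have h2 : |u - U| * (3 / 4 * β * u ^ 2) ≤ (|b| + K) * u ^ 4 :=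
        (mul_le_mul_of_nonneg_left hlow (abs_nonneg _)).trans habs
      have h3 : 3 / 4 * β * u ^ 2 * |u - U| ≤ 3 / 4 * β * u ^ 2 * (B * u ^ 2) := by
        calc _ = |u - U| * (3 / 4 * β * u ^ 2) := by ring
          _ ≤ _ := h2
          _ = (4 * (|b| + K)) / 4 * u ^ 4 := by ring
          _ = _ := by rw [← hBβ]; ring
      exact le_of_mul_le_mul_left h3 (by positivity)
  have hBu : B * |u| ≤ 1 / 2 := by
    have : 3 * β * (B * |u|) ≤ 3 * β * (1 / 2) := by
      rw [← mul_assoc, hBβ]; linarith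
    exact le_of_mul_le_mul_left this (by positivity)
  have hhalf : |u - U| ≤ |u| / 2 := by
    rw [← sq_abs u] at hdiff
    nlinarith [abs_nonneg u]
  have huU : |u| ≤ 2 * |U| := by
    have := abs_sub_abs_le_abs_sub u U
    linarith
  have hdU : |u - U| ≤ 4 * B * |U| ^ 2 := by
    refine hdiff.trans ?_
    rw [← sq_abs u]
    have : |u| ^ 2 ≤ (2 * |U|) ^ 2 := by gcongr
    nlinarith
  have hid : (u - U) * (s + 3 * β * U ^ 2) - b * U ^ 4 =
      b * ((u - U) * ((u + U) * (u ^ 2 + U ^ 2))) + R - β * ((u - U) ^ 2 * (u + 2 * U)) := by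
    linear_combination hD
  have e1 : |b * ((u - U) * ((u + U) * (u ^ 2 + U ^ 2)))| ≤ |b| * (60 * B) * |U| ^ 5 := by
    have h1 : |u + U| ≤ 3 * |U| := (abs_add_le _ _).trans (by linarith)
    have h2 : |u ^ 2 + U ^ 2| ≤ 5 * |U| ^ 2 := by
      rw [abs_of_nonneg (by positivity), ← sq_abs u, ← sq_abs U]
      nlinarith [abs_nonneg u, abs_nonneg U]
    rw [abs_mul, abs_mul, abs_mul]
    calc _ ≤ |b| * (4 * B * |U| ^ 2 * (3 * |U| * (5 * |U| ^ 2))) := by gcongr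
      _ = _ := by ring
  have e2 : |R| ≤ 32 * K * |U| ^ 5 := by
    calc |R| ≤ K * |u| ^ 5 := hR
      _ ≤ K * (2 * |U|) ^ 5 := by gcongr
      _ = _ := by ring
  have e3 : |β * ((u - U) ^ 2 * (u + 2 * U))| ≤ β * (64 * B ^ 2) * |U| ^ 5 := by
    have h1 : |u + 2 * U| ≤ 4 * |U| := by
      refine (abs_add_le _ _).trans ?_
      rw [abs_mul, abs_two]; linarith
    rw [abs_mul, abs_mul, abs_pow, abs_of_pos hβ]
    calc _ ≤ β * ((4 * B * |U| ^ 2) ^ 2 * (4 * |U|)) := by gcongr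
      _ = _ := by ring
  rw [hid]
  calc _ ≤ |b * ((u - U) * ((u + U) * (u ^ 2 + U ^ 2))) + R|
        + |β * ((u - U) ^ 2 * (u + 2 * U))| := abs_sub _ _
    _ ≤ |b * ((u - U) * ((u + U) * (u ^ 2 + U ^ 2)))| + |R|
        + |β * ((u - U) ^ 2 * (u + 2 * U))| := by gcongr; exact abs_add_le _ _
    _ ≤ _ := by linarith

lemma cubic_root_bounds {β S m : ℝ} (hβ : 0 < β) (hS : 0 < S) (hm : 0 < m) :
    ∃ r > 0, ∃ B, ∀ s U x : ℝ, 0 ≤ s → s ≤ S → m ≤ |x| → |x| ≤ 1 → -s * U - β * U ^ 3 = x →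
      r ≤ |U| ∧ |U| ≤ B := by
  refine ⟨m / (S + β * (1 + 1 / β) ^ 2), by positivity, 1 + 1 / β, fun s U x hs hsS hmx hx1 h => ?_⟩
  have habs : |U| * (s + β * |U| ^ 2) = |x| := by
    rw [← h, show -s * U - β * U ^ 3 = -(U * (s + β * U ^ 2)) by ring, abs_neg, abs_mul,
      abs_of_nonneg (a := s + _) (by positivity), sq_abs]
  have hB : |U| ≤ 1 + 1 / β := by
    rcases le_or_gt |U| 1 with h1 | h1
    · have : 0 < 1 / β := by positivity
      linarith
    · have h2 : β * |U| ≤ 1 := by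
        have h3 : |U| * 1 ≤ |U| * |U| ^ 2 := by gcongr; nlinarith
        have := mul_nonneg (abs_nonneg U) hs
        nlinarith
      have : |U| ≤ 1 / β := by rw [le_div_iff₀ hβ]; linarith
      linarith
  refine ⟨?_, hB⟩
  rw [div_le_iff₀ (by positivity)]
  calc m ≤ |x| := hmx
    _ = |U| * (s + β * |U| ^ 2) := habs.symm
    _ ≤ _ := by gcongr

/-- Before the blow-up time, characteristics starting at `y ≥ δ` stay away from `0`. -/
lemma characteristic_lower_bound {f : ℝ → ℝ} (hf : Differentiable ℝ f) (hf0 : f 0 = 0) {d t₀ : ℝ}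
    (hd : d < 0) (ht₀ : t₀ = d⁻¹) (hd' : ∀ y > 0, d < deriv f y) {δ : ℝ} (hδ : 0 < δ) :
    ∃ m > 0, ∀ t ∈ Ico t₀ 0, ∀ y, δ ≤ y → m ≤ y + (t - t₀) * f y := by
  have ht₀neg : t₀ < 0 := ht₀ ▸ inv_lt_zero.2 hd
  have hmono : StrictMonoOn (fun y => y + -t₀ * f y) (Ici 0) := by
    refine strictMonoOn_of_deriv_pos (convex_Ici 0)
      (continuous_id.add (continuous_const.mul hf.continuous)).continuousOn fun y hy => ?_
    rw [interior_Ici] at hy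
    have hder : HasDerivAt (fun y => y + -t₀ * f y) (1 + -t₀ * deriv f y) y :=
      (hasDerivAt_id y).add ((hf y).hasDerivAt.const_mul _)
    rw [hder.deriv]
    have h1 : t₀ * d = 1 := by rw [ht₀]; exact inv_mul_cancel₀ hd.ne
    nlinarith [hd' y hy]
  have hpos : 0 < δ + -t₀ * f δ := by
    simpa [hf0] using hmono (mem_Ici.2 le_rfl) (mem_Ici.2 hδ.le) hδ
  refine ⟨min δ (δ + -t₀ * f δ), lt_min hδ hpos, fun t ht y hy => ?_⟩
  rcases le_or_gt 0 (f y) with h | h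
  · have := mul_nonneg (sub_nonneg.2 ht.1) h
    exact (min_le_left _ _).trans (by linarith)
  · have h1 := hmono.monotoneOn (mem_Ici.2 hδ.le) (mem_Ici.2 (hδ.le.trans hy)) hy
    exact (min_le_right _ _).trans (by nlinarith [ht.2])

/-- Two-sided version of `characteristic_lower_bound`. -/
lemma abs_characteristic_lower_bound {f : ℝ → ℝ} (hf : Differentiable ℝ f) (hf0 : f 0 = 0)
    {d t₀ : ℝ} (hd : d < 0) (ht₀ : t₀ = d⁻¹) (hd' : ∀ y, y ≠ 0 → d < deriv f y) {δ : ℝ}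
    (hδ : 0 < δ) :
    ∃ m > 0, ∀ t ∈ Ico t₀ 0, ∀ y, δ ≤ |y| → m ≤ |y + (t - t₀) * f y| := by
  obtain ⟨m₁, hm₁, h₁⟩ := characteristic_lower_bound hf hf0 hd ht₀ (fun y hy => hd' y hy.ne') hδ
  have hneg : ∀ y, HasDerivAt (fun z => -f (-z)) (deriv f (-y)) y := fun y => by
    have h : HasDerivAt (fun z => -f (-z)) (-(deriv f (-y) * -1)) y :=
      ((hf (-y)).hasDerivAt.comp y (hasDerivAt_neg y)).neg
    simpa using h
  obtain ⟨m₂, hm₂, h₂⟩ := characteristic_lower_bound (f := fun z => -f (-z))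
    (fun y => (hneg y).differentiableAt) (by simp [hf0]) hd ht₀
    (fun y hy => by rw [(hneg y).deriv]; exact hd' _ (neg_ne_zero.2 hy.ne')) hδ
  refine ⟨min m₁ m₂, lt_min hm₁ hm₂, fun t ht y hy => ?_⟩
  rcases le_abs'.1 hy with h | h
  · have h3 := h₂ t ht (-y) (by linarith)
    rw [neg_neg] at h3
    exact (min_le_right _ _).trans (le_trans (by linarith) (neg_le_abs _))
  · exact (min_le_left _ _).trans ((h₁ t ht y h).trans (le_abs_self _))

lemma surjective_id_add_const_mul {f : ℝ → ℝ} (hf : Continuous f) {M : ℝ} (hM : ∀ y, |f y| ≤ M)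
    (a : ℝ) : Function.Surjective fun y => y + a * f y := by
  have hb : ∀ y, |a * f y| ≤ |a| * M := fun y => by
    rw [abs_mul]; exact mul_le_mul_of_nonneg_left (hM y) (abs_nonneg a)
  refine Continuous.surjective (by fun_prop) ?_ ?_
  · exact tendsto_atTop_add_right_of_le _ _ tendsto_id fun y => (abs_le.1 (hb y)).1
  · exact tendsto_atBot_add_right_of_ge _ _ tendsto_id fun y => (abs_le.1 (hb y)).2

lemma exists_abs_bound_of_eventually_const {f : ℝ → ℝ} (hf : Continuous f) {c L : ℝ}
    (hc : ∀ x, x ∉ Icc (-L) L → f x = c) : ∃ M, ∀ x, |f x| ≤ M := by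
  obtain ⟨M, hM⟩ := isCompact_Icc.exists_bound_of_continuousOn (hf.continuousOn (s := Icc (-L) L))
  refine ⟨max M |c|, fun x => ?_⟩
  by_cases hx : x ∈ Icc (-L) L
  · exact (hM x hx).trans (le_max_left _ _)
  · rw [hc x hx]; exact le_max_right _ _

/-- A continuous right inverse of a function with nonzero derivative is a local left inverse. -/
lemma eventually_leftInverse_of_rightInverse {f w : ℝ → ℝ} {f' : ℝ} (hf : HasStrictDerivAt f f' 0)
    (hf' : f' ≠ 0) (hf0 : f 0 = 0) (hw : Tendsto w (𝓝 0) (𝓝 0))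
    (hinv : ∀ᶠ v in 𝓝 0, f (w v) = v) : ∀ᶠ y in 𝓝 0, w (f y) = y := by
  have hleft := (hf.hasStrictFDerivAt_equiv hf').eventually_left_inverse
  have hft : Tendsto f (𝓝 0) (𝓝 0) := by simpa [hf0] using hf.hasDerivAt.continuousAt.tendsto
  filter_upwards [hleft, (hw.comp hft).eventually hleft, hft.eventually hinv] with y h1 h2 h3
  simp only [Function.comp_apply, h3] at h2
  exact h2.symm.trans h1

/-- Local Taylor expansion of the inverse at a nondegenerate minimum of the derivative. -/
lemma inverse_taylor_at_min_deriv {f w : ℝ → ℝ} {ε : ℝ} (hf : ContDiff ℝ (⊤ : ℕ∞) f)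
    (hneg : deriv f 0 < 0) (hmin : ∀ x, deriv f 0 ≤ deriv f x) (hf0 : f 0 = 0)
    (hε : 0 < ε) (hw : ContDiffOn ℝ (⊤ : ℕ∞) w (Ioo (-ε) ε))
    (hinv : ∀ y : ℝ, |y| < ε → f (w y) = y) (hw0 : w 0 = 0) :
    (fun y => w y - ((deriv f 0)⁻¹ * y - ((deriv f 0)⁻¹ ^ 4 * iteratedDeriv 3 f 0 / 6) * y ^ 3
      + iteratedDeriv 4 w 0 / 24 * y ^ 4)) =O[𝓝 0] fun y => y ^ 5 := by
  have h0 : (0 : ℝ) ∈ Ioo (-ε) ε := by simp [hε]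
  have hTw := isBigO_sub_taylor isOpen_Ioo (convex_Ioo _ _) h0 hw 4
  have hTf := isBigO_sub_taylor isOpen_univ convex_univ (mem_univ _) hf.contDiffOn 3
  have hf2 : iteratedDeriv 2 f 0 = 0 := by
    rw [iteratedDeriv_succ, iteratedDeriv_one]
    exact IsLocalMin.deriv_eq_zero (Eventually.of_forall hmin)
  simp only [Finset.sum_range_succ, Finset.sum_range_zero, iteratedDeriv_zero, hw0, hf0, hf2,
    iteratedDeriv_one] at hTw hTf
  have hwt : Tendsto w (𝓝 0) (𝓝 0) := by
    simpa [hw0] using (hw.continuousOn.continuousAt (isOpen_Ioo.mem_nhds h0)).tendsto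
  have hinv' : ∀ᶠ y in 𝓝 0, f (w y) = y := by
    filter_upwards [isOpen_Ioo.mem_nhds h0] with y hy
    exact hinv y (abs_lt.2 hy)
  have hTw' := hTw.congr_left (f₂ := fun y => w y - (deriv w 0 * y + iteratedDeriv 2 w 0 / 2 * y ^ 2
    + iteratedDeriv 3 w 0 / 6 * y ^ 3 + iteratedDeriv 4 w 0 / 24 * y ^ 4))
    fun y => by simp only [Nat.factorial]; push_cast; ring
  have hTf' := hTf.congr_left (f₂ := fun x => f x - (deriv f 0 * x
    + iteratedDeriv 3 f 0 / 6 * x ^ 3)) fun y => by simp only [Nat.factorial]; push_cast; ring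
  obtain ⟨e1, e2, e3⟩ := inverse_series_coeffs hTf' hTw' hwt hinv'
  have c1 : deriv w 0 = (deriv f 0)⁻¹ := eq_inv_of_mul_eq_one_right e1
  have c2 : iteratedDeriv 2 w 0 / 2 = 0 := (mul_eq_zero.1 e2).resolve_left hneg.ne
  have c3 : iteratedDeriv 3 w 0 / 6 = -((deriv f 0)⁻¹ ^ 4 * iteratedDeriv 3 f 0 / 6) := by
    rw [c1] at e3
    have hne := hneg.ne
    field_simp at e3 ⊢
    linarith
  rw [c1, c2, c3] at hTw'
  exact hTw'.congr_left fun y => by ring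

/-- Corollary 2.5: second-order homogeneous expansion of the inviscid solution:
`|u⁰ - 𝔲 - β₄ 𝔲⁴ 𝔪| ≲ |𝔲|⁵ 𝔪` on `[t₀,0) × [-1,1]`. -/
theorem statement12
    (uInit : ℝ → ℝ) (cInit LInit : ℝ) (hL : 0 < LInit)
    (h_smooth : ContDiff ℝ (⊤ : ℕ∞) uInit)
    (h_const : ∀ x : ℝ, x ∉ Set.Icc (-LInit) LInit → uInit x = cInit)
    (h_neg : deriv uInit 0 < 0)
    (h_min : ∀ x : ℝ, deriv uInit 0 ≤ deriv uInit x)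
    (h_uniq : ∀ x : ℝ, deriv uInit x = deriv uInit 0 → x = 0)
    (h_nondeg : 0 < iteratedDeriv 3 uInit 0)
    (h_val : uInit 0 = 0)
    (t₀ : ℝ) (ht₀ : t₀ = (deriv uInit 0)⁻¹)
    (β₃ : ℝ) (hβ₃ : β₃ = t₀ ^ 4 * iteratedDeriv 3 uInit 0 / 6)
    (ω₀ : ℝ → ℝ) (ε : ℝ) (hε : 0 < ε)
    (hω₀_smooth : ContDiffOn ℝ (⊤ : ℕ∞) ω₀ (Set.Ioo (-ε) ε))
    (hω₀_inv : ∀ y : ℝ, |y| < ε → uInit (ω₀ y) = y)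
    (hω₀_zero : ω₀ 0 = 0)
    (β₄ : ℝ) (hβ₄ : β₄ = iteratedDeriv 4 ω₀ 0 / 24)
    (uu mm : ℝ → ℝ → ℝ)
    (huu : ∀ t : ℝ, t < 0 → ∀ x : ℝ, t * uu t x - β₃ * uu t x ^ 3 = x)
    (hmm : ∀ t x : ℝ, mm t x = (|t| + 3 * β₃ * uu t x ^ 2)⁻¹)
    (u0 : ℝ → ℝ → ℝ)
    (hu0_smooth : ContDiffOn ℝ (⊤ : ℕ∞) (fun p : ℝ × ℝ => u0 p.1 p.2)
      (Set.Ico t₀ 0 ×ˢ (Set.univ : Set ℝ)))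
    (hu0_pde : ∀ t ∈ Set.Ico t₀ (0:ℝ), ∀ x : ℝ,
      deriv (fun s => u0 s x) t = -(u0 t x) * deriv (fun y => u0 t y) x)
    (hu0_init : ∀ x : ℝ, u0 t₀ x = uInit x) :
    ∃ C : ℝ, ∀ t ∈ Set.Ico t₀ (0:ℝ), ∀ x ∈ Set.Icc (-1:ℝ) 1,
      |u0 t x - uu t x - β₄ * uu t x ^ 4 * mm t x| ≤ C * |uu t x| ^ 5 * mm t x := by
  have hinit_cont := h_smooth.continuous
  have hdiff : Differentiable ℝ uInit := h_smooth.differentiable (by simp)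
  have ht₀neg : t₀ < 0 := ht₀ ▸ inv_lt_zero.2 h_neg
  have hβ₃pos : 0 < β₃ := by
    have := ht₀neg.ne
    rw [hβ₃]; positivity
  obtain ⟨M, hM⟩ := exists_abs_bound_of_eventually_const hinit_cont h_const
  have hzero : (0 : ℝ) ∈ Ioo (-ε) ε := by simp [hε]
  have hω_tendsto : Tendsto ω₀ (𝓝 0) (𝓝 0) := by
    simpa [hω₀_zero] using
      (hω₀_smooth.continuousOn.continuousAt (isOpen_Ioo.mem_nhds hzero)).tendsto
  have hu_tendsto : Tendsto uInit (𝓝 0) (𝓝 0) := by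
    simpa [h_val] using hinit_cont.tendsto 0
  have hinv : ∀ᶠ v in 𝓝 0, uInit (ω₀ v) = v := by
    filter_upwards [isOpen_Ioo.mem_nhds hzero] with v hv
    exact hω₀_inv v (abs_lt.2 hv)
  have hleft : ∀ᶠ y in 𝓝 0, ω₀ (uInit y) = y :=
    eventually_leftInverse_of_rightInverse
      (h_smooth.contDiffAt.hasStrictDerivAt (by simp)) h_neg.ne h_val hω_tendsto hinv
  obtain ⟨K, hKpos, hK⟩ := (inverse_taylor_at_min_deriv h_smooth h_neg h_min h_val hε hω₀_smooth
    hω₀_inv hω₀_zero).exists_pos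
  rw [← ht₀, ← hβ₃, ← hβ₄] at hK
  have hsmall : ∀ᶠ v in 𝓝 (0 : ℝ), 8 * (|β₄| + K) * |v| < 3 * β₃ := by
    have hc : Continuous fun v : ℝ => 8 * (|β₄| + K) * |v| := by fun_prop
    exact hc.tendsto 0 |>.eventually (gt_mem_nhds (by simpa using hβ₃pos))
  have hone : ∀ᶠ v in 𝓝 (0 : ℝ), |v| < 1 :=
    continuous_abs.tendsto 0 |>.eventually (gt_mem_nhds (by simp))
  obtain ⟨δ, hδ, hnear⟩ := Metric.eventually_nhds_iff.1
    (hleft.and (hu_tendsto.eventually (hK.bound.and (hsmall.and hone))))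
  obtain ⟨m, hm, hfar⟩ := abs_characteristic_lower_bound hdiff h_val h_neg ht₀
    (fun y hy => lt_of_le_of_ne (h_min y) fun h => hy (h_uniq y h.symm)) hδ
  obtain ⟨r, hr, B, hB⟩ := cubic_root_bounds hβ₃pos (neg_pos.2 ht₀neg) hm
  set C₁ := |β₄| * (60 * (4 * (|β₄| + K) / (3 * β₃))) + 32 * K
        + β₃ * (64 * (4 * (|β₄| + K) / (3 * β₃)) ^ 2)
  set Q := (M + B) * (-t₀ + 3 * β₃ * B ^ 2) + |β₄| * B ^ 4 with hQ
  refine ⟨max C₁ (Q / r ^ 5), fun t ht x hx => ?_⟩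
  have ht0 : t < 0 := ht.2
  obtain ⟨y, hy⟩ := surjective_id_add_const_mul hinit_cont hM (t - t₀) x
  simp only at hy
  have hu : u0 t x = uInit y := by
    rw [← hy]; exact burgers_const_along_characteristic hu0_smooth hu0_pde hu0_init ht y
  have hU : -(-t) * uu t x - β₃ * uu t x ^ 3 = x := by rw [neg_neg]; exact huu t ht0 x
  have hkey : |(u0 t x - uu t x) * (-t + 3 * β₃ * uu t x ^ 2) - β₄ * uu t x ^ 4|
      ≤ max C₁ (Q / r ^ 5) * |uu t x| ^ 5 := by
    rw [hu]
    rcases lt_or_ge |y| δ with hyδ | hyδ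
    · obtain ⟨h1, h2, h3, h4⟩ := hnear (y := y) (by simpa using hyδ)
      rw [h1, norm_pow, Real.norm_eq_abs, Real.norm_eq_abs] at h2
      refine (perturbed_cubic_root_bound hβ₃pos (by linarith) h3.le h4.le ?_ hU hKpos.le).trans ?_
      · refine le_of_eq_of_le ?_ h2
        congr 1
        linear_combination -hy
      · gcongr
        exact le_max_left _ _
    · have hmx : m ≤ |x| := hy ▸ hfar t ht y hyδ
      obtain ⟨hrU, hUB⟩ := hB (-t) (uu t x) x (by linarith) (by linarith [ht.1]) hmx
        (abs_le.2 hx) hU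
      have hB0 : 0 ≤ B := (abs_nonneg _).trans hUB
      have hM0 : 0 ≤ M := (abs_nonneg _).trans (hM 0)
      have hQ0 : 0 ≤ Q := by
        have := neg_pos.2 ht₀neg
        positivity
      have hD : |-t + 3 * β₃ * uu t x ^ 2| ≤ -t₀ + 3 * β₃ * B ^ 2 := by
        rw [abs_of_nonneg (add_nonneg (by linarith) (by positivity)), ← sq_abs (uu t x)]
        have := ht.1
        gcongr
      calc |(uInit y - uu t x) * (-t + 3 * β₃ * uu t x ^ 2) - β₄ * uu t x ^ 4|
          ≤ |(uInit y - uu t x) * (-t + 3 * β₃ * uu t x ^ 2)| + |β₄ * uu t x ^ 4| := abs_sub _ _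
        _ ≤ Q := by
          rw [abs_mul, abs_mul, abs_pow]
          have : |uInit y - uu t x| ≤ M + B := (abs_sub _ _).trans (add_le_add (hM y) hUB)
          rw [hQ]
          gcongr
        _ = Q / r ^ 5 * r ^ 5 := by field_simp
        _ ≤ max C₁ (Q / r ^ 5) * |uu t x| ^ 5 := by
          gcongr
          exact le_max_right _ _
  have hDpos : 0 < -t + 3 * β₃ * uu t x ^ 2 := add_pos_of_pos_of_nonneg (by linarith) (by positivity)
  rw [hmm, abs_of_neg ht0]
  calc |u0 t x - uu t x - β₄ * uu t x ^ 4 * (-t + 3 * β₃ * uu t x ^ 2)⁻¹|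
      = |(u0 t x - uu t x) * (-t + 3 * β₃ * uu t x ^ 2) - β₄ * uu t x ^ 4|
        * (-t + 3 * β₃ * uu t x ^ 2)⁻¹ := by
        rw [← abs_of_pos (inv_pos.2 hDpos), ← abs_mul, abs_of_pos (inv_pos.2 hDpos), sub_mul,
          mul_assoc (u0 t x - uu t x), mul_inv_cancel₀ hDpos.ne', mul_one]
    _ ≤ _ := mul_le_mul_of_nonneg_right hkey (inv_pos.2 hDpos).le
end

section
/- Corollary 2.7 (sharp slope asymptotics near shock formation): (i) For every t < 0, sup_{x∈ℝ} |∂ₓ𝔲(t,x)| = 1/|t| (equivalently sup_{x∈ℝ} 𝔪(t,x) = 1/|t|). (ii) There exists a constant C, depending only on ů, such that for all t ∈ [t₀,0): | sup_{x∈ℝ} |∂ₓu⁰(t,x)| − 1/|t| | ≤ C·|t|^(−1/2). -/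
open Set

/-- A cubic inverse branch `u` with `t * u - β * u ^ 3 = x` has slope `(t - 3 β u²)⁻¹`. -/
lemma hasDerivAt_cubic_inverse {t β : ℝ} (ht : t < 0) (hβ : 0 ≤ β) {u : ℝ → ℝ}
    (hu : ∀ x, t * u x - β * u x ^ 3 = x) (x : ℝ) :
    HasDerivAt u (t - 3 * β * u x ^ 2)⁻¹ x := by
  have hlip : ∀ a b, |u a - u b| ≤ (-t)⁻¹ * |a - b| := by
    intro a b
    have hpos : 0 < -t := by linarith
    have hq : 0 ≤ u a ^ 2 + u a * u b + u b ^ 2 := by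
      nlinarith [sq_nonneg (u a + u b), sq_nonneg (u a), sq_nonneg (u b)]
    have hβq := mul_nonneg hβ hq
    have h1 : a - b = -((-t + β * (u a ^ 2 + u a * u b + u b ^ 2)) * (u a - u b)) := by
      linear_combination hu b - hu a
    have h2 : |a - b| = (-t + β * (u a ^ 2 + u a * u b + u b ^ 2)) * |u a - u b| := by
      rw [h1, abs_neg, abs_mul, abs_of_nonneg (by linarith)]
    rw [inv_mul_eq_div, le_div_iff₀ hpos, h2]
    nlinarith [abs_nonneg (u a - u b)]
  have hcont : ContinuousAt u x := by
    have : LipschitzWith (Real.toNNReal (-t)⁻¹) u := by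
      refine LipschitzWith.of_dist_le_mul fun a b => ?_
      rw [Real.dist_eq, Real.dist_eq, Real.coe_toNNReal _ (inv_nonneg.2 (by linarith))]
      exact hlip a b
    exact this.continuous.continuousAt
  have hne : t - 3 * β * u x ^ 2 ≠ 0 := by
    have := mul_nonneg hβ (sq_nonneg (u x))
    intro h
    linarith
  have hφ : HasDerivAt (fun v : ℝ => t * v - β * v ^ 3) (t - 3 * β * u x ^ 2) (u x) := by
    have h := ((hasDerivAt_id (u x)).const_mul t).sub (((hasDerivAt_id (u x)).pow 3).const_mul β)
    exact h.congr_deriv (by simp only [id, Nat.cast_ofNat]; ring)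
  exact hφ.of_local_left_inverse hcont hne (Filter.Eventually.of_forall hu)

/-- If `f` is maximal at `a`, its supremum is `f a`. -/
lemma ciSup_eq_of_forall_le_apply {ι : Type*} {f : ι → ℝ} (a : ι) (h : ∀ x, f x ≤ f a) :
    ⨆ x, f x = f a := by
  have : Nonempty ι := ⟨a⟩
  exact le_antisymm (ciSup_le h) (le_ciSup ⟨f a, by rintro _ ⟨x, rfl⟩; exact h x⟩ a)

lemma iSup_abs_deriv_cubic_inverse {t β : ℝ} (ht : t < 0) (hβ : 0 ≤ β) {u : ℝ → ℝ}
    (hu : ∀ x, t * u x - β * u x ^ 3 = x) :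
    ⨆ x, |deriv u x| = 1 / |t| := by
  have hd : ∀ x, |deriv u x| = (|t| + 3 * β * u x ^ 2)⁻¹ := by
    intro x
    have := mul_nonneg hβ (sq_nonneg (u x))
    rw [(hasDerivAt_cubic_inverse ht hβ hu x).deriv, abs_inv, abs_of_neg ht,
      abs_of_neg (by linarith)]
    congr 1
    ring
  have h0 : u 0 = 0 := by
    have h1 : (t - β * u 0 ^ 2) * u 0 = 0 := by linear_combination hu 0
    have h2 : t - β * u 0 ^ 2 ≠ 0 := by
      have := mul_nonneg hβ (sq_nonneg (u 0))
      intro h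
      linarith
    exact (mul_eq_zero.1 h1).resolve_left h2
  have hat : |deriv u 0| = 1 / |t| := by
    rw [hd, h0]
    simp
  rw [← hat]
  refine ciSup_eq_of_forall_le_apply (f := fun x => |deriv u x|) 0 fun x => ?_
  simp only [hat]
  rw [hd, one_div]
  have := mul_nonneg hβ (sq_nonneg (u x))
  exact inv_anti₀ (abs_pos.2 ht.ne) (by linarith)

/-- A smooth solution of the inviscid Burgers equation is constant along characteristics. -/
lemma burgers_implicit {t₀ T : ℝ} {u : ℝ → ℝ → ℝ}
    (hu : ContDiffOn ℝ (⊤ : ℕ∞) (fun p : ℝ × ℝ => u p.1 p.2) (Ico t₀ T ×ˢ univ))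
    (hpde : ∀ t ∈ Ioo t₀ T, ∀ x : ℝ,
      deriv (fun s => u s x) t = -(u t x) * deriv (fun y => u t y) x)
    {t : ℝ} (ht : t ∈ Ico t₀ T) (x : ℝ) :
    u t x = u t₀ (x - (t - t₀) * u t x) := by
  set c := u t x with hc
  set S : Set (ℝ × ℝ) := Ico t₀ T ×ˢ univ
  set U : ℝ × ℝ → ℝ := fun p => u p.1 p.2 with hU
  have hSu : UniqueDiffOn ℝ S := (uniqueDiffOn_Ico t₀ T).prod uniqueDiffOn_univ
  have hD : ContinuousOn (fderivWithin ℝ U S) S := hu.continuousOn_fderivWithin hSu (by simp)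
  set γ : ℝ → ℝ × ℝ := fun r => (t - r, x - r * c) with hγ
  have hγc : Continuous γ := by fun_prop
  have hγm : MapsTo γ (Icc 0 (t - t₀)) S := by
    intro r hr
    refine ⟨⟨?_, ?_⟩, mem_univ _⟩
    · simp only [hγ]; linarith [hr.2]
    · simp only [hγ]; linarith [hr.1, ht.2]
  obtain ⟨K, hK⟩ := isCompact_Icc.exists_bound_of_continuousOn (hD.comp hγc.continuousOn hγm)
  have hder : ∀ r ∈ Ico 0 (t - t₀), HasDerivAt (fun r => U (γ r) - c)
      ((U (γ r) - c) * fderivWithin ℝ U S (γ r) (0, 1)) r := by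
    intro r hr
    have hmem : γ r ∈ S := hγm ⟨hr.1, hr.2.le⟩
    have hI : (γ r).1 ∈ Ioo t₀ T := by
      constructor <;> simp only [hγ] <;> linarith [hr.1, hr.2, ht.2]
    have hnhds : S ∈ nhds (γ r) :=
      prod_mem_nhds (Ico_mem_nhds hI.1 hI.2) Filter.univ_mem
    have hdiff : HasFDerivAt U (fderivWithin ℝ U S (γ r)) (γ r) :=
      (((hu _ hmem).differentiableWithinAt (by simp)).hasFDerivWithinAt).hasFDerivAt hnhds
    set L := fderivWithin ℝ U S (γ r)
    have hs : HasDerivAt (fun s => u s (γ r).2) (L (1, 0)) (γ r).1 :=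
      HasFDerivAt.comp_hasDerivAt (f := fun s : ℝ => (s, (γ r).2)) (γ r).1 hdiff
        ((hasDerivAt_id _).prodMk (hasDerivAt_const _ _))
    have hy : HasDerivAt (fun y => u (γ r).1 y) (L (0, 1)) (γ r).2 :=
      HasFDerivAt.comp_hasDerivAt (f := fun y : ℝ => ((γ r).1, y)) (γ r).2 hdiff
        ((hasDerivAt_const _ _).prodMk (hasDerivAt_id _))
    have hp := hpde _ hI (γ r).2
    rw [hs.deriv, hy.deriv] at hp
    have hγd : HasDerivAt γ (-1, -c) r := by
      refine HasDerivAt.prodMk ?_ ?_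
      · simpa using (hasDerivAt_id r).const_sub t
      · simpa using ((hasDerivAt_id r).mul_const c).const_sub x
    have hcomp := (hdiff.comp_hasDerivAt r hγd).sub_const c
    refine hcomp.congr_deriv ?_
    have hsplit : ((-1, -c) : ℝ × ℝ) = (-1 : ℝ) • (1, 0) + (-c) • (0, 1) := by
      ext <;> simp
    rw [hsplit, map_add, map_smul, map_smul, hp]
    simp only [hU, smul_eq_mul]
    ring
  have hcont : ContinuousOn (fun r => U (γ r) - c) (Icc 0 (t - t₀)) :=
    (hu.continuousOn.comp hγc.continuousOn hγm).sub continuousOn_const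
  have hgr := norm_le_gronwallBound_of_norm_deriv_right_le (δ := 0) (K := K * ‖((0, 1) : ℝ × ℝ)‖)
    (ε := 0) hcont (fun r hr => (hder r hr).hasDerivWithinAt) (by simp [hU, hγ, hc])
    (fun r hr => by
      rw [norm_mul, add_zero, mul_comm]
      refine mul_le_mul_of_nonneg_right ?_ (norm_nonneg _)
      exact (ContinuousLinearMap.le_opNorm _ _).trans
        (mul_le_mul_of_nonneg_right (hK r ⟨hr.1, hr.2.le⟩) (norm_nonneg _)))
    (t - t₀) ⟨by linarith [ht.1], le_rfl⟩
  rw [sub_zero, gronwallBound_ε0_δ0] at hgr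
  have h0 := norm_le_zero_iff.1 hgr
  simp only [hU, hγ, sub_sub_cancel] at h0
  linarith

/-- The derivative of a smooth function that is constant off a compact interval is bounded. -/
lemma exists_deriv_le_of_const_off_Icc {f : ℝ → ℝ} {c L : ℝ} (hf : ContDiff ℝ (⊤ : ℕ∞) f)
    (hc : ∀ x, x ∉ Icc (-L) L → f x = c) :
    ∃ M, 0 ≤ M ∧ ∀ x, deriv f x ≤ M := by
  obtain ⟨M, hM⟩ := (isCompact_Icc (a := -L) (b := L)).exists_bound_of_continuousOn
    (hf.continuous_deriv (by simp)).continuousOn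
  refine ⟨max M 0, le_max_right _ _, fun x => ?_⟩
  by_cases hx : x ∈ Icc (-L) L
  · exact (le_abs_self _).trans ((hM x hx).trans (le_max_left _ _))
  · have : f =ᶠ[nhds x] fun _ => c := by
      filter_upwards [isClosed_Icc.isOpen_compl.mem_nhds hx] with y hy using hc y hy
    rw [this.deriv_eq]
    simp

/-- Corollary 2.7: sharp slope asymptotics near shock formation:
`sup_x |∂ₓ𝔲(t,x)| = 1/|t|`, and `sup_x |∂ₓu⁰(t,x)| = 1/|t| + O(|t|^(-1/2))`. -/
theorem statement13
    (uInit : ℝ → ℝ) (cInit LInit : ℝ) (hL : 0 < LInit)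
    (h_smooth : ContDiff ℝ (⊤ : ℕ∞) uInit)
    (h_const : ∀ x : ℝ, x ∉ Set.Icc (-LInit) LInit → uInit x = cInit)
    (h_neg : deriv uInit 0 < 0)
    (h_min : ∀ x : ℝ, deriv uInit 0 ≤ deriv uInit x)
    (h_uniq : ∀ x : ℝ, deriv uInit x = deriv uInit 0 → x = 0)
    (h_nondeg : 0 < iteratedDeriv 3 uInit 0)
    (h_val : uInit 0 = 0)
    (t₀ : ℝ) (ht₀ : t₀ = (deriv uInit 0)⁻¹)
    (β₃ : ℝ) (hβ₃ : β₃ = t₀ ^ 4 * iteratedDeriv 3 uInit 0 / 6)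
    (uu mm : ℝ → ℝ → ℝ)
    (huu : ∀ t : ℝ, t < 0 → ∀ x : ℝ, t * uu t x - β₃ * uu t x ^ 3 = x)
    (hmm : ∀ t x : ℝ, mm t x = (|t| + 3 * β₃ * uu t x ^ 2)⁻¹)
    (u0 : ℝ → ℝ → ℝ)
    (hu0_smooth : ContDiffOn ℝ (⊤ : ℕ∞) (fun p : ℝ × ℝ => u0 p.1 p.2)
      (Set.Ico t₀ 0 ×ˢ (Set.univ : Set ℝ)))
    (hu0_pde : ∀ t ∈ Set.Ico t₀ (0:ℝ), ∀ x : ℝ,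
      deriv (fun s => u0 s x) t = -(u0 t x) * deriv (fun y => u0 t y) x)
    (hu0_init : ∀ x : ℝ, u0 t₀ x = uInit x) :
    (∀ t : ℝ, t < 0 → (⨆ x : ℝ, |deriv (fun y => uu t y) x|) = 1 / |t|) ∧
    (∃ C : ℝ, ∀ t ∈ Set.Ico t₀ (0:ℝ),
      abs ((⨆ x : ℝ, |deriv (fun y => u0 t y) x|) - 1 / |t|) ≤ C * |t| ^ (-(1:ℝ)/2)) := by
  have ht₀neg : t₀ < 0 := ht₀ ▸ inv_lt_zero.2 h_neg
  have ht₀ne : t₀ ≠ 0 := ht₀neg.ne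
  have hinit : deriv uInit 0 = t₀⁻¹ := by rw [ht₀, inv_inv]
  have hβ : 0 ≤ β₃ := by rw [hβ₃]; positivity
  refine ⟨fun t ht => iSup_abs_deriv_cubic_inverse ht hβ (huu t ht), ?_⟩
  obtain ⟨M, hM0, hM⟩ := exists_deriv_le_of_const_off_Icc h_smooth h_const
  refine ⟨M * |t₀| ^ ((1 : ℝ) / 2), fun t ht => ?_⟩
  have htneg : t < 0 := ht.2
  have htne : t ≠ 0 := htneg.ne
  have hτ : 0 ≤ t - t₀ := sub_nonneg.2 ht.1
  have hdI : Differentiable ℝ uInit := h_smooth.differentiable (by simp)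
  have himp : ∀ x, u0 t x = uInit (x - (t - t₀) * u0 t x) := fun x => by
    rw [← hu0_init]
    exact burgers_implicit hu0_smooth (fun s hs => hu0_pde s (Ioo_subset_Ico_self hs)) ht x
  have hdx : Differentiable ℝ (u0 t) := by
    have hcomp : ContDiffOn ℝ (⊤ : ℕ∞) (fun y => u0 t y) univ :=
      hu0_smooth.comp (f := fun y : ℝ => (t, y)) (by fun_prop) (fun y _ => ⟨ht, mem_univ _⟩)
    exact (contDiffOn_univ.1 hcomp).differentiable (by simp)
  have hlow : ∀ y, t / t₀ ≤ 1 + (t - t₀) * deriv uInit y := by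
    intro y
    have h1 : (t - t₀) * t₀⁻¹ ≤ (t - t₀) * deriv uInit y :=
      mul_le_mul_of_nonneg_left (hinit ▸ h_min y) hτ
    have h2 : t / t₀ = 1 + (t - t₀) * t₀⁻¹ := by
      field_simp
      ring
    linarith
  have hq : 0 < t / t₀ := div_pos_of_neg_of_neg htneg ht₀neg
  have hslope : ∀ x, deriv (u0 t) x * (1 + (t - t₀) * deriv uInit (x - (t - t₀) * u0 t x)) =
      deriv uInit (x - (t - t₀) * u0 t x) := by
    intro x
    have h1 : HasDerivAt (fun x => x - (t - t₀) * u0 t x) (1 - (t - t₀) * deriv (u0 t) x) x :=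
      (hasDerivAt_id x).sub ((hdx x).hasDerivAt.const_mul _)
    have h2 := (hdI (x - (t - t₀) * u0 t x)).hasDerivAt.comp x h1
    have h3 : u0 t = uInit ∘ fun x => x - (t - t₀) * u0 t x := funext himp
    rw [← h3] at h2
    have h4 := (hdx x).hasDerivAt.unique h2
    linear_combination h4
  have hzero : u0 t 0 = 0 := by
    have hmono : StrictMono fun c => c - uInit (-(t - t₀) * c) := by
      refine strictMono_of_deriv_pos fun c => ?_
      have h1 : HasDerivAt (fun c => -(t - t₀) * c) (-(t - t₀)) c := by
        simpa using (hasDerivAt_id c).const_mul (-(t - t₀))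
      have h2 := (hasDerivAt_id c).sub ((hdI (-(t - t₀) * c)).hasDerivAt.comp c h1)
      have h3 : deriv (fun c => c - uInit (-(t - t₀) * c)) c =
          1 - deriv uInit (-(t - t₀) * c) * -(t - t₀) := h2.deriv
      rw [h3]
      linarith [hlow (-(t - t₀) * c)]
    refine hmono.injective ?_
    have h0 := himp 0
    rw [zero_sub, ← neg_mul] at h0
    simp only [mul_zero, h_val, sub_zero]
    linarith
  have hmin : deriv (u0 t) 0 = 1 / t := by
    have h := hslope 0
    rw [hzero, mul_zero, sub_zero, hinit] at h
    have h' : 1 + (t - t₀) * t₀⁻¹ = t * t₀⁻¹ := by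
      field_simp
      ring
    rw [h', ← mul_assoc] at h
    rw [eq_div_iff htne]
    exact mul_right_cancel₀ (inv_ne_zero ht₀ne) (h.trans (one_mul _).symm)
  have hbound : ∀ x, |deriv (u0 t) x| ≤ 1 / |t| + M := by
    intro x
    have hs := hslope x
    set p := deriv uInit (x - (t - t₀) * u0 t x)
    set v := deriv (u0 t) x
    have hD : t / t₀ ≤ 1 + (t - t₀) * p := hlow _
    have hpM : p ≤ M := hM _
    have hpm : t₀⁻¹ ≤ p := hinit ▸ h_min _
    have hDpos : 0 < 1 + (t - t₀) * p := hq.trans_le hD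
    have ht_inv : 0 < 1 / |t| := one_div_pos.2 (abs_pos.2 htneg.ne)
    rw [abs_le]
    constructor
    · have h1 : 1 / t ≤ v := by
        have h2 : 1 / t * (1 + (t - t₀) * p) ≤ v * (1 + (t - t₀) * p) := by
          rw [hs, ← sub_nonneg]
          have h3 : p - 1 / t * (1 + (t - t₀) * p) = t₀ / t * (p - t₀⁻¹) := by
            field_simp
            ring
          rw [h3]
          exact mul_nonneg (div_pos_of_neg_of_neg ht₀neg htneg).le (sub_nonneg.2 hpm)
        exact le_of_mul_le_mul_right h2 hDpos
      have h4 : 1 / t = -(1 / |t|) := by rw [abs_of_neg htneg, div_neg, neg_neg]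
      linarith
    · have h1 : v ≤ M := by
        refine le_of_mul_le_mul_right ?_ hDpos
        rw [hs]
        rcases le_or_gt 0 p with h | h
        · nlinarith [mul_nonneg hM0 (mul_nonneg hτ h)]
        · exact h.le.trans (mul_nonneg hM0 hDpos.le)
      linarith
  have hsup_le : (⨆ x : ℝ, |deriv (u0 t) x|) ≤ 1 / |t| + M := ciSup_le hbound
  have hsup_ge : 1 / |t| ≤ ⨆ x : ℝ, |deriv (u0 t) x| := by
    have h := le_ciSup (f := fun x => |deriv (u0 t) x|)
      ⟨1 / |t| + M, by rintro _ ⟨x, rfl⟩; exact hbound x⟩ 0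
    simp only [hmin, abs_div, abs_one] at h
    exact h
  have habs : |t| ≤ |t₀| := by
    rw [abs_of_neg htneg, abs_of_neg ht₀neg]
    linarith
  have hpow : 1 ≤ |t₀| ^ ((1 : ℝ) / 2) * |t| ^ (-(1 : ℝ) / 2) := by
    have htpos : 0 < |t| := abs_pos.2 htneg.ne
    rw [neg_div, Real.rpow_neg htpos.le, ← div_eq_mul_inv,
      one_le_div (Real.rpow_pos_of_pos htpos _)]
    exact Real.rpow_le_rpow htpos.le habs (by norm_num)
  have hfin : abs ((⨆ x : ℝ, |deriv (u0 t) x|) - 1 / |t|) ≤ M := by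
    rw [abs_of_nonneg (by linarith)]
    linarith
  refine hfin.trans ?_
  rw [mul_assoc]
  exact le_mul_of_one_le_right hM0 hpow
end

section
/- Explicit leading homogeneous corrector u₁,₀ (Section 3.3): The function v(t,x) := −6·β₃·𝔲(t,x)·𝔪(t,x)² is smooth on (−∞,0) × ℝ, is homogeneous of degree −3 (i.e. v(λ²·t, λ³·x) = λ⁻³·v(t,x) for all λ > 0 and all (t,x)), and solves ∂ₜv = −∂ₓ(𝔲·v) + ∂ₓ²𝔲 on (−∞,0) × ℝ. Moreover it is the unique such function: if ṽ is smooth on (−∞,0) × ℝ, satisfies ṽ(λ²·t, λ³·x) = λ⁻³·ṽ(t,x) for all λ > 0 and all (t,x), and solves ∂ₜṽ = −∂ₓ(𝔲·ṽ) + ∂ₓ²𝔲, then ṽ = v. -/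
open Set

open Filter Topology

theorem cubicMap_strictAnti {β t : ℝ} (hβ : 0 < β) (ht : t < 0) :
    StrictAnti fun u : ℝ => t * u - β * u ^ 3 := fun a b hab => by
  have h : a ^ 3 < b ^ 3 := (Odd.strictMono_pow (by decide : Odd 3)) hab
  have h₁ := mul_lt_mul_of_pos_left h hβ
  have h₂ := mul_lt_mul_of_neg_left hab ht
  dsimp only
  linarith

theorem cubicMap_deriv_neg {β t : ℝ} (hβ : 0 < β) (ht : t < 0) (u : ℝ) :
    t - 3 * β * u ^ 2 < 0 := by
  have : 0 ≤ 3 * β * u ^ 2 := by positivity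
  linarith

/-- The derivative at `(t, u)` of `(t, u) ↦ (t, t u - β u³)`, written in terms of `a = u` and
`b = t - 3 β u²`. -/
noncomputable def shearEquiv (a b : ℝ) (hb : b ≠ 0) : (ℝ × ℝ) ≃L[ℝ] (ℝ × ℝ) :=
  ContinuousLinearEquiv.equivOfInverse
    ((ContinuousLinearMap.fst ℝ ℝ ℝ).prod
      (a • ContinuousLinearMap.fst ℝ ℝ ℝ + b • ContinuousLinearMap.snd ℝ ℝ ℝ))
    ((ContinuousLinearMap.fst ℝ ℝ ℝ).prod
      (b⁻¹ • (ContinuousLinearMap.snd ℝ ℝ ℝ - a • ContinuousLinearMap.fst ℝ ℝ ℝ)))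
    (fun p => by ext <;> simp [hb])
    (fun p => by ext <;> simp [hb])

section CubicInverse

variable {β : ℝ} {uu : ℝ → ℝ → ℝ}

theorem cubicInverse_apply (hβ : 0 < β)
    (huu : ∀ t : ℝ, t < 0 → ∀ x : ℝ, t * uu t x - β * uu t x ^ 3 = x)
    {t : ℝ} (ht : t < 0) (u : ℝ) : uu t (t * u - β * u ^ 3) = u :=
  (cubicMap_strictAnti hβ ht).injective (huu t ht _)

theorem contDiffAt_cubicInverse (hβ : 0 < β)
    (huu : ∀ t : ℝ, t < 0 → ∀ x : ℝ, t * uu t x - β * uu t x ^ 3 = x)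
    {t : ℝ} (ht : t < 0) (x : ℝ) :
    ContDiffAt ℝ (⊤ : ℕ∞) (fun p : ℝ × ℝ => uu p.1 p.2) (t, x) := by
  let F : ℝ × ℝ → ℝ × ℝ := fun p => (p.1, p.1 * p.2 - β * p.2 ^ 3)
  have hF : ContDiffAt ℝ (⊤ : ℕ∞) F (t, uu t x) := by fun_prop
  have hF' : HasFDerivAt F
      (shearEquiv (uu t x) (t - 3 * β * uu t x ^ 2) (cubicMap_deriv_neg hβ ht _).ne :
        (ℝ × ℝ) →L[ℝ] (ℝ × ℝ)) (t, uu t x) := by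
    have h₁ : HasFDerivAt (fun p : ℝ × ℝ => p.1) (ContinuousLinearMap.fst ℝ ℝ ℝ) (t, uu t x) :=
      hasFDerivAt_fst
    have h₂ : HasFDerivAt (fun p : ℝ × ℝ => p.2) (ContinuousLinearMap.snd ℝ ℝ ℝ) (t, uu t x) :=
      hasFDerivAt_snd
    convert! h₁.prodMk ((h₁.mul h₂).sub ((h₂.pow 3).const_mul β)) using 1
    ext <;> simp [shearEquiv]
    ring
  have hn : ((⊤ : ℕ∞) : WithTop ℕ∞) ≠ 0 := by simp
  have himage : F (t, uu t x) = (t, x) := Prod.ext rfl (huu t ht x)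
  have hleft : ∀ᶠ p in 𝓝 (t, uu t x), (fun q : ℝ × ℝ => (q.1, uu q.1 q.2)) (F p) = p := by
    filter_upwards [(isOpen_Iio.preimage continuous_fst).mem_nhds (show (t, uu t x).1 < 0 from ht)]
      with p hp
    exact Prod.ext rfl (cubicInverse_apply hβ huu hp p.2)
  have hsmooth := (hF.to_localInverse hF' hn).congr_of_eventuallyEq
    ((hF.hasStrictFDerivAt' hF' hn).localInverse_unique
      (g := fun q : ℝ × ℝ => (q.1, uu q.1 q.2)) hleft)
  rw [himage] at hsmooth
  exact contDiffAt_snd.comp _ hsmooth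

theorem hasDerivAt_cubicInverse_right (hβ : 0 < β)
    (huu : ∀ t : ℝ, t < 0 → ∀ x : ℝ, t * uu t x - β * uu t x ^ 3 = x)
    {t : ℝ} (ht : t < 0) (x : ℝ) :
    HasDerivAt (uu t) (t - 3 * β * uu t x ^ 2)⁻¹ x := by
  have hd : DifferentiableAt ℝ (fun y => uu t y) x :=
    DifferentiableAt.comp x (f := fun y : ℝ => (t, y))
      ((contDiffAt_cubicInverse hβ huu ht x).differentiableAt (by simp)) (by fun_prop)
  have h := hd.hasDerivAt
  have heq := ((h.const_mul t).sub ((h.pow 3).const_mul β)).unique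
    ((hasDerivAt_id x).congr_of_eventuallyEq (.of_forall fun y => huu t ht y))
  convert! h using 1
  refine (eq_inv_of_mul_eq_one_left ?_).symm
  push_cast at heq
  linear_combination heq

theorem hasDerivAt_cubicInverse_left (hβ : 0 < β)
    (huu : ∀ t : ℝ, t < 0 → ∀ x : ℝ, t * uu t x - β * uu t x ^ 3 = x)
    {t : ℝ} (ht : t < 0) (x : ℝ) :
    HasDerivAt (fun s => uu s x) (-uu t x * (t - 3 * β * uu t x ^ 2)⁻¹) t := by
  have hd : DifferentiableAt ℝ (fun s => uu s x) t :=
    DifferentiableAt.comp t (f := fun s : ℝ => (s, x))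
      ((contDiffAt_cubicInverse hβ huu ht x).differentiableAt (by simp)) (by fun_prop)
  have h := hd.hasDerivAt
  have heq := (((hasDerivAt_id t).mul h).sub ((h.pow 3).const_mul β)).unique
    ((hasDerivAt_const t x).congr_of_eventuallyEq
      (eventually_of_mem (Iio_mem_nhds ht) fun s hs => huu s hs x))
  convert! h using 1
  rw [← div_eq_mul_inv, div_eq_iff (cubicMap_deriv_neg hβ ht _).ne]
  push_cast at heq
  simp only [id] at heq
  linear_combination -heq

theorem cubicInverse_homogeneous (hβ : 0 < β)
    (huu : ∀ t : ℝ, t < 0 → ∀ x : ℝ, t * uu t x - β * uu t x ^ 3 = x)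
    {lam : ℝ} (hlam : 0 < lam) {t : ℝ} (ht : t < 0) (x : ℝ) :
    uu (lam ^ 2 * t) (lam ^ 3 * x) = lam * uu t x := by
  have hneg : lam ^ 2 * t < 0 := mul_neg_of_pos_of_neg (by positivity) ht
  rw [← cubicInverse_apply hβ huu hneg (lam * uu t x)]
  congr 1
  linear_combination -lam ^ 3 * huu t ht x

theorem hasDerivAt_along_curve {d : ℝ → ℝ → ℝ} {γ : ℝ → ℝ} {γ' t : ℝ}
    (hd : DifferentiableAt ℝ (fun p : ℝ × ℝ => d p.1 p.2) (t, γ t)) (hγ : HasDerivAt γ γ' t) :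
    HasDerivAt (fun s => d s (γ s))
      (deriv (fun s => d s (γ t)) t + γ' * deriv (fun y => d t y) (γ t)) t := by
  have h := hd.hasFDerivAt
  have h₁ := h.comp_hasDerivAt t ((hasDerivAt_id t).prodMk (hasDerivAt_const t (γ t)))
  have h₂ := h.comp_hasDerivAt (γ t) ((hasDerivAt_const (γ t) t).prodMk (hasDerivAt_id (γ t)))
  have h₃ := h.comp_hasDerivAt t ((hasDerivAt_id t).prodMk hγ)
  rw [show deriv (fun s => d s (γ t)) t = _ from h₁.deriv,
    show deriv (fun y => d t y) (γ t) = _ from h₂.deriv]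
  convert! h₃ using 1
  rw [← smul_eq_mul, ← map_smul, ← map_add]
  simp

/-- A differentiable solution of the transport equation, homogeneous of degree `-3`, vanishes:
along the characteristics `x = t u - β u³` the quantity `(3 β u² - t) d` is constant, hence it is
a continuous function of `u` that is homogeneous of degree `-1`. -/
theorem eq_zero_of_transport_of_homogeneous (hβ : 0 < β)
    (huu : ∀ t : ℝ, t < 0 → ∀ x : ℝ, t * uu t x - β * uu t x ^ 3 = x)
    {d : ℝ → ℝ → ℝ}
    (hd : ∀ t : ℝ, t < 0 → ∀ x : ℝ, DifferentiableAt ℝ (fun p : ℝ × ℝ => d p.1 p.2) (t, x))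
    (hhom : ∀ lam : ℝ, 0 < lam → ∀ t : ℝ, t < 0 → ∀ x : ℝ,
      d (lam ^ 2 * t) (lam ^ 3 * x) = (lam ^ 3)⁻¹ * d t x)
    (heq : ∀ t : ℝ, t < 0 → ∀ x : ℝ,
      deriv (fun s => d s x) t = -deriv (fun y => uu t y * d t y) x)
    {t : ℝ} (ht : t < 0) (x : ℝ) : d t x = 0 := by
  let G : ℝ → ℝ → ℝ := fun s u => d s (s * u - β * u ^ 3) * (s - 3 * β * u ^ 2)
  have hG (u s : ℝ) (hs : s < 0) : HasDerivAt (fun s => G s u) 0 s := by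
    have hγ : HasDerivAt (fun s : ℝ => s * u - β * u ^ 3) u s := by
      simpa using ((hasDerivAt_id s).mul_const u).sub_const (β * u ^ 3)
    have hdy : DifferentiableAt ℝ (fun y => d s y) (s * u - β * u ^ 3) :=
      DifferentiableAt.comp _ (f := fun y : ℝ => (s, y)) (hd s hs _) (by fun_prop)
    have hprod := (hasDerivAt_cubicInverse_right hβ huu hs (s * u - β * u ^ 3)).mul hdy.hasDerivAt
    have h₀ := heq s hs (s * u - β * u ^ 3)
    rw [show deriv (fun y => uu s y * d s y) (s * u - β * u ^ 3) = _ from hprod.deriv,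
      cubicInverse_apply hβ huu hs] at h₀
    have h := (hasDerivAt_along_curve (hd s hs _) hγ).mul
      ((hasDerivAt_id s).sub_const (3 * β * u ^ 2))
    convert! h using 1
    have hne := (cubicMap_deriv_neg hβ hs u).ne
    rw [h₀]
    simp only [id]
    field_simp
    ring
  have hconst (u s r : ℝ) (hs : s < 0) (hr : r < 0) : G s u = G r u :=
    isOpen_Iio.is_const_of_deriv_eq_zero isPreconnected_Iio
      (fun z hz => (hG u z hz).differentiableAt.differentiableWithinAt)
      (fun z hz => (hG u z hz).deriv) hs hr
  have hscale (u lam : ℝ) (hlam : 0 < lam) : lam * G (-1) (lam * u) = G (-1) u := by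
    have hneg : lam ^ 2 * (-1) < 0 := mul_neg_of_pos_of_neg (by positivity) (by norm_num)
    have h := hhom lam hlam (-1) (by norm_num) (-1 * u - β * u ^ 3)
    rw [hconst (lam * u) (-1) (lam ^ 2 * (-1)) (by norm_num) hneg]
    simp only [G]
    rw [show lam ^ 2 * (-1) * (lam * u) - β * (lam * u) ^ 3
      = lam ^ 3 * (-1 * u - β * u ^ 3) by ring, h]
    field_simp
  have hzero (u : ℝ) : G (-1) u = 0 := by
    have hcont : Continuous fun lam : ℝ => lam * G (-1) (lam * u) := by
      have hd' : Continuous fun y => d (-1) y := continuous_iff_continuousAt.2 fun y =>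
        ContinuousAt.comp (f := fun y : ℝ => ((-1 : ℝ), y))
          (hd (-1) (by norm_num) y).continuousAt (by fun_prop)
      simp only [G]
      fun_prop
    have hlim : Tendsto (fun lam : ℝ => lam * G (-1) (lam * u)) (𝓝[>] 0) (𝓝 0) := by
      simpa using (hcont.tendsto 0).mono_left nhdsWithin_le_nhds
    refine tendsto_nhds_unique (tendsto_const_nhds.congr' ?_) hlim
    filter_upwards [self_mem_nhdsWithin] with lam hlam using (hscale u lam hlam).symm
  have h := (hconst (uu t x) t (-1) ht (by norm_num)).trans (hzero _)
  simp only [G, huu t ht x] at h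
  exact (mul_eq_zero.1 h).resolve_right (cubicMap_deriv_neg hβ ht _).ne

end CubicInverse

/-- Section 3.3: the function `v = -6β₃ 𝔲 𝔪²` is the unique smooth
`(-3)`-homogeneous solution of `∂ₜv = -∂ₓ(𝔲 v) + ∂ₓ²𝔲` on `(-∞,0) × ℝ`. -/
theorem statement15
    (β₃ : ℝ) (hβ₃ : 0 < β₃)
    (uu mm : ℝ → ℝ → ℝ)
    (huu : ∀ t : ℝ, t < 0 → ∀ x : ℝ, t * uu t x - β₃ * uu t x ^ 3 = x)
    (hmm : ∀ t x : ℝ, mm t x = (|t| + 3 * β₃ * uu t x ^ 2)⁻¹)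
    (v : ℝ → ℝ → ℝ)
    (hv : ∀ t x : ℝ, v t x = -6 * β₃ * uu t x * mm t x ^ 2) :
    ContDiffOn ℝ (⊤ : ℕ∞) (fun p : ℝ × ℝ => v p.1 p.2)
      (Set.Iio 0 ×ˢ (Set.univ : Set ℝ)) ∧
    (∀ lam : ℝ, 0 < lam → ∀ t : ℝ, t < 0 → ∀ x : ℝ,
      v (lam ^ 2 * t) (lam ^ 3 * x) = (lam ^ 3)⁻¹ * v t x) ∧
    (∀ t : ℝ, t < 0 → ∀ x : ℝ,
      deriv (fun s => v s x) t
        = -(deriv (fun y => uu t y * v t y) x) + deriv (deriv (fun y => uu t y)) x) ∧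
    (∀ w : ℝ → ℝ → ℝ,
      ContDiffOn ℝ (⊤ : ℕ∞) (fun p : ℝ × ℝ => w p.1 p.2)
        (Set.Iio 0 ×ˢ (Set.univ : Set ℝ)) →
      (∀ lam : ℝ, 0 < lam → ∀ t : ℝ, t < 0 → ∀ x : ℝ,
        w (lam ^ 2 * t) (lam ^ 3 * x) = (lam ^ 3)⁻¹ * w t x) →
      (∀ t : ℝ, t < 0 → ∀ x : ℝ,
        deriv (fun s => w s x) t
          = -(deriv (fun y => uu t y * w t y) x) + deriv (deriv (fun y => uu t y)) x) →
      ∀ t : ℝ, t < 0 → ∀ x : ℝ, w t x = v t x) := by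
  have hden (t : ℝ) (ht : t < 0) (x : ℝ) : t - 3 * β₃ * uu t x ^ 2 ≠ 0 :=
    (cubicMap_deriv_neg hβ₃ ht _).ne
  have hvt (t : ℝ) (ht : t < 0) (x : ℝ) :
      v t x = -6 * β₃ * uu t x * ((t - 3 * β₃ * uu t x ^ 2)⁻¹) ^ 2 := by
    rw [hv, hmm, abs_of_neg ht, ← neg_sq (t - 3 * β₃ * uu t x ^ 2)⁻¹, ← inv_neg]
    ring
  have hvsmooth (t : ℝ) (ht : t < 0) (x : ℝ) :
      ContDiffAt ℝ (⊤ : ℕ∞) (fun p : ℝ × ℝ => v p.1 p.2) (t, x) := by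
    have hu := contDiffAt_cubicInverse hβ₃ huu ht x
    refine ((contDiffAt_const.mul hu).mul (((contDiffAt_fst.sub
      (contDiffAt_const.mul (hu.pow 2))).inv (hden t ht x)).pow 2)).congr_of_eventuallyEq
      (f := fun p : ℝ × ℝ => -6 * β₃ * uu p.1 p.2 * ((p.1 - 3 * β₃ * uu p.1 p.2 ^ 2)⁻¹) ^ 2) ?_
    filter_upwards [(isOpen_Iio.preimage continuous_fst).mem_nhds (show (t, x).1 < 0 from ht)]
      with p hp using hvt p.1 hp p.2
  have hvhom : ∀ lam : ℝ, 0 < lam → ∀ t : ℝ, t < 0 → ∀ x : ℝ,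
      v (lam ^ 2 * t) (lam ^ 3 * x) = (lam ^ 3)⁻¹ * v t x := by
    intro lam hlam t ht x
    rw [hvt _ (mul_neg_of_pos_of_neg (by positivity) ht), hvt t ht,
      cubicInverse_homogeneous hβ₃ huu hlam ht,
      show lam ^ 2 * t - 3 * β₃ * (lam * uu t x) ^ 2
        = lam ^ 2 * (t - 3 * β₃ * uu t x ^ 2) by ring]
    have := hden t ht x
    field_simp
  have hux (t : ℝ) (ht : t < 0) (x : ℝ) := hasDerivAt_cubicInverse_right hβ₃ huu ht x
  have hvpde : ∀ t : ℝ, t < 0 → ∀ x : ℝ,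
      deriv (fun s => v s x) t
        = -(deriv (fun y => uu t y * v t y) x) + deriv (deriv (fun y => uu t y)) x := by
    intro t ht x
    have hne := hden t ht x
    have hut := hasDerivAt_cubicInverse_left hβ₃ huu ht x
    have hmt := (((hasDerivAt_id t).sub ((hut.pow 2).const_mul (3 * β₃))).inv hne)
    have hmx := ((((hux t ht x).pow 2).const_mul (3 * β₃)).const_sub t).inv hne
    have h₁ : deriv (fun s => v s x) t = _ :=
      (((hut.const_mul (-6 * β₃)).mul (hmt.pow 2)).congr_of_eventuallyEq
        (eventually_of_mem (Iio_mem_nhds ht) fun s hs => hvt s hs x)).deriv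
    have h₂ : deriv (fun y => uu t y * v t y) x = _ :=
      ((hux t ht x).mul ((((hux t ht x).const_mul (-6 * β₃)).mul
        (hmx.pow 2)).congr_of_eventuallyEq (.of_forall fun y => hvt t ht y))).deriv
    have h₃ : deriv (deriv (fun y => uu t y)) x = _ :=
      (hmx.congr_of_eventuallyEq (.of_forall fun y => (hux t ht y).deriv)).deriv
    rw [h₁, h₂, h₃, hvt t ht x]
    simp only [Pi.inv_apply, Pi.pow_apply, Pi.sub_apply, id]
    generalize t - 3 * β₃ * uu t x ^ 2 = D at hne ⊢
    push_cast
    field_simp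
    ring
  refine ⟨fun p hp => (hvsmooth p.1 hp.1 p.2).contDiffWithinAt, hvhom, hvpde, ?_⟩
  intro w hw hwhom hwpde t ht x
  have hwd (s : ℝ) (hs : s < 0) (y : ℝ) :
      DifferentiableAt ℝ (fun p : ℝ × ℝ => w p.1 p.2) (s, y) :=
    (hw.contDiffAt (prod_mem_nhds (Iio_mem_nhds hs) univ_mem)).differentiableAt (by simp)
  have hvd (s : ℝ) (hs : s < 0) (y : ℝ) :
      DifferentiableAt ℝ (fun p : ℝ × ℝ => v p.1 p.2) (s, y) :=
    (hvsmooth s hs y).differentiableAt (by simp)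
  have hleft {f : ℝ → ℝ → ℝ} {s y : ℝ}
      (hf : DifferentiableAt ℝ (fun p : ℝ × ℝ => f p.1 p.2) (s, y)) :
      DifferentiableAt ℝ (fun r => f r y) s :=
    DifferentiableAt.comp s (f := fun r : ℝ => (r, y)) hf (by fun_prop)
  have hright {f : ℝ → ℝ → ℝ} {s y : ℝ}
      (hf : DifferentiableAt ℝ (fun p : ℝ × ℝ => f p.1 p.2) (s, y)) :
      DifferentiableAt ℝ (fun z => f s z) y :=
    DifferentiableAt.comp y (f := fun z : ℝ => (s, z)) hf (by fun_prop)
  refine sub_eq_zero.1 (eq_zero_of_transport_of_homogeneous hβ₃ huu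
    (d := fun s y => w s y - v s y) (fun s hs y => (hwd s hs y).sub (hvd s hs y)) ?_ ?_ ht x)
  · intro lam hlam s hs y
    rw [hwhom lam hlam s hs y, hvhom lam hlam s hs y, mul_sub]
  · intro s hs y
    have hu := (hux s hs y).differentiableAt
    simp only [mul_sub]
    rw [deriv_fun_sub (hleft (hwd s hs y)) (hleft (hvd s hs y)),
      deriv_fun_sub (hu.fun_mul (hright (hwd s hs y))) (hu.fun_mul (hright (hvd s hs y))),
      hwpde s hs y, hvpde s hs y]
    ring
end
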